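/- Let K be a quadratic field and let c ∈ K. Then f_c cannot simultaneously admit a point of exact period 3 in K and a point of exact period 4 in K; that is, there do not exist α, β ∈ K such that α has exact period 3 and β has exact period 4 under f_c. -/

import Mathlib

/-- The quadratic map `z ↦ z ^ 2 + c`. -/
def fc {K : Type*} [Field K] (c : K) : K → K := fun z => z ^ 2 + c

/-- `α` has exact period `m` under `fc c`. -/
def HasExactPeriod {K : Type*} [Field K] (c : K) (m : ℕ) (α : K) : Prop :=
  (fc c)^[m] α = α ∧ ∀ j : ℕ, 1 ≤ j → j < m → (fc c)^[j] α ≠ α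

/-- `α` has preperiodic type `m_n` under `fc c`: preperiod exactly `n`, eventual period `m`. -/
def HasPreperiodicType {K : Type*} [Field K] (c : K) (m n : ℕ) (α : K) : Prop :=
  HasExactPeriod c m ((fc c)^[n] α) ∧ (fc c)^[n + m - 1] α ≠ (fc c)^[n - 1] α

open WeierstrassCurve

/-- The Weierstrass curve `y ^ 2 = x ^ 3 + a * x ^ 2 + b * x + c`. -/
def cubicCurve {K : Type*} [CommRing K] (a b c : K) : WeierstrassCurve K := ⟨0, a, 0, b, c⟩

namespace CubicCurve

/-- The points of the curve `y ^ 2 = x ^ 3 + a * x ^ 2 + b * x + c`. -/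
abbrev Pt {K : Type*} [CommRing K] (a b c : K) := (cubicCurve a b c).toAffine.Point

theorem equation_iff {K : Type*} [Field K] {a b c x y : K} :
    (cubicCurve a b c).toAffine.Equation x y ↔ y ^ 2 = x ^ 3 + a * x ^ 2 + b * x + c := by
  rw [Affine.equation_iff]; simp [cubicCurve]

section Basic

variable {K : Type*} [Field K] {a b c : K} [(cubicCurve a b c).IsElliptic]

/-- The point with given coordinates. -/
def pt {x y : K} (h : y ^ 2 = x ^ 3 + a * x ^ 2 + b * x + c) : Pt a b c :=
  .some x y (Affine.equation_iff_nonsingular.1 (equation_iff.2 h))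

theorem eq_zero_or (P : Pt a b c) :
    P = 0 ∨ ∃ (x y : K) (h : y ^ 2 = x ^ 3 + a * x ^ 2 + b * x + c), P = pt h := by
  rcases P with _ | ⟨x, y, h⟩
  · exact .inl rfl
  · exact .inr ⟨x, y, equation_iff.1 h.1, rfl⟩

theorem pt_inj {x y x' y' : K} {h : y ^ 2 = x ^ 3 + a * x ^ 2 + b * x + c}
    {h' : y' ^ 2 = x' ^ 3 + a * x' ^ 2 + b * x' + c} :
    (pt h : Pt a b c) = pt h' ↔ x = x' ∧ y = y' := by
  simp [pt]

theorem neg_pt {x y : K} (h : y ^ 2 = x ^ 3 + a * x ^ 2 + b * x + c) :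
    -(pt h : Pt a b c) = pt (x := x) (y := -y) (by rw [neg_sq, h]) := by
  rw [pt, Affine.Point.neg_some, pt, Affine.Point.some.injEq]
  simp [Affine.negY, cubicCurve]

variable [DecidableEq K]

theorem pt_add_eq_zero {x y x' y' : K} {h : y ^ 2 = x ^ 3 + a * x ^ 2 + b * x + c}
    {h' : y' ^ 2 = x' ^ 3 + a * x' ^ 2 + b * x' + c} :
    (pt h : Pt a b c) + pt h' = 0 ↔ x = x' ∧ y = -y' := by
  rw [add_eq_zero_iff_eq_neg, neg_pt, pt_inj]

theorem add_chord {x₁ y₁ x₂ y₂ : K} (h₁ : y₁ ^ 2 = x₁ ^ 3 + a * x₁ ^ 2 + b * x₁ + c)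
    (h₂ : y₂ ^ 2 = x₂ ^ 3 + a * x₂ ^ 2 + b * x₂ + c) (hx : x₁ ≠ x₂) {l x y : K}
    (hl : l * (x₁ - x₂) = y₁ - y₂) (hx3 : x = l ^ 2 - a - x₁ - x₂)
    (hy3 : y = -(y₁ + l * (x - x₁))) :
    ∃ h : y ^ 2 = x ^ 3 + a * x ^ 2 + b * x + c, (pt h₁ : Pt a b c) + pt h₂ = pt h := by
  have hl' : (cubicCurve a b c).toAffine.slope x₁ x₂ y₁ y₂ = l := by
    rw [Affine.slope_of_X_ne hx, div_eq_iff (sub_ne_zero.2 hx), hl]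
  have key := Affine.Point.add_of_X_ne
    (h₁ := Affine.equation_iff_nonsingular.1 (equation_iff.2 h₁))
    (h₂ := Affine.equation_iff_nonsingular.1 (equation_iff.2 h₂)) hx
  have hX : (cubicCurve a b c).toAffine.addX x₁ x₂
      ((cubicCurve a b c).toAffine.slope x₁ x₂ y₁ y₂) = x := by
    rw [hl', hx3]; simp [Affine.addX, cubicCurve]
  have hY : (cubicCurve a b c).toAffine.addY x₁ x₂ y₁
      ((cubicCurve a b c).toAffine.slope x₁ x₂ y₁ y₂) = y := by
    rw [Affine.addY, Affine.negAddY, hX, hl', hy3]; simp [Affine.negY, cubicCurve]; ring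
  simp only [hX, hY] at key
  obtain ⟨hn, key⟩ : ∃ hn, _ = Affine.Point.some x y hn := ⟨_, key⟩
  exact ⟨equation_iff.1 hn.1, key⟩

theorem double {x₁ y₁ : K} (h₁ : y₁ ^ 2 = x₁ ^ 3 + a * x₁ ^ 2 + b * x₁ + c)
    (hy : 2 * y₁ ≠ 0) {l x y : K}
    (hl : l * (2 * y₁) = 3 * x₁ ^ 2 + 2 * a * x₁ + b) (hx3 : x = l ^ 2 - a - 2 * x₁)
    (hy3 : y = -(y₁ + l * (x - x₁))) :
    ∃ h : y ^ 2 = x ^ 3 + a * x ^ 2 + b * x + c, (pt h₁ : Pt a b c) + pt h₁ = pt h := by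
  have hne : y₁ ≠ (cubicCurve a b c).toAffine.negY x₁ y₁ := by
    intro h
    simp only [Affine.negY, cubicCurve] at h
    apply hy; linear_combination h
  have hl' : (cubicCurve a b c).toAffine.slope x₁ x₁ y₁ y₁ = l := by
    rw [Affine.slope_of_Y_ne rfl hne, div_eq_iff (sub_ne_zero.2 hne)]
    simp only [Affine.negY, cubicCurve]
    linear_combination -hl
  have key := Affine.Point.add_self_of_Y_ne
    (h₁ := Affine.equation_iff_nonsingular.1 (equation_iff.2 h₁)) hne
  have hX : (cubicCurve a b c).toAffine.addX x₁ x₁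
      ((cubicCurve a b c).toAffine.slope x₁ x₁ y₁ y₁) = x := by
    rw [hl', hx3]; simp [Affine.addX, cubicCurve]; ring
  have hY : (cubicCurve a b c).toAffine.addY x₁ x₁ y₁
      ((cubicCurve a b c).toAffine.slope x₁ x₁ y₁ y₁) = y := by
    rw [Affine.addY, Affine.negAddY, hX, hl', hy3]; simp [Affine.negY, cubicCurve]; ring
  simp only [hX, hY] at key
  obtain ⟨hn, key⟩ : ∃ hn, _ = Affine.Point.some x y hn := ⟨_, key⟩
  exact ⟨equation_iff.1 hn.1, key⟩

end Basic

section Finite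

open Height

/-- A group with a Northcott height that quadruples under doubling is finite as soon as
every element is the sum of a 2-torsion element and a double. -/
theorem finite_of_two_divisible {G : Type*} [AddCommGroup G] (h : G → ℝ)
    (hN : ∀ B, {P | h P ≤ B}.Finite) {C : ℝ} (hC : ∀ P, 4 * h P - C ≤ h (P + P))
    (hdiv : ∀ P, ∃ T Q : G, T + T = 0 ∧ P = T + (Q + Q)) : Finite G := by
  have hex : ∀ P : G, ∃ Q : G, (P + P) = (Q + Q) + (Q + Q) := fun P => by
    obtain ⟨T, Q, hT, rfl⟩ := hdiv P
    exact ⟨Q, by rw [add_add_add_comm, hT, zero_add]⟩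
  choose r hr using hex
  set M : ℝ := C / 3 + 1 with hM
  let D := {R : G // ∃ P, R = P + P}
  let ρ : D → D := fun R => ⟨r R.2.choose + r R.2.choose, _, rfl⟩
  have hρ2 : ∀ R : D, R.1 = (ρ R).1 + (ρ R).1 := fun R => by
    have := hr R.2.choose
    rw [← R.2.choose_spec] at this
    exact this
  have hρinj : Function.Injective ρ := fun R R' e => by
    apply Subtype.ext; rw [hρ2 R, hρ2 R', e]
  have hρh : ∀ R : D, 4 * h (ρ R).1 ≤ h R.1 + C := fun R => by
    have := hC (ρ R).1; rw [← hρ2] at this; linarith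
  have hρit : ∀ (n : ℕ) (R : D), h (ρ^[n] R).1 - C / 3 ≤ (h R.1 - C / 3) / 4 ^ n := by
    intro n
    induction n with
    | zero => intro P; simp
    | succ n ih =>
      intro P
      rw [Function.iterate_succ_apply']
      have h1 := hρh (ρ^[n] P)
      have h2 := ih P
      have h3 : (h P.1 - C / 3) / 4 ^ (n + 1) = (h P.1 - C / 3) / 4 ^ n / 4 := by
        rw [pow_succ, div_div]
      rw [h3]; linarith
  let S : Set D := {R | h R.1 ≤ M}
  have hSfin : S.Finite := (hN M).preimage Subtype.val_injective.injOn
  have hmaps : Set.MapsTo ρ S S := fun R hR => by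
    have := hρh R
    simp only [S, Set.mem_ofPred_eq] at hR ⊢
    linarith
  have hsurj : Set.SurjOn ρ S S :=
    ((Set.Finite.injOn_iff_bijOn_of_mapsTo hSfin hmaps).1 hρinj.injOn).surjOn
  have hall : ∀ R : D, R ∈ S := by
    intro R
    obtain ⟨n, hn⟩ := pow_unbounded_of_one_lt (h R.1 - C / 3) (by norm_num : (1 : ℝ) < 4)
    have hnS : ρ^[n] R ∈ S := by
      have h1 := hρit n R
      have h2 : (h R.1 - C / 3) / 4 ^ n ≤ 1 := (div_le_one (by positivity)).2 hn.le
      simp only [S, Set.mem_ofPred_eq]; linarith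
    obtain ⟨s, hs, hsR⟩ := hsurj.iterate n hnS
    rwa [← hρinj.iterate n hsR]
  have : ∀ P : G, h P ≤ (M + C) / 4 := fun P => by
    have h1 := hC P
    have h2 : h (P + P) ≤ M := hall ⟨P + P, P, rfl⟩
    linarith
  exact Set.finite_univ_iff.1 ((hN ((M + C) / 4)).subset fun P _ => this P)


open MvPolynomial in
theorem finite_pt {K : Type*} [Field K] [NumberField K] [DecidableEq K] {a b c : K}
    [(cubicCurve a b c).IsElliptic]
    (hdiv : ∀ P : Pt a b c, ∃ T Q : Pt a b c, T + T = 0 ∧ P = T + (Q + Q)) :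
    Finite (Pt a b c) := by
  obtain ⟨C₁, hC₁⟩ := abs_logHeight_addSubMap_sub_two_mul_logHeight_le (cubicCurve a b c)
  obtain ⟨C₂, hC₂⟩ := abs_logHeight_sym2_sub_le K
  let h : Pt a b c → ℝ := fun P => logHeight P.xRep
  have h0 : h 0 = 0 := by
    simp only [h, Affine.Point.xRep_zero]
    rw [logHeight_swap, ← logHeight₁_eq_logHeight, logHeight₁_zero]
  have hpt : ∀ {x y : K} (e : y ^ 2 = x ^ 3 + a * x ^ 2 + b * x + c),
      h (pt e) = logHeight₁ x := fun e => by
    simp [h, pt, Affine.Point.xRep_some, logHeight₁_eq_logHeight]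
  refine finite_of_two_divisible h (fun B => ?_) (C := C₁ + 3 * C₂) (fun P => ?_) hdiv
  · have h1 : {x : K | logHeight₁ x ≤ B}.Finite := Northcott.finite_le B
    have h2 : {P : Pt a b c | h P ≤ B} ⊆ {0} ∪ ⋃ x ∈ {x : K | logHeight₁ x ≤ B},
        {P | ∃ (y : K) (e : y ^ 2 = x ^ 3 + a * x ^ 2 + b * x + c), P = pt e} := by
      intro P hP
      rcases eq_zero_or P with rfl | ⟨x, y, e, rfl⟩
      · exact .inl rfl
      · simp only [Set.mem_ofPred_eq, hpt] at hP
        refine .inr (Set.mem_biUnion (x := x) hP ⟨y, e, rfl⟩)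
    refine (Set.Finite.union (Set.finite_singleton _) (h1.biUnion fun x _ => ?_)).subset h2
    by_cases hy : ∃ y : K, y ^ 2 = x ^ 3 + a * x ^ 2 + b * x + c
    · obtain ⟨y, e⟩ := hy
      refine (Set.toFinite {(pt e : Pt a b c), -pt e}).subset ?_
      rintro _ ⟨y', e', rfl⟩
      rcases sq_eq_sq_iff_eq_or_eq_neg.1 (e'.trans e.symm) with rfl | rfl
      · exact .inl rfl
      · exact .inr (neg_pt e).symm
    · convert Set.finite_empty
      ext P; simp only [Set.mem_ofPred_eq, Set.mem_empty_iff_false, iff_false]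
      rintro ⟨y, e, -⟩; exact hy ⟨y, e⟩
  · have hC₂0 : 0 ≤ C₂ := (abs_nonneg _).trans
      (hC₂ (a := 1) (b := 1) (c := 1) (d := 1) (by simp) (by simp))
    have hC₁0 : 0 ≤ C₁ := (abs_nonneg _).trans (hC₁ 0)
    rcases eq_zero_or P with rfl | ⟨x, y, e, rfl⟩
    · rw [add_zero, h0]; linarith
    have k1 := hC₁ ![x * x, x * 1 + 1 * x, 1 * 1]
    have k2 := hC₂ (a := x) (b := 1) (c := x) (d := 1) (by simp) (by simp)
    rw [← logHeight₁_eq_logHeight] at k2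
    set N := x ^ 4 - 2 * b * x ^ 2 - 8 * c * x + b ^ 2 - 4 * a * c with hN
    have hev : (fun i ↦ (addSubMap (cubicCurve a b c) i).eval ![x * x, x * 1 + 1 * x, 1 * 1]) =
        ![N, 4 * y ^ 2, 0] := by
      ext i
      rw [e, hN]
      fin_cases i <;>
        simp [addSubMap, cubicCurve, WeierstrassCurve.b₂, WeierstrassCurve.b₄,
          WeierstrassCurve.b₆, WeierstrassCurve.b₈] <;> ring
    rw [hev] at k1
    have k3 : |logHeight ![N, 4 * y ^ 2, 0] - h (pt e + pt e)| ≤ C₂ := by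
      by_cases hy : y = 0
      · subst hy
        have hN0 : N ≠ 0 := by
          intro h0
          have := addSubMap_ne_zero (cubicCurve a b c)
            (x := ![x * x, x * 1 + 1 * x, 1 * 1]) (by simp)
          rw [hev, h0] at this
          simp at this
        have hz : (pt e : Pt a b c) + pt e = 0 := pt_add_eq_zero.2 (by simp)
        have k := hC₂ (a := 1) (b := 0) (c := 1) (d := 0) (by simp) (by simp)
        have hs : ![N, 4 * 0 ^ 2, 0] = N • ![(1 : K) * 1, 1 * 0 + 0 * 1, 0 * 0] := by
          ext i; fin_cases i <;> simp
        rw [hz, hs, logHeight_smul_eq_logHeight _ hN0, h0]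
        have h0' : logHeight ![(1 : K), 0] = 0 := by
          simp [logHeight_swap (1 : K) 0]
        rwa [h0', add_zero] at k
      · have h4 : 4 * y ^ 2 ≠ 0 := by simp [hy]
        obtain ⟨e', he'⟩ := double (a := a) e (by simpa using hy)
          (l := (3 * x ^ 2 + 2 * a * x + b) / (2 * y)) (by field_simp) rfl rfl
        rw [he', hpt]
        have k := hC₂ (a := N / (4 * y ^ 2)) (b := 1) (c := 1) (d := 0) (by simp) (by simp)
        have hs : ![N, 4 * y ^ 2, 0] = (4 * y ^ 2) • ![N / (4 * y ^ 2) * 1,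
            N / (4 * y ^ 2) * 0 + 1 * 1, 1 * 0] := by
          ext i; fin_cases i <;> simp; field_simp
        have h0' : logHeight ![(1 : K), 0] = 0 := by
          simp [logHeight_swap (1 : K) 0]
        have hx2 : ((3 * x ^ 2 + 2 * a * x + b) / (2 * y)) ^ 2 - a - 2 * x = N / (4 * y ^ 2) := by
          rw [eq_div_iff h4, hN]; field_simp
          linear_combination (-16 * a - 32 * x) * e
        rw [h0', add_zero, ← logHeight₁_eq_logHeight] at k
        rwa [hs, logHeight_smul_eq_logHeight _ h4, hx2]
    rw [abs_le] at k1 k2 k3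
    rw [hpt]
    linarith [k1.1, k2.1, k3.2]

end Finite
section Valuation

variable {K : Type*} [Field K] {v : AbsoluteValue K ℝ}

/-- The ring of integers of a nonarchimedean absolute value. -/
def intRing (hv : IsNonarchimedean v) : Subring K where
  carrier := {x | v x ≤ 1}
  mul_mem' {x y} hx hy := by
    simp only [Set.mem_ofPred_eq, map_mul] at *
    exact mul_le_one₀ hx (v.nonneg _) hy
  one_mem' := by simp
  add_mem' {x y} hx hy := (hv x y).trans (max_le hx hy)
  zero_mem' := by simp
  neg_mem' {x} hx := by simpa using hx

variable (hv : IsNonarchimedean v)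

theorem mem_intRing {x : K} : x ∈ intRing hv ↔ v x ≤ 1 := Iff.rfl

include hv

theorem v_add_lt_one {x y : K} (hx : v x < 1) (hy : v y < 1) : v (x + y) < 1 :=
  (hv x y).trans_lt (max_lt hx hy)

theorem v_sub_lt_one {x y : K} (hx : v x < 1) (hy : v y < 1) : v (x - y) < 1 := by
  rw [sub_eq_add_neg]; exact v_add_lt_one hv hx (by simpa using hy)

theorem v_mul_lt_one {x y : K} (hx : v x < 1) (hy : y ∈ intRing hv) : v (x * y) < 1 := by
  rw [map_mul]
  exact (mul_le_of_le_one_right (v.nonneg _) hy).trans_lt hx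

theorem v_mul_lt_one' {x y : K} (hx : x ∈ intRing hv) (hy : v y < 1) : v (x * y) < 1 := by
  rw [mul_comm]; exact v_mul_lt_one hv hy hx

theorem v_add_eq {x y : K} (h : v y < v x) : v (x + y) = v x := by
  rw [hv.add_eq_max_of_ne h.ne', max_eq_left h.le]

theorem v_eq_one_of_sub {x y : K} (h : v y = 1) (hxy : v (x - y) < 1) : v x = 1 := by
  have := v_add_eq hv (x := y) (y := x - y) (by rwa [h])
  rwa [add_sub_cancel, h] at this

theorem v_one_add {t : K} (h : v t < 1) : v (1 + t) = 1 := by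
  rw [v_add_eq hv (by simpa using h), map_one]

theorem v_two (h3 : v 3 < 1) : v 2 = 1 := by
  have := v_one_add hv (t := -3) (by simpa using h3)
  rw [show (1 : K) + -3 = -2 by ring] at this
  simpa using this

theorem v_four (h3 : v 3 < 1) : v 4 = 1 := by
  rw [show (4 : K) = 2 * 2 by norm_num, map_mul, v_two hv h3, one_mul]

variable {a b c : K} (ha : a ∈ intRing hv) (hb : b ∈ intRing hv) (hc : c ∈ intRing hv)

include ha hb hc

theorem v_cubic {x : K} (hx : 1 < v x) :
    v (x ^ 3 + a * x ^ 2 + b * x + c) = v x ^ 3 := by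
  have hx0 : x ≠ 0 := fun h => by simp [h] at hx; linarith
  have ht : v x⁻¹ < 1 := by rw [map_inv₀]; exact inv_lt_one_of_one_lt₀ hx
  have ht' : x⁻¹ ∈ intRing hv := ht.le
  have : x ^ 3 + a * x ^ 2 + b * x + c
      = x ^ 3 * (1 + x⁻¹ * (a + b * x⁻¹ + c * x⁻¹ ^ 2)) := by
    field_simp; ring
  rw [this, map_mul, v_one_add hv, map_pow, mul_one]
  apply v_mul_lt_one hv ht
  repeat' (first | assumption | apply add_mem | apply mul_mem | apply pow_mem)

/-- The numerator of the duplication formula has absolute value `v x ^ 4`. -/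
theorem v_dupl {x : K} (hx : 1 < v x) :
    v (x ^ 4 - 2 * b * x ^ 2 - 8 * c * x + b ^ 2 - 4 * a * c) = v x ^ 4 := by
  have hx0 : x ≠ 0 := fun h => by simp [h] at hx; linarith
  have ht : v x⁻¹ < 1 := by rw [map_inv₀]; exact inv_lt_one_of_one_lt₀ hx
  have ht' : x⁻¹ ∈ intRing hv := ht.le
  have : x ^ 4 - 2 * b * x ^ 2 - 8 * c * x + b ^ 2 - 4 * a * c
      = x ^ 4 * (1 + x⁻¹ * (-2 * b * x⁻¹ - 8 * c * x⁻¹ ^ 2 + (b ^ 2 - 4 * a * c) * x⁻¹ ^ 3)) := by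
    field_simp; ring
  rw [this, map_mul, v_one_add hv, map_pow, mul_one]
  apply v_mul_lt_one hv ht
  repeat' (first | assumption | apply ofNat_mem | apply neg_mem | apply add_mem |
    apply sub_mem | apply mul_mem | apply pow_mem)

/-- The third division polynomial is dominated by its leading term deep in the kernel of
reduction. -/
theorem v_psi_three {x : K} (hx : 1 < v x) (h3 : 1 < v 3 * v x) :
    v (3 * x ^ 4 + 4 * a * x ^ 3 + 6 * b * x ^ 2 + 12 * c * x + 4 * a * c - b ^ 2)
      = v 3 * v x ^ 4 := by
  have hx0 : x ≠ 0 := fun h => by simp [h] at hx; linarith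
  have ht : v x⁻¹ < 1 := by rw [map_inv₀]; exact inv_lt_one_of_one_lt₀ hx
  have ht' : x⁻¹ ∈ intRing hv := ht.le
  have : 3 * x ^ 4 + 4 * a * x ^ 3 + 6 * b * x ^ 2 + 12 * c * x + 4 * a * c - b ^ 2
      = x ^ 3 * (3 * x +
        (4 * a + 6 * b * x⁻¹ + 12 * c * x⁻¹ ^ 2 + (4 * a * c - b ^ 2) * x⁻¹ ^ 3)) := by
    field_simp; ring
  rw [this, map_mul, v_add_eq hv, map_pow, map_mul]
  · ring
  · rw [map_mul]
    refine lt_of_le_of_lt (?_ : _ ∈ intRing hv) h3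
    repeat' (first | assumption | apply ofNat_mem | apply neg_mem | apply add_mem |
      apply sub_mem | apply mul_mem | apply pow_mem)

variable [(cubicCurve a b c).IsElliptic] [DecidableEq K]

/-- Doubling preserves the absolute value of a large `x`-coordinate. -/
theorem double_reducesToZero (h3 : v 3 < 1) {x y : K}
    (h : y ^ 2 = x ^ 3 + a * x ^ 2 + b * x + c) (hx : 1 < v x) :
    ∃ (l x' y' : K) (h' : y' ^ 2 = x' ^ 3 + a * x' ^ 2 + b * x' + c),
      (pt h : Pt a b c) + pt h = pt h' ∧ v x' = v x ∧
      l * (2 * y) = 3 * x ^ 2 + 2 * a * x + b ∧ x' = l ^ 2 - a - 2 * x ∧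
      y' = -(y + l * (x' - x)) := by
  have hvy : v y ^ 2 = v x ^ 3 := by rw [← map_pow, h, v_cubic hv ha hb hc hx]
  have hy : y ≠ 0 := by
    rintro rfl
    rw [map_zero] at hvy
    have := one_lt_pow₀ hx three_ne_zero
    norm_num at hvy; linarith
  have h2 : (2 : K) ≠ 0 := fun e => by
    have := v_two hv h3; rw [e, map_zero] at this; norm_num at this
  obtain ⟨h', e⟩ := double h (mul_ne_zero h2 hy) (l := (3 * x ^ 2 + 2 * a * x + b) / (2 * y))
    (by field_simp) rfl rfl
  refine ⟨_, _, _, h', e, ?_, by field_simp, rfl, rfl⟩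
  have : ((3 * x ^ 2 + 2 * a * x + b) / (2 * y)) ^ 2 - a - 2 * x
      = (x ^ 4 - 2 * b * x ^ 2 - 8 * c * x + b ^ 2 - 4 * a * c) / (4 * y ^ 2) := by
    have h4 : (4 : K) ≠ 0 := by rw [show (4 : K) = 2 * 2 by norm_num]; exact mul_ne_zero h2 h2
    field_simp
    linear_combination (-16 * a - 32 * x) * h
  rw [this, map_div₀, map_mul, map_pow, v_dupl hv ha hb hc hx, v_four hv h3, hvy]
  have : v x ≠ 0 := by linarith
  field_simp

/-- A finite unramified group of points meets the kernel of reduction trivially. -/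
theorem v_le_one_of_finite [Finite (Pt a b c)] (h30 : (3 : K) ≠ 0) (h3 : v 3 < 1)
    (hunr : ∀ u : K, v u < 1 → v u ≤ v 3) {x y : K}
    (h : y ^ 2 = x ^ 3 + a * x ^ 2 + b * x + c) : v x ≤ 1 := by
  by_contra! hx
  let S : Set K := {x | ∃ y : K, y ^ 2 = x ^ 3 + a * x ^ 2 + b * x + c}
  have hS : S.Finite := by
    let f : Pt a b c → K := fun P => P.xRep 0
    refine (Set.finite_range f).subset ?_
    rintro x ⟨y, h⟩
    exact ⟨pt h, by simp [f, pt]⟩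
  obtain ⟨x₁, ⟨y₁, h₁⟩, hmax⟩ := Set.exists_max_image S v hS ⟨x, y, h⟩
  have hx₁ : 1 < v x₁ := hx.trans_le (hmax x ⟨y, h⟩)
  clear! x y
  rename' x₁ => x, y₁ => y, h₁ => h, hx₁ => hx
  have h3pos : 0 < v 3 := v.pos h30
  have hvy : v y ^ 2 = v x ^ 3 := by rw [← map_pow, h, v_cubic hv ha hb hc hx]
  have hvx0 : 0 < v x := by linarith
  have hvy0 : 0 < v y := by
    have : 0 < v y ^ 2 := by rw [hvy]; positivity
    exact lt_of_le_of_ne (v.nonneg _) fun h => by rw [← h] at this; norm_num at this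
  have hz2 : v (x / y) ^ 2 * v x = 1 := by rw [map_div₀, div_pow, hvy]; field_simp
  have hz : v (x / y) < 1 := by
    by_contra! hz
    nlinarith [one_le_pow₀ hz (n := 2)]
  have hz3 := hunr _ hz
  have hx3 : 1 ≤ v 3 ^ 2 * v x := by
    rw [← hz2]
    exact mul_le_mul_of_nonneg_right (pow_le_pow_left₀ (v.nonneg _) hz3 2) hvx0.le
  have hx3' : 1 < v 3 * v x := by nlinarith
  obtain ⟨l, x₂, y₂, h₂, e₂, hvx₂, hl, hx₂, hy₂⟩ := double_reducesToZero hv ha hb hc h3 h hx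
  have h2 := v_two hv h3
  have h4 := v_four hv h3
  have hψ := v_psi_three hv ha hb hc hx hx3'
  have hdiff : (x₂ - x) * (4 * y ^ 2)
      = -(3 * x ^ 4 + 4 * a * x ^ 3 + 6 * b * x ^ 2 + 12 * c * x + 4 * a * c - b ^ 2) := by
    rw [hx₂]
    linear_combination (l * (2 * y) + (3 * x ^ 2 + 2 * a * x + b)) * hl + (-4 * a - 12 * x) * h
  have hvd : v (x₂ - x) = v 3 * v x := by
    have := congrArg v hdiff
    rw [AbsoluteValue.map_neg, hψ, map_mul, map_mul, map_pow, h4, hvy, one_mul] at this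
    have h' : v x ^ 3 ≠ 0 := by positivity
    apply mul_right_cancel₀ h'
    rw [this]; ring
  have hvd0 : x₂ - x ≠ 0 := fun h0 => by
    rw [h0, map_zero] at hvd; nlinarith
  have hvl : v l * v y ≤ v 3 * v x ^ 2 := by
    have e : v l * v y = v (3 * x ^ 2 + 2 * a * x + b) := by
      rw [← hl, map_mul, map_mul, h2, one_mul]
    rw [e]
    have hx0 : x ≠ 0 := by rintro rfl; simp at hvx0
    have ht : v x⁻¹ < 1 := by rw [map_inv₀]; exact inv_lt_one_of_one_lt₀ hx
    have ht' : x⁻¹ ∈ intRing hv := ht.le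
    have e2 : 3 * x ^ 2 + 2 * a * x + b = x * (3 * x + (2 * a + b * x⁻¹)) := by
      field_simp; ring
    rw [e2, map_mul, v_add_eq hv, map_mul]
    · exact le_of_eq (by ring)
    · rw [map_mul]
      refine lt_of_le_of_lt (?_ : _ ∈ intRing hv) hx3'
      repeat' (first | assumption | apply ofNat_mem | apply add_mem | apply mul_mem)
  have hvyy : v (y₂ - y) = v y := by
    have e : y₂ - y = -(2 * y) + -(l * (x₂ - x)) := by rw [hy₂]; ring
    rw [e, v_add_eq hv]
    · rw [AbsoluteValue.map_neg, map_mul, h2, one_mul]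
    · rw [AbsoluteValue.map_neg, AbsoluteValue.map_neg, map_mul, map_mul, h2, one_mul, hvd]
      have : v l * (v 3 * v x) * v y < v y * v y := by
        have e1 : v l * (v 3 * v x) * v y = (v l * v y) * (v 3 * v x) := by ring
        have e2 : v y * v y = v x ^ 3 := by rw [← hvy]; ring
        rw [e1, e2]
        calc _ ≤ v 3 * v x ^ 2 * (v 3 * v x) :=
              mul_le_mul_of_nonneg_right hvl (by positivity)
          _ = v 3 ^ 2 * v x ^ 3 := by ring
          _ < 1 * v x ^ 3 := by
              apply mul_lt_mul_of_pos_right _ (by positivity)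
              exact pow_lt_one₀ h3pos.le h3 two_ne_zero
          _ = _ := one_mul _
      exact lt_of_mul_lt_mul_right this hvy0.le
  obtain ⟨h₃, -⟩ := add_chord h₂ h (sub_ne_zero.1 hvd0) (l := (y₂ - y) / (x₂ - x))
    (by field_simp) rfl rfl
  have hbig := hmax _ ⟨_, h₃⟩
  have hm2 : v (((y₂ - y) / (x₂ - x)) ^ 2) * v 3 ^ 2 = v x := by
    rw [map_pow, map_div₀, hvd, hvyy, div_pow, hvy]; field_simp
  have hgt : v x < v (((y₂ - y) / (x₂ - x)) ^ 2) := by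
    rw [← hm2]
    have hp : 0 < v (((y₂ - y) / (x₂ - x)) ^ 2) := by
      by_contra! hp
      nlinarith [pow_pos h3pos 2]
    exact mul_lt_of_lt_one_right hp (pow_lt_one₀ h3pos.le h3 two_ne_zero)
  have e : ((y₂ - y) / (x₂ - x)) ^ 2 - a - x₂ - x
      = ((y₂ - y) / (x₂ - x)) ^ 2 + -(a + x₂ + x) := by ring
  rw [e, v_add_eq hv] at hbig
  · linarith
  · rw [AbsoluteValue.map_neg]
    refine lt_of_le_of_lt ?_ hgt
    refine (hv _ _).trans (max_le ((hv _ _).trans (max_le ?_ hvx₂.le)) le_rfl)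
    exact ((mem_intRing hv).1 ha).trans hx.le

omit hb hc [(cubicCurve a b c).IsElliptic] [DecidableEq K] in
/-- The chord through two integral points with the same smooth reduction is steep. -/
theorem one_lt_slope (h3 : v 3 < 1) {x y x₀ y₀ : K}
    (h : y ^ 2 = x ^ 3 + a * x ^ 2 + b * x + c)
    (h₀ : y₀ ^ 2 = x₀ ^ 3 + a * x₀ ^ 2 + b * x₀ + c) (hx₀ : x₀ ∈ intRing hv)
    (hx : v (x - x₀) < 1) (hy : v (y - y₀) < 1) (hne : x ≠ x₀)
    (hsm : v y₀ = 1 ∨ v (3 * x₀ ^ 2 + 2 * a * x₀ + b) = 1) :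
    1 < v ((y + y₀) / (x - x₀)) := by
  have hd : 0 < v (x - x₀) := v.pos (sub_ne_zero.2 hne)
  rcases hsm with h1 | h1
  · have : v (y + y₀) = 1 := by
      rw [show y + y₀ = 2 * y₀ + (y - y₀) by ring, v_add_eq hv] <;>
        rw [map_mul, v_two hv h3, h1, one_mul]
      exact hy
    rw [map_div₀, this, one_lt_div hd]; exact hx
  · set g := x ^ 2 + x * x₀ + x₀ ^ 2 + a * (x + x₀) + b with hg
    have hvg : v g = 1 := by
      refine v_eq_one_of_sub hv h1 ?_
      rw [show g - (3 * x₀ ^ 2 + 2 * a * x₀ + b) = (x - x₀) * ((x - x₀) + 3 * x₀ + a) by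
        rw [hg]; ring]
      apply v_mul_lt_one hv hx
      have : x - x₀ ∈ intRing hv := hx.le
      repeat' (first | assumption | apply ofNat_mem | apply add_mem | apply mul_mem)
    have e : (y - y₀) * (y + y₀) = (x - x₀) * g := by rw [hg]; linear_combination h - h₀
    have hy0 : y - y₀ ≠ 0 := fun h0 => by
      rw [h0, zero_mul] at e
      rcases mul_eq_zero.1 e.symm with e | e
      · exact hne (sub_eq_zero.1 e)
      · rw [e, map_zero] at hvg; norm_num at hvg
    have e2 : (y + y₀) / (x - x₀) = g / (y - y₀) := by
      rw [div_eq_div_iff (sub_ne_zero.2 hne) hy0]; linear_combination e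
    rw [e2, map_div₀, hvg, one_lt_div (v.pos hy0)]; exact hy

variable (v) in
omit hv ha hb hc [DecidableEq K] in
/-- The kernel of reduction. -/
def InKernel (P : Pt a b c) : Prop :=
  P = 0 ∨ ∃ (x y : K) (h : y ^ 2 = x ^ 3 + a * x ^ 2 + b * x + c), P = pt h ∧ 1 < v x

omit hb hc in
/-- Two integral points with the same smooth reduction differ by an element of the kernel
of reduction. -/
theorem inKernel_sub (h3 : v 3 < 1) {x y x₀ y₀ : K}
    (h : y ^ 2 = x ^ 3 + a * x ^ 2 + b * x + c)
    (h₀ : y₀ ^ 2 = x₀ ^ 3 + a * x₀ ^ 2 + b * x₀ + c) (hx₀ : x₀ ∈ intRing hv)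
    (hx : v (x - x₀) < 1) (hy : v (y - y₀) < 1)
    (hsm : v y₀ = 1 ∨ v (3 * x₀ ^ 2 + 2 * a * x₀ + b) = 1) :
    InKernel v ((pt h : Pt a b c) - pt h₀) := by
  have h2 : (2 : K) ≠ 0 := fun e => by
    have := v_two hv h3; rw [e, map_zero] at this; norm_num at this
  have hxi : x ∈ intRing hv := by
    rw [← sub_add_cancel x x₀]; exact add_mem (hx.le : _ ∈ intRing hv) hx₀
  rw [sub_eq_add_neg, neg_pt]
  have main : ∀ l u : K, 1 < v l → u ∈ intRing hv → 1 < v (l ^ 2 + u) := fun l u hl hu => by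
    have hl2 : 1 < v (l ^ 2) := by rw [map_pow]; exact one_lt_pow₀ hl two_ne_zero
    rwa [v_add_eq hv (lt_of_le_of_lt hu hl2)]
  by_cases hne : x = x₀
  · subst hne
    rcases sq_eq_sq_iff_eq_or_eq_neg.1 (h.trans h₀.symm) with rfl | rfl
    · left; rw [pt_add_eq_zero]; simp
    · by_cases hy0 : y₀ = 0
      · left; rw [pt_add_eq_zero]; simp [hy0]
      have hvy : v y₀ < 1 := by
        rw [show -y₀ - y₀ = -(2 * y₀) by ring, AbsoluteValue.map_neg, map_mul, v_two hv h3,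
          one_mul] at hy
        exact hy
      have hf := hsm.resolve_left hvy.ne
      right
      obtain ⟨h', e⟩ := double h (mul_ne_zero h2 (neg_ne_zero.2 hy0))
        (l := (3 * x ^ 2 + 2 * a * x + b) / (2 * -y₀)) (by field_simp) rfl rfl
      refine ⟨_, _, h', e, ?_⟩
      rw [sub_sub, sub_eq_add_neg]
      refine main _ _ ?_ ?_
      · rw [map_div₀, hf, map_mul, v_two hv h3, one_mul, AbsoluteValue.map_neg,
          one_lt_div (v.pos hy0)]
        exact hvy
      · repeat' (first | assumption | apply ofNat_mem | apply neg_mem | apply add_mem |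
          apply mul_mem)
  · right
    have hl := one_lt_slope hv ha h3 h h₀ hx₀ hx hy hne hsm
    obtain ⟨h', e⟩ := add_chord h (y₂ := -y₀) (by rw [neg_sq, h₀]) hne
      (l := (y + y₀) / (x - x₀)) (by have := sub_ne_zero.2 hne; field_simp; ring) rfl rfl
    refine ⟨_, _, h', e, ?_⟩
    rw [sub_sub, sub_sub, sub_eq_add_neg]
    refine main _ _ hl ?_
    repeat' (first | assumption | apply neg_mem | apply add_mem)

/-- The kernel of reduction is closed under addition. -/
theorem InKernel.add (h3 : v 3 < 1) {P Q : Pt a b c} (hP : InKernel v P) (hQ : InKernel v Q) :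
    InKernel v (P + Q) := by
  rcases hP with rfl | ⟨x₁, y₁, h₁, rfl, hx₁⟩
  · rwa [zero_add]
  rcases hQ with rfl | ⟨x₂, y₂, h₂, rfl, hx₂⟩
  · rw [add_zero]; exact .inr ⟨_, _, h₁, rfl, hx₁⟩
  by_cases hne : x₁ = x₂
  · subst hne
    rcases sq_eq_sq_iff_eq_or_eq_neg.1 (h₁.trans h₂.symm) with rfl | rfl
    · obtain ⟨-, x', y', h', e, hvx, -⟩ := double_reducesToZero hv ha hb hc h3 h₁ hx₁
      exact .inr ⟨_, _, h', e, by rwa [hvx]⟩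
    · left; rw [pt_add_eq_zero]; simp
  have hd := sub_ne_zero.2 hne
  obtain ⟨h', e⟩ := add_chord h₁ h₂ hne (l := (y₁ - y₂) / (x₁ - x₂)) (by field_simp) rfl rfl
  refine .inr ⟨_, _, h', e, ?_⟩
  set x₃ := ((y₁ - y₂) / (x₁ - x₂)) ^ 2 - a - x₁ - x₂ with hx₃
  by_contra! hx3
  have hx0 : x₁ ≠ 0 := fun h => by simp [h] at hx₁; linarith
  have hx0' : x₂ ≠ 0 := fun h => by simp [h] at hx₂; linarith
  have ht : v x₁⁻¹ < 1 := by rw [map_inv₀]; exact inv_lt_one_of_one_lt₀ hx₁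
  have ht2 : v x₂⁻¹ < 1 := by rw [map_inv₀]; exact inv_lt_one_of_one_lt₀ hx₂
  have ht' : x₁⁻¹ ∈ intRing hv := ht.le
  have ht2' : x₂⁻¹ ∈ intRing hv := ht2.le
  have hi3 : x₃ ∈ intRing hv := hx3
  -- `x₃` is a root of a quadratic whose constant term dominates
  have hq : x₁ ^ 2 * x₂ ^ 2 - 2 * b * (x₁ * x₂) - 4 * c * (x₁ + x₂) + b ^ 2 - 4 * a * c
      = x₃ * (2 * (x₁ * x₂ + b) * (x₁ + x₂) + 4 * a * (x₁ * x₂) + 4 * c)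
        - x₃ ^ 2 * (x₁ - x₂) ^ 2 := by
    have e1 : x₃ * (x₁ - x₂) ^ 2 = (y₁ - y₂) ^ 2 - (a + x₁ + x₂) * (x₁ - x₂) ^ 2 := by
      rw [hx₃]; field_simp; ring
    have hd2 : (x₁ - x₂) ^ 2 ≠ 0 := pow_ne_zero _ hd
    apply mul_right_cancel₀ hd2
    have hsum : 2 * (x₁ * x₂ + b) * (x₁ + x₂) + 4 * a * (x₁ * x₂) + 4 * c - x₃ * (x₁ - x₂) ^ 2
        = (y₁ + y₂) ^ 2 - (a + x₁ + x₂) * (x₁ - x₂) ^ 2 := by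
      linear_combination -e1 - 2 * h₁ - 2 * h₂
    have hprod : ((y₁ - y₂) ^ 2 - (a + x₁ + x₂) * (x₁ - x₂) ^ 2) *
        ((y₁ + y₂) ^ 2 - (a + x₁ + x₂) * (x₁ - x₂) ^ 2) =
        (x₁ ^ 2 * x₂ ^ 2 - 2 * b * (x₁ * x₂) - 4 * c * (x₁ + x₂) + b ^ 2 - 4 * a * c) *
        (x₁ - x₂) ^ 2 := by
      linear_combination (y₁ ^ 2 - y₂ ^ 2 + (x₁ ^ 3 + a * x₁ ^ 2 + b * x₁ + c)
        - (x₂ ^ 3 + a * x₂ ^ 2 + b * x₂ + c)) * (h₁ - h₂)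
        - 2 * (a + x₁ + x₂) * (x₁ - x₂) ^ 2 * (h₁ + h₂)
    rw [← hprod, ← e1, ← hsum]; ring
  have hq2 : (1 : K) + (-2 * b * (x₁⁻¹ * x₂⁻¹) - 4 * c * (x₁⁻¹ * x₂⁻¹ ^ 2 + x₁⁻¹ ^ 2 * x₂⁻¹)
      + (b ^ 2 - 4 * a * c) * (x₁⁻¹ ^ 2 * x₂⁻¹ ^ 2)
      - x₃ * (2 * (1 + b * (x₁⁻¹ * x₂⁻¹)) * (x₁⁻¹ + x₂⁻¹) + 4 * a * (x₁⁻¹ * x₂⁻¹)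
        + 4 * c * (x₁⁻¹ ^ 2 * x₂⁻¹ ^ 2))
      + x₃ ^ 2 * (x₁⁻¹ - x₂⁻¹) ^ 2) = 0 := by
    have e : x₁ * x₁⁻¹ = 1 := mul_inv_cancel₀ hx0
    have e' : x₂ * x₂⁻¹ = 1 := mul_inv_cancel₀ hx0'
    field_simp
    linear_combination hq
  have hsmall : v (-2 * b * (x₁⁻¹ * x₂⁻¹) - 4 * c * (x₁⁻¹ * x₂⁻¹ ^ 2 + x₁⁻¹ ^ 2 * x₂⁻¹)
      + (b ^ 2 - 4 * a * c) * (x₁⁻¹ ^ 2 * x₂⁻¹ ^ 2)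
      - x₃ * (2 * (1 + b * (x₁⁻¹ * x₂⁻¹)) * (x₁⁻¹ + x₂⁻¹) + 4 * a * (x₁⁻¹ * x₂⁻¹)
        + 4 * c * (x₁⁻¹ ^ 2 * x₂⁻¹ ^ 2))
      + x₃ ^ 2 * (x₁⁻¹ - x₂⁻¹) ^ 2) < 1 := by
    generalize x₁⁻¹ = s at *
    generalize x₂⁻¹ = t at *
    rw [show (-2 * b * (s * t) - 4 * c * (s * t ^ 2 + s ^ 2 * t)
      + (b ^ 2 - 4 * a * c) * (s ^ 2 * t ^ 2)
      - x₃ * (2 * (1 + b * (s * t)) * (s + t) + 4 * a * (s * t)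
        + 4 * c * (s ^ 2 * t ^ 2)) + x₃ ^ 2 * (s - t) ^ 2)
      = s * (-2 * b * t - 4 * c * (t ^ 2 + s * t)
      + (b ^ 2 - 4 * a * c) * (s * t ^ 2)
      - x₃ * (2 * (1 + b * (s * t)) + 2 * b * t * t  + 4 * a * t
        + 4 * c * (s * t ^ 2)) + x₃ ^ 2 * (s - 2 * t)) + t * (x₃ ^ 2 * t - 2 * x₃) by ring]
    refine v_add_lt_one hv (v_mul_lt_one hv ht ?_) (v_mul_lt_one hv ht2 ?_) <;>
    repeat' (first | assumption | apply ofNat_mem | apply one_mem | apply neg_mem |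
      apply add_mem | apply sub_mem | apply mul_mem | apply pow_mem)
  have := v_one_add hv hsmall
  rw [hq2, map_zero] at this
  norm_num at this

end Valuation
theorem isElliptic_of_ne {K : Type*} [Field K] {a b c : K}
    (h : 16 * (a ^ 2 * b ^ 2 - 4 * b ^ 3 - 4 * a ^ 3 * c - 27 * c ^ 2 + 18 * a * b * c) ≠ 0) :
    (cubicCurve a b c).IsElliptic := by
  refine ⟨isUnit_iff_ne_zero.2 ?_⟩
  convert h using 1
  simp only [WeierstrassCurve.Δ, WeierstrassCurve.b₂, WeierstrassCurve.b₄, WeierstrassCurve.b₆,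
    WeierstrassCurve.b₈, cubicCurve]
  ring

section TwoTorsion

variable {K : Type*} [Field K] [CharZero K] {a b : K} [(cubicCurve a b 0).IsElliptic]
  [DecidableEq K]

/-- Halving a point on `y ^ 2 = x ^ 3 + a * x ^ 2 + b * x`. -/
theorem exists_half (hb : b ≠ 0) (hab : a ^ 2 ≠ 4 * b) {X V n : K}
    (hV : V ^ 2 = X ^ 4 + a * X ^ 2 + b) (hn : n ^ 2 = 2 * X ^ 2 + a + 2 * V)
    (h : (X * V) ^ 2 = (X ^ 2) ^ 3 + a * (X ^ 2) ^ 2 + b * X ^ 2 + 0) :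
    ∃ Q : Pt a b 0, pt h = Q + Q := by
  set x := X ^ 2 + X * n + V with hx
  have hq : x ^ 2 - (2 * X ^ 2 + 2 * V) * x + b = 0 := by
    rw [hx]; linear_combination -hV + X ^ 2 * hn
  have hx0 : x ≠ 0 := by
    intro h0; rw [h0] at hq; apply hb; linear_combination hq
  have hn0 : n ≠ 0 := by
    rintro rfl
    apply hab
    linear_combination 4 * hV + (2 * V - 2 * X ^ 2 - a) * hn
  have hQ : (n * x) ^ 2 = x ^ 3 + a * x ^ 2 + b * x + 0 := by
    linear_combination x ^ 2 * hn - x * hq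
  obtain ⟨h', e⟩ := double hQ (mul_ne_zero two_ne_zero (mul_ne_zero hn0 hx0)) (l := X + n)
    (x := X ^ 2) (y := X * V) (by
      linear_combination 2 * x * hn - hq - 2 * x * hx)
    (by rw [hx]; linear_combination -hn) (by rw [hx]; ring)
  exact ⟨pt hQ, e.symm⟩

omit [CharZero K] in
/-- Translation by the 2-torsion point at the origin. -/
theorem add_origin {x y : K} (hx : x ≠ 0) (h : y ^ 2 = x ^ 3 + a * x ^ 2 + b * x + 0)
    (h₀ : (0 : K) ^ 2 = 0 ^ 3 + a * 0 ^ 2 + b * 0 + 0) :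
    ∃ h' : (-(y * b / x ^ 2)) ^ 2 = (b / x) ^ 3 + a * (b / x) ^ 2 + b * (b / x) + 0,
      (pt h : Pt a b 0) + pt h₀ = pt h' := by
  refine add_chord h h₀ hx (l := y / x) (by field_simp; ring) ?_ ?_
  · field_simp; linear_combination -h
  · field_simp; ring

end TwoTorsion

section Rational

variable {v : AbsoluteValue ℚ ℝ} (hv : IsNonarchimedean v) (h3 : v 3 < 1)

include hv h3

theorem v_intCast_eq_one {n : ℤ} (hn : ¬ 3 ∣ n) : v n = 1 := by
  have hi : ∀ m : ℤ, (m : ℚ) ∈ intRing hv := fun m => intCast_mem _ m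
  obtain ⟨k, hk⟩ : ∃ k : ℤ, n * n = 1 + 3 * k := by
    have : n % 3 = 1 ∨ n % 3 = 2 := by omega
    rcases this with h | h
    · exact ⟨(n * n - 1) / 3, by have : (n * n) % 3 = 1 := by rw [Int.mul_emod, h]; rfl
                                 omega⟩
    · exact ⟨(n * n - 1) / 3, by have : (n * n) % 3 = 1 := by rw [Int.mul_emod, h]; rfl
                                 omega⟩
  have h1 : v ((n : ℚ) * n) = 1 := by
    rw [show (n : ℚ) * n = 1 + 3 * k by exact_mod_cast hk]
    exact v_one_add hv (v_mul_lt_one hv h3 (hi k))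
  rw [map_mul] at h1
  have h2 : v n ≤ 1 := hi n
  nlinarith [v.nonneg (n : ℚ)]

theorem rat_unramified {u : ℚ} (hu : v u < 1) : v u ≤ v 3 := by
  have hi : ∀ m : ℤ, (m : ℚ) ∈ intRing hv := fun m => intCast_mem _ m
  have hd0 : (u.den : ℚ) ≠ 0 := by simp
  have e : v u * v (u.den : ℤ) = v (u.num : ℚ) := by
    rw [← map_mul]; congr 1; exact_mod_cast Rat.mul_den_eq_num u
  have hd1 : v ((u.den : ℤ) : ℚ) ≤ 1 := hi _
  have hn : 3 ∣ u.num := by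
    by_contra hn
    rw [v_intCast_eq_one hv h3 hn] at e
    nlinarith [v.nonneg u, v.nonneg ((u.den : ℤ) : ℚ)]
  have hd : ¬ (3 : ℤ) ∣ u.den := by
    intro hd
    have := u.reduced
    have h1 : 3 ∣ u.num.natAbs := by omega
    have h2 : 3 ∣ u.den := by omega
    have := Nat.dvd_gcd h1 h2
    rw [u.reduced] at this
    omega
  rw [v_intCast_eq_one hv h3 hd, mul_one] at e
  obtain ⟨k, hk⟩ := hn
  rw [e, hk]; push_cast
  rw [map_mul]
  exact mul_le_of_le_one_right (v.nonneg _) (hi k)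

theorem rat_residue {u : ℚ} (hu : v u ≤ 1) : v u < 1 ∨ v (u - 1) < 1 ∨ v (u + 1) < 1 := by
  have hi : ∀ m : ℤ, (m : ℚ) ∈ intRing hv := fun m => intCast_mem _ m
  have hd0 : (u.den : ℚ) ≠ 0 := by simp
  have e : v u * v (u.den : ℤ) = v (u.num : ℚ) := by
    rw [← map_mul]; congr 1; exact_mod_cast Rat.mul_den_eq_num u
  have hd : ¬ (3 : ℤ) ∣ u.den := by
    rintro ⟨k, hk⟩
    have h1 : ¬ (3 : ℤ) ∣ u.num := by
      intro h
      have h1 : 3 ∣ u.num.natAbs := by omega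
      have h2 : 3 ∣ u.den := by omega
      have := Nat.dvd_gcd h1 h2
      rw [u.reduced] at this
      omega
    rw [v_intCast_eq_one hv h3 h1, hk] at e
    push_cast at e
    have := v_mul_lt_one hv h3 (hi k)
    have h0 := v.nonneg ((3 : ℚ) * k)
    nlinarith
  have key : ∀ r : ℤ, 3 ∣ u.num - r * u.den → v (u - r) < 1 := by
    rintro r ⟨k, hk⟩
    have e1 : (u - r) * ((u.den : ℤ) : ℚ) = 3 * k := by
      have h1 : u * u.den = u.num := Rat.mul_den_eq_num u
      have h2 : (u.num : ℚ) - r * u.den = 3 * k := by exact_mod_cast hk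
      push_cast; linear_combination h1 + h2
    have := congrArg v e1
    rw [map_mul, v_intCast_eq_one hv h3 hd, mul_one] at this
    rw [this]
    exact v_mul_lt_one hv h3 (hi k)
  have : 3 ∣ u.num ∨ 3 ∣ u.num - u.den ∨ 3 ∣ u.num + u.den := by
    have h1 : u.num % 3 = 0 ∨ u.num % 3 = 1 ∨ u.num % 3 = 2 := by omega
    have h2 : (u.den : ℤ) % 3 = 1 ∨ (u.den : ℤ) % 3 = 2 := by omega
    rcases h1 with h1 | h1 | h1 <;> rcases h2 with h2 | h2 <;> omega
  rcases this with h | h | h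
  · left; simpa using key 0 (by simpa using h)
  · right; left; simpa using key 1 (by simpa using h)
  · right; right; simpa using key (-1) (by simpa using h)

end Rational

/-- The 3-adic absolute value on the rationals. -/
theorem exists_three_adic :
    ∃ v : AbsoluteValue ℚ ℝ, IsNonarchimedean v ∧ v 3 < 1 := by
  refine ⟨Rat.AbsoluteValue.padic 3, ?_, ?_⟩
  · intro x y
    simp only [Rat.AbsoluteValue.padic_eq_padicNorm]
    exact_mod_cast padicNorm.nonarchimedean
  · rw [Rat.AbsoluteValue.padic_eq_padicNorm]
    have := padicNorm.padicNorm_p_lt_one (p := 3) (by norm_num)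
    exact_mod_cast this

theorem rat_descent {A B l : ℤ} (hl : Prime l) (hB : ∀ p : ℤ, ¬ l ∣ p → IsCoprime p B)
    {x y : ℚ} (hx : x ≠ 0) (h : y ^ 2 = x * (x ^ 2 + A * x + B)) :
    ∃ r : ℚ, r ≠ 0 ∧ (x = r ^ 2 ∨ x = -r ^ 2 ∨ x = l * r ^ 2 ∨ x = -(l * r ^ 2)) := by
  set p := x.num with hp
  set q : ℤ := (x.den : ℤ) with hq
  have hq0 : q ≠ 0 := by simp [hq]
  have hp0 : p ≠ 0 := by simpa [hp] using hx
  have hxpq : x = p / q := (Rat.num_div_den x).symm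
  have hpq : IsCoprime p q := by
    rw [Int.isCoprime_iff_gcd_eq_one]; exact x.reduced
  have hq0' : (q : ℚ) ≠ 0 := by exact_mod_cast hq0
  have hsq : IsSquare (p * q * (p ^ 2 + A * p * q + B * q ^ 2)) := by
    rw [← Rat.isSquare_intCast_iff]
    refine ⟨y * q ^ 2, ?_⟩
    push_cast
    rw [show y * (q : ℚ) ^ 2 * (y * q ^ 2) = y ^ 2 * q ^ 4 by ring, h, hxpq]
    field_simp
  obtain ⟨s, hs⟩ := hsq
  set g := p ^ 2 + A * p * q + B * q ^ 2 with hg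
  obtain ⟨p', hpp, hp'⟩ := (FiniteMultiplicity.of_prime_left hl hp0).exists_eq_pow_mul_and_not_dvd
  set i := multiplicity l p
  have hp'l : IsCoprime p' l := (hl.coprime_iff_not_dvd.2 hp').symm
  have hp'q : IsCoprime p' q := hpq.of_isCoprime_of_dvd_left ⟨l ^ i, by rw [hpp]; ring⟩
  have hp'g : IsCoprime p' g := by
    have : g = B * q ^ 2 + p' * (l ^ i * (p + A * q)) := by
      rw [hg]; linear_combination (p + A * q) * hpp
    rw [this]
    exact ((hB p' hp').mul_right hp'q.pow_right).add_mul_left_right _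
  have hqg : IsCoprime q g := by
    have : g = p ^ 2 + q * (A * p + B * q) := by rw [hg]; ring
    rw [this]
    exact (hpq.symm.pow_right).add_mul_left_right _
  obtain ⟨m, hm⟩ := Int.sq_of_isCoprime (c := s)
    ((hp'l.pow_right (n := i)).mul_right (hp'q.mul_right hp'g)) (by
      rw [pow_two s, ← hs]; linear_combination -q * g * hpp)
  obtain ⟨n, hn⟩ := Int.sq_of_isCoprime (c := s) (hpq.symm.mul_right hqg) (by
      rw [pow_two s, ← hs]; ring)
  have hn0 : (n : ℚ) ≠ 0 := by
    rintro h0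
    have : n = 0 := by exact_mod_cast h0
    rw [this] at hn; simp at hn; exact hq0 hn
  have hl0 : (l : ℚ) ≠ 0 := by exact_mod_cast hl.ne_zero
  have hm0 : (m : ℚ) ≠ 0 := by
    rintro h0
    have : m = 0 := by exact_mod_cast h0
    rw [this] at hm; simp at hm; rw [hm, mul_zero] at hpp; exact hp0 hpp
  have hx' : x = l ^ i * p' / q := by rw [hxpq, hpp]; push_cast; ring
  have hm' : (p' : ℚ) = m ^ 2 ∨ (p' : ℚ) = -m ^ 2 := by exact_mod_cast hm
  have hn' : (q : ℚ) = n ^ 2 ∨ (q : ℚ) = -n ^ 2 := by exact_mod_cast hn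
  obtain ⟨j, hj⟩ := Nat.even_or_odd' i
  refine ⟨l ^ j * (m / n), by positivity, ?_⟩
  rcases hj with hj | hj <;> rw [hj] at hx'
  · have : x = (l ^ j * (m / n)) ^ 2 ∨ x = -(l ^ j * (m / n)) ^ 2 := by
      rcases hm' with e | e <;> rcases hn' with e' | e' <;> rw [hx', e, e']
      · left; field_simp; try ring
      · right; field_simp; try ring
      · right; field_simp; try ring
      · left; field_simp; try ring
    tauto
  · have : x = l * (l ^ j * (m / n)) ^ 2 ∨ x = -(l * (l ^ j * (m / n)) ^ 2) := by
      rcases hm' with e | e <;> rcases hn' with e' | e' <;> rw [hx', e, e']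
      · left; field_simp; try ring
      · right; field_simp; try ring
      · right; field_simp; try ring
      · left; field_simp; try ring
    tauto

/-- A quartic without rational points, for a 2-adic reason. -/
theorem quartic_ne_sq {w r : ℚ} (hr : r ≠ 0) : w ^ 2 ≠ -r ^ 4 + 22 * r ^ 2 + 7 := by
  intro h
  set m := r.num with hm
  set n : ℤ := (r.den : ℤ) with hn
  have hn0 : n ≠ 0 := by simp [hn]
  have hn0' : (n : ℚ) ≠ 0 := by exact_mod_cast hn0
  have hr' : r = m / n := (Rat.num_div_den r).symm
  have hmn : m % 2 = 1 ∨ n % 2 = 1 := by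
    by_contra! hc
    have h1 : 2 ∣ r.num.natAbs := by omega
    have h2 : 2 ∣ r.den := by omega
    have := Nat.dvd_gcd h1 h2
    rw [r.reduced] at this
    omega
  have hsq : IsSquare (-m ^ 4 + 22 * m ^ 2 * n ^ 2 + 7 * n ^ 4) := by
    rw [← Rat.isSquare_intCast_iff]
    refine ⟨w * n ^ 2, ?_⟩
    push_cast
    rw [show w * (n : ℚ) ^ 2 * (w * n ^ 2) = w ^ 2 * n ^ 4 by ring, h, hr']
    field_simp
  obtain ⟨s, hs⟩ := hsq
  have key : ∀ m n s : ZMod 16, (m * 8 = 8 ∨ n * 8 = 8) →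
      -m ^ 4 + 22 * m ^ 2 * n ^ 2 + 7 * n ^ 4 ≠ s * s := by decide
  refine key m n s ?_ ?_
  · have : ∀ k : ℤ, k % 2 = 1 → (k : ZMod 16) * 8 = 8 := fun k hk => by
      have : k = 1 + 2 * (k / 2) := by omega
      rw [this]; push_cast
      generalize ((k / 2 : ℤ) : ZMod 16) = t
      revert t; decide
    exact hmn.imp (this m) (this n)
  · have := congrArg (Int.cast : ℤ → ZMod 16) hs
    push_cast at this
    exact this

instance : (cubicCurve (-11 : ℚ) 32 0).IsElliptic := isElliptic_of_ne (by norm_num)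

theorem finite_fourteen : Finite (Pt (-11 : ℚ) 32 0) := by
  apply finite_pt
  have h₀ : (0 : ℚ) ^ 2 = 0 ^ 3 + (-11) * 0 ^ 2 + 32 * 0 + 0 := by norm_num
  have hT : (pt h₀ : Pt (-11 : ℚ) 32 0) + pt h₀ = 0 := pt_add_eq_zero.2 (by simp)
  have hsq : ∀ {r y : ℚ} (h : y ^ 2 = (r ^ 2) ^ 3 + (-11) * (r ^ 2) ^ 2 + 32 * r ^ 2 + 0),
      r ≠ 0 → ∃ Q : Pt (-11 : ℚ) 32 0, pt h = Q + Q := by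
    intro X y h hX
    obtain ⟨V, rfl⟩ : ∃ V, y = X * V := ⟨y / X, by field_simp⟩
    have hV : V ^ 2 = X ^ 4 + (-11) * X ^ 2 + 32 := by
      have : X ^ 2 ≠ 0 := pow_ne_zero _ hX
      apply mul_left_cancel₀ this; linear_combination h
    set q := 2 * X ^ 2 - 11 + 2 * V with hq
    have hqq : q * (2 * X ^ 2 - 11 - 2 * V) = -7 := by rw [hq]; linear_combination -4 * hV
    have hq0 : q ≠ 0 := fun h0 => by rw [h0] at hqq; norm_num at hqq
    have heq : (2 * X) ^ 2 * q = q ^ 2 + 22 * q - 7 := by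
      rw [hq]; linear_combination -4 * hV
    obtain ⟨r, hr, hr'⟩ := rat_descent (A := 22) (B := -7) (l := 7) (by norm_num)
      (fun p hp => by
        rw [IsCoprime.neg_right_iff]
        exact ((Prime.coprime_iff_not_dvd (by norm_num)).2 hp).symm)
      hq0 (y := 2 * X * q) (by push_cast; linear_combination q * heq)
    push_cast at hr'
    rcases hr' with e | e | e | e
    · exact exists_half (by norm_num) (by norm_num) hV (n := r) (by rw [← e, hq]; ring) h
    · exfalso
      refine quartic_ne_sq hr (w := 2 * X * r) ?_
      rw [e] at heq; linear_combination -heq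
    · exfalso
      refine quartic_ne_sq (inv_ne_zero hr) (w := 2 * X / r) ?_
      rw [e] at heq
      field_simp
      linear_combination heq / 7
    · obtain ⟨Q, hQ⟩ := exists_half (a := (-11 : ℚ)) (b := 32) (by norm_num) (by norm_num)
        (X := -X) (V := -V) (n := r⁻¹) (by linear_combination hV) (by
          have : r ^ 2 * (2 * X ^ 2 - 11 - 2 * V) = 1 := by rw [e] at hqq; linarith
          field_simp; linear_combination -this) (by linear_combination h)
      refine ⟨Q, ?_⟩
      rw [← hQ, pt_inj]; constructor <;> ring
  intro P
  rcases eq_zero_or P with rfl | ⟨x, y, h, rfl⟩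
  · exact ⟨0, 0, by simp, by simp⟩
  by_cases hx : x = 0
  · subst hx
    have hy : y = 0 := by simpa using h
    subst hy
    exact ⟨pt h₀, 0, hT, by simp⟩
  have hx' : 0 < x := by
    have h1 : y ^ 2 = x * ((x - 11 / 2) ^ 2 + 7 / 4) := by rw [h]; ring
    by_contra! h2
    have : x < 0 := lt_of_le_of_ne h2 hx
    nlinarith [sq_nonneg y, sq_nonneg (x - 11 / 2), mul_pos_of_neg_of_neg this this]
  obtain ⟨r, hr, hr'⟩ := rat_descent (A := -11) (B := 32) (l := 2) (by norm_num)
    (fun p hp => by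
      have := ((Prime.coprime_iff_not_dvd (by norm_num)).2 hp).symm
      exact this.pow_right (n := 5)) hx (y := y) (by push_cast; linear_combination h)
  push_cast at hr'
  have hr2 : 0 < r ^ 2 := by positivity
  rcases hr' with e | e | e | e
  · subst e
    obtain ⟨Q, hQ⟩ := hsq h hr
    exact ⟨0, Q, by simp, by rw [hQ, zero_add]⟩
  · linarith
  · obtain ⟨h', e'⟩ := add_origin hx h h₀
    have hx4 : 32 / x = (4 / r) ^ 2 := by rw [e]; field_simp; norm_num
    have : ∃ Q : Pt (-11 : ℚ) 32 0, pt h' = Q + Q := by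
      revert h'
      rw [hx4]
      intro h' _
      exact hsq h' (by positivity)
    obtain ⟨Q, hQ⟩ := this
    refine ⟨pt h₀, Q, hT, ?_⟩
    rw [← hQ, ← e', add_left_comm, hT, add_zero]
  · linarith

/-- Two rational points of a finite group of points that agree modulo 3 coincide. -/
theorem rat_pt_eq {v : AbsoluteValue ℚ ℝ} (hv : IsNonarchimedean v) (h3 : v 3 < 1)
    {a b c : ℤ} [(cubicCurve (a : ℚ) b c).IsElliptic] [Finite (Pt (a : ℚ) b c)]
    {x y : ℚ} (h : y ^ 2 = x ^ 3 + a * x ^ 2 + b * x + c) {x₀ y₀ : ℤ}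
    (h₀ : (y₀ : ℚ) ^ 2 = x₀ ^ 3 + a * x₀ ^ 2 + b * x₀ + c)
    (hx : v (x - x₀) < 1) (hy : v (y - y₀) < 1)
    (hsm : ¬ 3 ∣ y₀ ∨ ¬ 3 ∣ 3 * x₀ ^ 2 + 2 * a * x₀ + b) : x = x₀ ∧ y = y₀ := by
  have hi : ∀ m : ℤ, (m : ℚ) ∈ intRing hv := fun m => intCast_mem _ m
  have := inKernel_sub hv (hi a) h3 h h₀ (hi _) hx hy (by
    rcases hsm with h | h
    · exact .inl (v_intCast_eq_one hv h3 h)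
    · right; have := v_intCast_eq_one hv h3 h
      push_cast at this; exact this)
  rcases this with h1 | ⟨x', y', h', -, hx'⟩
  · exact pt_inj.1 (sub_eq_zero.1 h1)
  · have := v_le_one_of_finite hv (hi a) (hi b) (hi c) (by norm_num) h3
      (fun u => rat_unramified hv h3) h'
    linarith

/-- Integrality of the coordinates at 3. -/
theorem rat_pt_integral {v : AbsoluteValue ℚ ℝ} (hv : IsNonarchimedean v) (h3 : v 3 < 1)
    {a b c : ℤ} [(cubicCurve (a : ℚ) b c).IsElliptic] [Finite (Pt (a : ℚ) b c)]
    {x y : ℚ} (h : y ^ 2 = x ^ 3 + a * x ^ 2 + b * x + c) : v x ≤ 1 ∧ v y ≤ 1 := by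
  have hi : ∀ m : ℤ, (m : ℚ) ∈ intRing hv := fun m => intCast_mem _ m
  have hx := v_le_one_of_finite hv (hi a) (hi b) (hi c) (by norm_num) h3
      (fun u => rat_unramified hv h3) h
  refine ⟨hx, ?_⟩
  have hy : v (y ^ 2) ≤ 1 := by
    rw [h]
    change _ ∈ intRing hv
    have hx' : x ∈ intRing hv := hx
    have := hi a
    have := hi b
    have := hi c
    repeat' (first | assumption | apply add_mem | apply mul_mem | apply pow_mem)
  rw [map_pow] at hy
  exact (pow_le_one_iff_of_nonneg (v.nonneg _) two_ne_zero).1 hy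

theorem rat_congr {v : AbsoluteValue ℚ ℝ} (hv : IsNonarchimedean v) (h3 : v 3 < 1)
    {u : ℚ} (m n : ℤ) (hmn : 3 ∣ m - n) (h : v (u - m) < 1) : v (u - n) < 1 := by
  obtain ⟨k, hk⟩ := hmn
  have : u - n = (u - m) + 3 * k := by
    have : (m : ℚ) - n = 3 * k := by exact_mod_cast hk
    linear_combination this
  rw [this]
  exact v_add_lt_one hv h (v_mul_lt_one hv h3 (intCast_mem _ k))

/-- If the residues of a point are those of integers `m, n`, then `m, n` satisfies the
equation modulo 3. -/
theorem rat_residue_eq {v : AbsoluteValue ℚ ℝ} (hv : IsNonarchimedean v) (h3 : v 3 < 1)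
    {a b c : ℤ} {x y : ℚ} (h : y ^ 2 = x ^ 3 + a * x ^ 2 + b * x + c) (m n : ℤ)
    (hx : v (x - m) < 1) (hy : v (y - n) < 1) : 3 ∣ n ^ 2 - (m ^ 3 + a * m ^ 2 + b * m + c) := by
  have hi : ∀ m : ℤ, (m : ℚ) ∈ intRing hv := fun m => intCast_mem _ m
  by_contra hn
  have h1 := v_intCast_eq_one hv h3 hn
  have hx' : x ∈ intRing hv := by
    rw [← sub_add_cancel x m]; exact add_mem (hx.le : _ ∈ intRing hv) (hi m)
  have hy' : y ∈ intRing hv := by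
    rw [← sub_add_cancel y n]; exact add_mem (hy.le : _ ∈ intRing hv) (hi n)
  have e : ((n ^ 2 - (m ^ 3 + a * m ^ 2 + b * m + c) : ℤ) : ℚ)
      = (x - m) * (x ^ 2 + x * m + m ^ 2 + a * (x + m) + b) - (y - n) * (y + n) := by
    push_cast; linear_combination h
  have := hi a
  have := hi b
  have := hi m
  have := hi n
  rw [e] at h1
  refine (v_sub_lt_one hv (v_mul_lt_one hv hx ?_) (v_mul_lt_one hv hy ?_)).ne h1 <;>
  repeat' (first | assumption | apply add_mem | apply mul_mem | apply pow_mem)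

theorem rat_residue_int {v : AbsoluteValue ℚ ℝ} (hv : IsNonarchimedean v) (h3 : v 3 < 1)
    {u : ℚ} (hu : v u ≤ 1) : ∃ m : ℤ, (m = 0 ∨ m = 1 ∨ m = -1) ∧ v (u - m) < 1 := by
  rcases rat_residue hv h3 hu with h | h | h
  · exact ⟨0, by simp, by simpa using h⟩
  · exact ⟨1, by simp, by simpa using h⟩
  · exact ⟨-1, by simp, by simpa using h⟩

theorem fourteen_points {x y : ℚ} (h : y ^ 2 = x ^ 3 - 11 * x ^ 2 + 32 * x) :
    x = 0 ∨ x = 4 ∨ x = 8 := by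
  obtain ⟨v, hv, h3⟩ := exists_three_adic
  have hE : (cubicCurve ((-11 : ℤ) : ℚ) (32 : ℤ) (0 : ℤ)).IsElliptic := by
    push_cast; infer_instance
  have hF : Finite (Pt ((-11 : ℤ) : ℚ) (32 : ℤ) (0 : ℤ)) := by
    push_cast; exact finite_fourteen
  have h' : y ^ 2 = x ^ 3 + (-11 : ℤ) * x ^ 2 + (32 : ℤ) * x + (0 : ℤ) := by
    push_cast; linear_combination h
  obtain ⟨hx, hy⟩ := rat_pt_integral hv h3 h'
  obtain ⟨m, hm, hxm⟩ := rat_residue_int hv h3 hx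
  obtain ⟨n, hn, hyn⟩ := rat_residue_int hv h3 hy
  have hmn := rat_residue_eq hv h3 h' m n hxm hyn
  have go : ∀ x₀ y₀ : ℤ, (y₀ : ℚ) ^ 2 = x₀ ^ 3 + (-11 : ℤ) * x₀ ^ 2 + (32 : ℤ) * x₀ + (0 : ℤ) →
      3 ∣ m - x₀ → 3 ∣ n - y₀ → (¬ 3 ∣ y₀ ∨ ¬ 3 ∣ 3 * x₀ ^ 2 + 2 * (-11) * x₀ + 32) → x = x₀ :=
    fun x₀ y₀ h₀ h1 h2 h4 => (rat_pt_eq hv h3 h' h₀ (rat_congr hv h3 m x₀ h1 hxm)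
      (rat_congr hv h3 n y₀ h2 hyn) h4).1
  rcases hm with rfl | rfl | rfl <;> rcases hn with rfl | rfl | rfl <;> norm_num at hmn
  · left; simpa using go 0 0 (by norm_num) (by norm_num) (by norm_num) (by norm_num)
  · right; left; simpa using go 4 4 (by norm_num) (by norm_num) (by norm_num) (by norm_num)
  · right; left; simpa using go 4 (-4) (by norm_num) (by norm_num) (by norm_num) (by norm_num)
  · right; right; simpa using go 8 (-8) (by norm_num) (by norm_num) (by norm_num) (by norm_num)
  · right; right; simpa using go 8 8 (by norm_num) (by norm_num) (by norm_num) (by norm_num)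

instance : (cubicCurve (-4 : ℚ) 0 16).IsElliptic := isElliptic_of_ne (by norm_num)

theorem eleven_points [Finite (Pt (-4 : ℚ) 0 16)] {x y : ℚ}
    (h : y ^ 2 = x ^ 3 - 4 * x ^ 2 + 16) : x = 0 ∨ x = 4 := by
  obtain ⟨v, hv, h3⟩ := exists_three_adic
  have hE : (cubicCurve ((-4 : ℤ) : ℚ) (0 : ℤ) (16 : ℤ)).IsElliptic := by
    push_cast; infer_instance
  have hF : Finite (Pt ((-4 : ℤ) : ℚ) (0 : ℤ) (16 : ℤ)) := by
    push_cast; infer_instance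
  have h' : y ^ 2 = x ^ 3 + (-4 : ℤ) * x ^ 2 + (0 : ℤ) * x + (16 : ℤ) := by
    push_cast; linear_combination h
  obtain ⟨hx, hy⟩ := rat_pt_integral hv h3 h'
  obtain ⟨m, hm, hxm⟩ := rat_residue_int hv h3 hx
  obtain ⟨n, hn, hyn⟩ := rat_residue_int hv h3 hy
  have hmn := rat_residue_eq hv h3 h' m n hxm hyn
  have go : ∀ x₀ y₀ : ℤ, (y₀ : ℚ) ^ 2 = x₀ ^ 3 + (-4 : ℤ) * x₀ ^ 2 + (0 : ℤ) * x₀ + (16 : ℤ) →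
      3 ∣ m - x₀ → 3 ∣ n - y₀ → (¬ 3 ∣ y₀ ∨ ¬ 3 ∣ 3 * x₀ ^ 2 + 2 * (-4) * x₀ + 0) → x = x₀ :=
    fun x₀ y₀ h₀ h1 h2 h4 => (rat_pt_eq hv h3 h' h₀ (rat_congr hv h3 m x₀ h1 hxm)
      (rat_congr hv h3 n y₀ h2 hyn) h4).1
  rcases hm with rfl | rfl | rfl <;> rcases hn with rfl | rfl | rfl <;> norm_num at hmn
  · left; simpa using go 0 4 (by norm_num) (by norm_num) (by norm_num) (by norm_num)
  · left; simpa using go 0 (-4) (by norm_num) (by norm_num) (by norm_num) (by norm_num)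
  · right; simpa using go 4 4 (by norm_num) (by norm_num) (by norm_num) (by norm_num)
  · right; simpa using go 4 (-4) (by norm_num) (by norm_num) (by norm_num) (by norm_num)

open Polynomial NumberField Module

section PowerBasis

variable {K : Type*} [Field K] [NumberField K]

/-- The power basis generated by an element of full degree. -/
theorem exists_powerBasis {g : ℚ[X]} (hg : g.Monic) (hirr : Irreducible g) {θ : K}
    (hθ : aeval θ g = 0) (hdeg : finrank ℚ K = g.natDegree) :
    minpoly ℚ θ = g ∧ ∃ pb : PowerBasis ℚ K, pb.gen = θ ∧ pb.dim = g.natDegree := by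
  have hmin : minpoly ℚ θ = g := (minpoly.eq_of_irreducible_of_monic hirr hθ hg).symm
  have hIntegral : IsIntegral ℚ θ := IsIntegral.of_finite ℚ θ
  have htop : IntermediateField.adjoin ℚ {θ} = ⊤ := by
    rw [Field.primitive_element_iff_minpoly_natDegree_eq, hmin, hdeg]
  have htop' : Algebra.adjoin ℚ {θ} = ⊤ := by
    rw [← IntermediateField.adjoin_simple_toSubalgebra_of_isAlgebraic hIntegral.isAlgebraic, htop]; rfl
  refine ⟨hmin, PowerBasis.ofAdjoinEqTop hIntegral htop', ?_, ?_⟩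
  · simp
  · rw [PowerBasis.ofAdjoinEqTop_dim, hmin]

theorem norm_algebraMap_sub_gen (pb : PowerBasis ℚ K) (q : ℚ) :
    Algebra.norm ℚ (algebraMap ℚ K q - pb.gen) = (minpoly ℚ pb.gen).eval q := by
  rw [Algebra.norm_eq_matrix_det pb.basis, ← charpoly_leftMulMatrix, Matrix.eval_charpoly, map_sub,
    AlgHom.commutes]
  rfl

theorem exists_discr_eq (pb : PowerBasis ℚ K) (hIntegral : IsIntegral ℤ pb.gen) :
    ∃ n : ℤ, Algebra.discr ℚ pb.basis = n ^ 2 * NumberField.discr K := by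
  classical
  let b := integralBasis K
  let e : Fin pb.dim ≃ Free.ChooseBasisIndex ℤ (𝓞 K) := pb.basis.indexEquiv b
  let b' := b.reindex e.symm
  have hb' : Algebra.discr ℚ b' = NumberField.discr K := by
    rw [NumberField.coe_discr, ← Algebra.discr_reindex ℚ (integralBasis K) e.symm]
    congr 1
    ext i
    simp [b', b]
  have hi : ∀ i, IsIntegral ℤ (pb.basis i) := fun i => by
    rw [pb.basis_eq_pow]; exact hIntegral.pow _
  have hrep : ∀ i j, ∃ n : ℤ, b'.repr (pb.basis i) j = n := fun i j => by
    refine ⟨(RingOfIntegers.basis K).repr ⟨pb.basis i, hi i⟩ (e j), ?_⟩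
    simp only [b', b, Basis.repr_reindex_apply, Equiv.symm_symm]
    exact integralBasis_repr_apply K ⟨pb.basis i, hi i⟩ (e j)
  choose n hn using hrep
  refine ⟨(Matrix.of fun i j => n i j : Matrix _ _ ℤ).det, ?_⟩
  rw [← hb']
  have : (pb.basis : Fin pb.dim → K) = ((Matrix.of fun i j => (n i j : ℚ)).map (algebraMap ℚ K)).mulVec b' := by
    ext i
    rw [Matrix.mulVec, dotProduct]
    conv_lhs => rw [← b'.sum_repr (pb.basis i)]
    refine Finset.sum_congr rfl fun j _ => ?_
    rw [hn, Algebra.smul_def]; rfl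
  rw [this, Algebra.discr_of_matrix_mulVec]
  congr 2
  exact ((Int.castRingHom ℚ).map_det _).symm

end PowerBasis

section Units

variable (K : Type*) [Field K] [NumberField K]

/-- The group of units modulo squares has at most `2 ^ (rank + 1)` elements if the only roots
of unity are `1` and `-1`. -/
theorem card_units_mod_squares (htors : ∀ ζ ∈ Units.torsion K, ζ = 1 ∨ ζ = -1) :
    Finite ((𝓞 K)ˣ ⧸ (powMonoidHom 2 : (𝓞 K)ˣ →* (𝓞 K)ˣ).range) ∧
    Nat.card ((𝓞 K)ˣ ⧸ (powMonoidHom 2 : (𝓞 K)ˣ →* (𝓞 K)ˣ).range) ≤ 2 ^ (Units.rank K + 1) := by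
  classical
  let f : Bool × (Fin (Units.rank K) → Bool) → (𝓞 K)ˣ := fun p =>
    (if p.1 then -1 else 1) * ∏ i, if p.2 i then Units.fundSystem K i else 1
  have hf : Function.Surjective fun p =>
      (f p : (𝓞 K)ˣ ⧸ (powMonoidHom 2 : (𝓞 K)ˣ →* (𝓞 K)ˣ).range) := by
    intro q
    obtain ⟨u, rfl⟩ := QuotientGroup.mk_surjective q
    obtain ⟨⟨ζ, e⟩, hu, -⟩ := Units.exist_unique_eq_mul_prod K u
    refine ⟨(decide ((ζ : (𝓞 K)ˣ) = -1), fun i => decide (Odd (e i))), ?_⟩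
    rw [QuotientGroup.eq]
    refine ⟨∏ i, Units.fundSystem K i ^ (e i / 2), ?_⟩
    rw [eq_inv_mul_iff_mul_eq, hu]
    simp only [powMonoidHom_apply, f, ← Finset.prod_pow, mul_assoc, ← Finset.prod_mul_distrib]
    congr 1
    · rcases htors ζ ζ.2 with h | h
      · rw [h]
        split_ifs with h1
        · exact (of_decide_eq_true h1).symm
        · rfl
      · simp [h]
    · refine Finset.prod_congr rfl fun i _ => ?_
      by_cases ho : Odd (e i)
      · simp only [ho, decide_true, if_true]
        rw [← zpow_natCast, ← zpow_mul, ← zpow_one_add]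
        congr 1
        obtain ⟨k, hk⟩ := ho
        push_cast; omega
      · simp only [ho, decide_false, Bool.false_eq_true, if_false, one_mul]
        rw [← zpow_natCast, ← zpow_mul]
        congr 1
        rw [Int.not_odd_iff_even] at ho
        obtain ⟨k, hk⟩ := ho
        push_cast; omega
  refine ⟨Finite.of_surjective _ hf, (Nat.card_le_card_of_surjective _ hf).trans ?_⟩
  simp [Nat.card_eq_fintype_card, pow_succ, mul_comm]

/-- A family of `2 ^ (rank + 1)` units in distinct square classes represents all of them. -/
theorem exists_unit_class (htors : ∀ ζ ∈ Units.torsion K, ζ = 1 ∨ ζ = -1) {ι : Type*} [Finite ι]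
    (hι : 2 ^ (Units.rank K + 1) ≤ Nat.card ι) (f : ι → (𝓞 K)ˣ)
    (hf : ∀ i j w, f i = f j * w ^ 2 → i = j) (u : (𝓞 K)ˣ) : ∃ i w, u = f i * w ^ 2 := by
  obtain ⟨hfin, hcard⟩ := card_units_mod_squares K htors
  have hinj : Function.Injective fun i =>
      (f i : (𝓞 K)ˣ ⧸ (powMonoidHom 2 : (𝓞 K)ˣ →* (𝓞 K)ˣ).range) := by
    intro i j hij
    obtain ⟨w, hw⟩ := (QuotientGroup.eq).1 hij.symm
    exact hf i j w (by rw [eq_comm, ← eq_inv_mul_iff_mul_eq]; exact hw)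
  have hbij := (Nat.bijective_iff_injective_and_card _).2
    ⟨hinj, le_antisymm (Nat.card_le_card_of_injective _ hinj) (hcard.trans hι)⟩
  obtain ⟨i, hi⟩ := hbij.2 (u : (𝓞 K)ˣ ⧸ (powMonoidHom 2 : (𝓞 K)ˣ →* (𝓞 K)ˣ).range)
  obtain ⟨w, hw⟩ := (QuotientGroup.eq).1 hi
  exact ⟨i, w, by rw [eq_comm, ← eq_inv_mul_iff_mul_eq]; exact hw⟩

theorem torsion_of_real (φ : K →+* ℝ) : ∀ ζ ∈ Units.torsion K, ζ = 1 ∨ ζ = -1 := by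
  intro ζ hζ
  obtain ⟨n, hn, h⟩ := isOfFinOrder_iff_pow_eq_one.1 ((CommGroup.mem_torsion _).1 hζ)
  have h1 : (φ ζ) ^ n = 1 := by
    rw [← map_pow]
    have := congrArg (fun u : (𝓞 K)ˣ => ((u : 𝓞 K) : K)) h
    simp only [Units.val_pow_eq_pow_val] at this
    simpa using congrArg φ this
  have h2 : |φ ζ| = 1 := by
    have : |φ ζ| ^ n = 1 := by rw [← abs_pow, h1, abs_one]
    exact (pow_eq_one_iff_of_nonneg (abs_nonneg _) hn.ne').1 this
  have h3 : ∀ s : K, φ ζ = φ s → ((ζ : 𝓞 K) : K) = s := fun s hs => φ.injective hs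
  rcases eq_or_eq_neg_of_abs_eq h2 with h | h
  · left
    ext
    simpa using h3 1 (by simpa using h)
  · right
    ext
    simpa using h3 (-1) (by simpa using h)

end Units

section Factor

/-- In a unique factorization domain, a factor of a square is a unit times a square times a
common divisor of both factors. -/
theorem exists_eq_gcd_mul_sq {R : Type*} [CommRing R] [IsDomain R] [IsPrincipalIdealRing R]
    {g h y : R} (hy : y ≠ 0) (e : g * h = y ^ 2) :
    ∃ (d m : R) (u : Rˣ), d ∣ g ∧ d ∣ h ∧ g = u * d * m ^ 2 := by
  classical
  let := UniqueFactorizationMonoid.toGCDMonoid R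
  have hg : g ≠ 0 := by rintro rfl; rw [zero_mul] at e; exact pow_ne_zero 2 hy e.symm
  have hd0 : gcd g h ≠ 0 := fun h0 => hg ((gcd_eq_zero_iff _ _).1 h0).1
  obtain ⟨g', hg'⟩ := gcd_dvd_left g h
  obtain ⟨h', hh'⟩ := gcd_dvd_right g h
  have hdy : gcd g h ∣ y := by
    refine (IsIntegrallyClosed.pow_dvd_pow_iff two_ne_zero).1 (Dvd.intro (g' * h') ?_)
    calc _ = (gcd g h * g') * (gcd g h * h') := by ring
      _ = _ := by rw [← hg', ← hh', e]
  obtain ⟨y', hy'⟩ := hdy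
  have e' : g' * h' = y' ^ 2 := by
    refine mul_left_cancel₀ (pow_ne_zero 2 hd0) ?_
    calc gcd g h ^ 2 * (g' * h') = (gcd g h * g') * (gcd g h * h') := by ring
      _ = (gcd g h) ^ 2 * y' ^ 2 := by rw [← hg', ← hh', e, ← mul_pow, ← hy']
  have hu : IsUnit (gcd g' h') := by
    have : gcd (gcd g h * g') (gcd g h * h') = gcd g h := by rw [← hg', ← hh']
    have h2 := (gcd_mul_left' (gcd g h) g' h').symm
    rw [this] at h2
    have h3 : Associated (gcd g h * gcd g' h') (gcd g h * 1) := by rw [mul_one]; exact h2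
    exact associated_one_iff_isUnit.1 (h3.of_mul_left (Associated.refl _) hd0)
  obtain ⟨m, u, hm⟩ := exists_associated_pow_of_mul_eq_pow hu e'
  exact ⟨gcd g h, m, u, gcd_dvd_left _ _, gcd_dvd_right _ _, by
    conv_lhs => rw [hg', ← hm]
    ring⟩

end Factor

open Polynomial NumberField Module

section Coordinates

variable {K : Type*} [Field K] [NumberField K]

theorem exists_coordinates (pb : PowerBasis ℚ K) (z : K) :
    ∃ f : ℕ → ℚ, z = ∑ i ∈ Finset.range pb.dim, (f i : K) * pb.gen ^ i := by
  obtain ⟨f, hf, rfl⟩ := pb.exists_eq_aeval z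
  refine ⟨f.coeff, ?_⟩
  rw [aeval_eq_sum_range' hf]
  simp [Algebra.smul_def]

theorem eq_zero_of_coordinates (pb : PowerBasis ℚ K) {f : ℕ → ℚ}
    (h : ∑ i ∈ Finset.range pb.dim, (f i : K) * pb.gen ^ i = 0) {i : ℕ} (hi : i < pb.dim) :
    f i = 0 := by
  have hli := Fintype.linearIndependent_iff.1 pb.basis.linearIndependent (fun j => f j) (by
    rw [← h, Finset.sum_range]
    simp [Algebra.smul_def])
  exact hli ⟨i, hi⟩

end Coordinates

/-- Integral coordinates with at least one odd entry, up to scaling. -/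
theorem exists_primitive (a b c n : ℤ) (hn : n ≠ 0) :
    ∃ (k : ℕ) (a' b' c' n' : ℤ), a = 2 ^ k * a' ∧ b = 2 ^ k * b' ∧ c = 2 ^ k * c' ∧ n = 2 ^ k * n' ∧
      ¬ (2 ∣ a' ∧ 2 ∣ b' ∧ 2 ∣ c' ∧ 2 ∣ n') := by
  induction hm : n.natAbs using Nat.strong_induction_on generalizing a b c n with
  | _ m ih =>
    by_cases h : 2 ∣ a ∧ 2 ∣ b ∧ 2 ∣ c ∧ 2 ∣ n
    · obtain ⟨⟨a, rfl⟩, ⟨b, rfl⟩, ⟨c, rfl⟩, ⟨n, rfl⟩⟩ := h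
      obtain ⟨k, a', b', c', n', rfl, rfl, rfl, rfl, hh⟩ :=
        ih n.natAbs (by omega) a b c n (by rintro rfl; simp at hn) rfl
      exact ⟨k + 1, a', b', c', n', by ring, by ring, by ring, by ring, hh⟩
    · exact ⟨0, a, b, c, n, by simp, by simp, by simp, by simp, h⟩

theorem exists_primitive_rat (a b c : ℚ) :
    ∃ (q : ℚ) (a' b' c' n' : ℤ), q ≠ 0 ∧ q * a = a' ∧ q * b = b' ∧ q * c = c' ∧ q = n' ∧
      ¬ (2 ∣ a' ∧ 2 ∣ b' ∧ 2 ∣ c' ∧ 2 ∣ n') := by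
  have hn : (a.den * b.den * c.den : ℤ) ≠ 0 := by simp
  obtain ⟨k, a', b', c', n', ha, hb, hc, hn', hh⟩ := exists_primitive (a.num * b.den * c.den)
    (b.num * a.den * c.den) (c.num * a.den * b.den) (a.den * b.den * c.den) hn
  have hda : (a.den : ℚ) ≠ 0 := by simp
  have hdb : (b.den : ℚ) ≠ 0 := by simp
  have hdc : (c.den : ℚ) ≠ 0 := by simp
  have ea := Rat.num_div_den a
  have eb := Rat.num_div_den b
  have ec := Rat.num_div_den c
  have h2 : (2 : ℚ) ^ k ≠ 0 := by positivity
  have ha := congrArg (Int.cast : ℤ → ℚ) ha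
  have hb := congrArg (Int.cast : ℤ → ℚ) hb
  have hc := congrArg (Int.cast : ℤ → ℚ) hc
  have hn' := congrArg (Int.cast : ℤ → ℚ) hn'
  push_cast at ha hb hc hn'
  rw [div_eq_iff (by assumption)] at ea eb ec
  rw [ea] at ha
  rw [eb] at hb
  rw [ec] at hc
  refine ⟨n', a', b', c', n', ?_, ?_, ?_, ?_, rfl, hh⟩
  · intro h0
    rw [h0, mul_zero] at hn'
    exact hn (by exact_mod_cast hn')
  · refine mul_left_cancel₀ h2 ?_
    linear_combination ha - a * hn'
  · refine mul_left_cancel₀ h2 ?_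
    linear_combination hb - b * hn'
  · refine mul_left_cancel₀ h2 ?_
    linear_combination hc - c * hn'

theorem cubic_irreducible : Irreducible (X ^ 3 - 2 * X ^ 2 + 2 : ℚ[X]) := by
  have hm : (X ^ 3 - 2 * X ^ 2 + 2 : ℤ[X]).Monic := by monicity!
  have hd : (X ^ 3 - 2 * X ^ 2 + 2 : ℤ[X]).natDegree = 3 := by compute_degree!
  have hp : (Ideal.span {(2 : ℤ)}).IsPrime :=
    (Ideal.span_singleton_prime two_ne_zero).2 Int.prime_two
  have := (Polynomial.IsEisensteinAt.mk (𝓟 := Ideal.span {(2 : ℤ)}) ?_ ?_ ?_).irreducible hp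
    hm.isPrimitive (by rw [hd]; norm_num)
  · have h := (hm.irreducible_iff_irreducible_map_fraction_map (K := ℚ)).1 this
    simpa using h
  · rw [hm.leadingCoeff, Ideal.mem_span_singleton]; norm_num
  · intro n hn
    rw [hd] at hn
    have e : (X ^ 3 - 2 * X ^ 2 + 2 : ℤ[X]) = X ^ 3 - C 2 * X ^ 2 + C 2 := rfl
    rw [Ideal.mem_span_singleton, e]
    interval_cases n <;> simp [coeff_X_pow]
  · rw [Ideal.span_singleton_pow, Ideal.mem_span_singleton]
    simp [coeff_zero_eq_eval_zero]

theorem quartic_irreducible : Irreducible (X ^ 4 - 4 * X ^ 2 + 2 : ℚ[X]) := by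
  have hm : (X ^ 4 - 4 * X ^ 2 + 2 : ℤ[X]).Monic := by monicity!
  have hd : (X ^ 4 - 4 * X ^ 2 + 2 : ℤ[X]).natDegree = 4 := by compute_degree!
  have hp : (Ideal.span {(2 : ℤ)}).IsPrime :=
    (Ideal.span_singleton_prime two_ne_zero).2 Int.prime_two
  have := (Polynomial.IsEisensteinAt.mk (𝓟 := Ideal.span {(2 : ℤ)}) ?_ ?_ ?_).irreducible hp
    hm.isPrimitive (by rw [hd]; norm_num)
  · have h := (hm.irreducible_iff_irreducible_map_fraction_map (K := ℚ)).1 this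
    simpa using h
  · rw [hm.leadingCoeff, Ideal.mem_span_singleton]; norm_num
  · intro n hn
    rw [hd] at hn
    have e : (X ^ 4 - 4 * X ^ 2 + 2 : ℤ[X]) = X ^ 4 - C 4 * X ^ 2 + C 2 := rfl
    rw [Ideal.mem_span_singleton, e]
    interval_cases n <;> simp [coeff_X_pow]
  · rw [Ideal.span_singleton_pow, Ideal.mem_span_singleton]
    simp [coeff_zero_eq_eval_zero]

open Polynomial NumberField Module

section CubicField

variable {L : Type*} [Field L] [NumberField L] {χ : L}

theorem cubic_powerBasis (hχ : χ ^ 3 - 2 * χ ^ 2 + 2 = 0) (hdeg : finrank ℚ L = 3) :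
    ∃ pb : PowerBasis ℚ L, pb.gen = χ ∧ pb.dim = 3 ∧ minpoly ℚ χ = X ^ 3 - 2 * X ^ 2 + 2 := by
  have hd : (X ^ 3 - 2 * X ^ 2 + 2 : ℚ[X]).natDegree = 3 := by compute_degree!
  obtain ⟨h, pb, h1, h2⟩ := exists_powerBasis (K := L) (θ := χ) (g := X ^ 3 - 2 * X ^ 2 + 2)
    (by monicity!) cubic_irreducible (by simpa [map_ofNat] using hχ) (by rw [hd, hdeg])
  exact ⟨pb, h1, h2.trans hd, h⟩

theorem cubic_coordinates (hχ : χ ^ 3 - 2 * χ ^ 2 + 2 = 0) (hdeg : finrank ℚ L = 3) (z : L) :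
    ∃ a b c : ℚ, z = a + b * χ + c * χ ^ 2 := by
  obtain ⟨pb, rfl, hd, -⟩ := cubic_powerBasis hχ hdeg
  obtain ⟨f, hf⟩ := exists_coordinates pb z
  refine ⟨f 0, f 1, f 2, ?_⟩
  rw [hf, hd]
  simp [Finset.sum_range_succ]

theorem cubic_coordinates_eq (hχ : χ ^ 3 - 2 * χ ^ 2 + 2 = 0) (hdeg : finrank ℚ L = 3)
    {a b c : ℚ} (h : (a + b * χ + c * χ ^ 2 : L) = 0) : a = 0 ∧ b = 0 ∧ c = 0 := by
  obtain ⟨pb, rfl, hd, -⟩ := cubic_powerBasis hχ hdeg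
  have := fun i (hi : i < pb.dim) => eq_zero_of_coordinates pb
    (f := fun i => if i = 0 then a else if i = 1 then b else c)
    (by rw [hd, ← h]; simp [Finset.sum_range_succ]) hi
  rw [hd] at this
  exact ⟨by simpa using this 0 (by norm_num), by simpa using this 1 (by norm_num),
    by simpa using this 2 (by norm_num)⟩

theorem cubic_norm (hχ : χ ^ 3 - 2 * χ ^ 2 + 2 = 0) (hdeg : finrank ℚ L = 3) (p q : ℚ) :
    Algebra.norm ℚ (p - q * χ : L) = p ^ 3 - 2 * p ^ 2 * q + 2 * q ^ 3 := by
  obtain ⟨pb, rfl, hd, hmin⟩ := cubic_powerBasis hχ hdeg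
  by_cases hq : q = 0
  · have : (p - q * pb.gen : L) = algebraMap ℚ L p := by simp [hq]
    rw [this, Algebra.norm_algebraMap, hdeg, hq]; ring
  have h := norm_algebraMap_sub_gen pb (p / q)
  have e : (p - q * pb.gen : L) = algebraMap ℚ L q * (algebraMap ℚ L (p / q) - pb.gen) := by
    have : (q : L) ≠ 0 := by exact_mod_cast hq
    simp only [eq_ratCast, Rat.cast_div]
    field_simp
  rw [e, map_mul, h, Algebra.norm_algebraMap, hdeg, hmin]
  simp
  field_simp

theorem cubic_discr (hχ : χ ^ 3 - 2 * χ ^ 2 + 2 = 0) (hdeg : finrank ℚ L = 3) :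
    ∃ n : ℤ, -44 = n ^ 2 * NumberField.discr L := by
  obtain ⟨pb, rfl, hd, hmin⟩ := cubic_powerBasis hχ hdeg
  have hIntegral : IsIntegral ℤ pb.gen :=
    ⟨X ^ 3 - 2 * X ^ 2 + 2, by monicity!, by simpa [← aeval_def] using hχ⟩
  obtain ⟨n, hn⟩ := exists_discr_eq pb hIntegral
  refine ⟨n, ?_⟩
  rw [Algebra.discr_powerBasis_eq_norm, hmin, hdeg] at hn
  have e : (aeval pb.gen) (derivative (X ^ 3 - 2 * X ^ 2 + 2 : ℚ[X]))
      = (((0 : ℚ) : L) - ((-1 : ℚ) : L) * pb.gen) * (((-4 : ℚ) : L) - ((-3 : ℚ) : L) * pb.gen) := by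
    simp [map_ofNat]
    ring
  rw [e, map_mul, cubic_norm hχ hdeg, cubic_norm hχ hdeg] at hn
  norm_num at hn
  exact_mod_cast hn

theorem cubic_field (hχ : χ ^ 3 - 2 * χ ^ 2 + 2 = 0) (hdeg : finrank ℚ L = 3) :
    IsPrincipalIdealRing (𝓞 L) ∧ Units.rank L = 1 := by
  obtain ⟨n, hn⟩ := cubic_discr hχ hdeg
  have hn0 : 0 < n ^ 2 := by
    rcases (sq_nonneg n).lt_or_eq with h | h
    · exact h
    · rw [← h] at hn; norm_num at hn
  have hneg : NumberField.discr L < 0 := by nlinarith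
  have hle : |NumberField.discr L| ≤ 44 := by rw [abs_of_neg hneg]; nlinarith
  have hs := NumberField.sign_discr L
  rw [Int.sign_eq_neg_one_of_neg hneg] at hs
  have hr := InfinitePlace.card_add_two_mul_card_eq_rank L
  rw [hdeg] at hr
  have hr2 : InfinitePlace.nrComplexPlaces L = 1 := by
    have : InfinitePlace.nrComplexPlaces L ≠ 0 := fun h => by rw [h] at hs; norm_num at hs
    omega
  refine ⟨RingOfIntegers.isPrincipalIdealRing_of_abs_discr_lt ?_, ?_⟩
  · rw [hr2, hdeg]
    have : (|NumberField.discr L| : ℝ) ≤ 44 := by exact_mod_cast hle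
    push_cast
    refine this.trans_lt ?_
    norm_num [Nat.factorial]
    nlinarith [Real.pi_gt_d2]
  · rw [Units.rank, InfinitePlace.card_eq_nrRealPlaces_add_nrComplexPlaces]
    omega

theorem cubic_not_sq (hχ : χ ^ 3 - 2 * χ ^ 2 + 2 = 0) (hdeg : finrank ℚ L = 3) (w : L) :
    1 - χ ≠ w ^ 2 := by
  obtain ⟨a, b, c, rfl⟩ := cubic_coordinates hχ hdeg w
  intro h
  obtain ⟨h0, h1, h2⟩ := cubic_coordinates_eq hχ hdeg (a := a ^ 2 - 4 * b * c - 4 * c ^ 2 - 1)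
    (b := 2 * a * b - 2 * c ^ 2 + 1) (c := b ^ 2 + 2 * a * c + 4 * b * c + 4 * c ^ 2) (by
      push_cast
      linear_combination -h - (2 * b * c + c ^ 2 * χ + 2 * c ^ 2) * hχ)
  obtain ⟨q, a', b', c', n', hq, ha, hb, hc, hn, hodd⟩ := exists_primitive_rat a b c
  have h0' : a' ^ 2 - 4 * b' * c' - 4 * c' ^ 2 = n' ^ 2 := by
    have : (a' : ℚ) ^ 2 - 4 * b' * c' - 4 * c' ^ 2 = n' ^ 2 := by
      rw [← ha, ← hb, ← hc, ← hn]; linear_combination q ^ 2 * h0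
    exact_mod_cast this
  have h1' : 2 * a' * b' - 2 * c' ^ 2 = -n' ^ 2 := by
    have : 2 * (a' : ℚ) * b' - 2 * c' ^ 2 = -n' ^ 2 := by
      rw [← ha, ← hb, ← hc, ← hn]; linear_combination q ^ 2 * h1
    exact_mod_cast this
  have h2' : b' ^ 2 + 2 * a' * c' + 4 * b' * c' + 4 * c' ^ 2 = 0 := by
    have : (b' : ℚ) ^ 2 + 2 * a' * c' + 4 * b' * c' + 4 * c' ^ 2 = 0 := by
      rw [← ha, ← hb, ← hc]; linear_combination q ^ 2 * h2
    exact_mod_cast this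
  have hn2 : 2 ∣ n' := Int.prime_two.dvd_of_dvd_pow (n := 2) ⟨c' ^ 2 - a' * b', by linarith⟩
  obtain ⟨n, rfl⟩ := hn2
  have ha2 : 2 ∣ a' := Int.prime_two.dvd_of_dvd_pow (n := 2)
    ⟨2 * b' * c' + 2 * c' ^ 2 + 2 * n ^ 2, by linarith⟩
  obtain ⟨a, rfl⟩ := ha2
  have hb2 : 2 ∣ b' := Int.prime_two.dvd_of_dvd_pow (n := 2)
    ⟨-(2 * a * c' + 2 * b' * c' + 2 * c' ^ 2), by linarith⟩
  obtain ⟨b, rfl⟩ := hb2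
  have hc2 : 2 ∣ c' := Int.prime_two.dvd_of_dvd_pow (n := 2)
    ⟨2 * a * b + n ^ 2, by linarith⟩
  exact hodd ⟨⟨_, rfl⟩, ⟨_, rfl⟩, hc2, ⟨_, rfl⟩⟩

theorem cubic_ne_twisted_sq (hχ : χ ^ 3 - 2 * χ ^ 2 + 2 = 0) (hdeg : finrank ℚ L = 3)
    (x : ℚ) (w : L) : x - 2 * χ ≠ (1 - χ) * w ^ 2 := by
  obtain ⟨a, b, c, rfl⟩ := cubic_coordinates hχ hdeg w
  intro h
  obtain ⟨-, h1, h2⟩ := cubic_coordinates_eq hχ hdeg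
    (a := a ^ 2 - 4 * b * c - 4 * c ^ 2 + 2 * (b ^ 2 + 2 * a * c + 4 * b * c + 4 * c ^ 2) - x)
    (b := 2 * a * b - 2 * c ^ 2 - (a ^ 2 - 4 * b * c - 4 * c ^ 2) + 2)
    (c := -(2 * a * b - 2 * c ^ 2) - (b ^ 2 + 2 * a * c + 4 * b * c + 4 * c ^ 2)) (by
      push_cast
      linear_combination -h - ((2 * b * c + c ^ 2 * χ + 2 * c ^ 2) * (1 - χ)
        - (b ^ 2 + 2 * a * c + 4 * b * c + 4 * c ^ 2)) * hχ)
  obtain ⟨q, a', b', c', n', hq, ha, hb, hc, hn, hodd⟩ := exists_primitive_rat a b c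
  have h1' : a' ^ 2 - 2 * a' * b' - 2 * c' ^ 2 - 4 * b' * c' = 2 * n' ^ 2 := by
    have : (a' : ℚ) ^ 2 - 2 * a' * b' - 2 * c' ^ 2 - 4 * b' * c' = 2 * n' ^ 2 := by
      rw [← ha, ← hb, ← hc, ← hn]; linear_combination -q ^ 2 * h1
    exact_mod_cast this
  have h2' : b' ^ 2 + 2 * a' * b' + 2 * a' * c' + 4 * b' * c' + 2 * c' ^ 2 = 0 := by
    have : (b' : ℚ) ^ 2 + 2 * a' * b' + 2 * a' * c' + 4 * b' * c' + 2 * c' ^ 2 = 0 := by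
      rw [← ha, ← hb, ← hc]; linear_combination -q ^ 2 * h2
    exact_mod_cast this
  have hb2 : 2 ∣ b' := Int.prime_two.dvd_of_dvd_pow (n := 2)
    ⟨-(a' * b' + a' * c' + 2 * b' * c' + c' ^ 2), by linarith⟩
  obtain ⟨b, rfl⟩ := hb2
  have ha2 : 2 ∣ a' := Int.prime_two.dvd_of_dvd_pow (n := 2)
    ⟨n' ^ 2 + 2 * a' * b + c' ^ 2 + 4 * b * c', by linarith⟩
  obtain ⟨a, rfl⟩ := ha2
  have hc2 : 2 ∣ c' := Int.prime_two.dvd_of_dvd_pow (n := 2)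
    ⟨-(b ^ 2 + 2 * a * b + a * c' + 2 * b * c'), by linarith⟩
  obtain ⟨c, rfl⟩ := hc2
  have hn2 : 2 ∣ n' := Int.prime_two.dvd_of_dvd_pow (n := 2)
    ⟨a ^ 2 - 2 * a * b - 2 * c ^ 2 - 4 * b * c, by linarith⟩
  exact hodd ⟨⟨_, rfl⟩, ⟨_, rfl⟩, ⟨_, rfl⟩, hn2⟩

end CubicField

open Polynomial NumberField Module

section CubicField

variable {L : Type*} [Field L] [NumberField L] {χ : 𝓞 L}

/-- The unit `1 - χ`. -/
def cubicUnit (hχ : χ ^ 3 - 2 * χ ^ 2 + 2 = 0) : (𝓞 L)ˣ where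
  val := 1 - χ
  inv := χ ^ 2 - χ - 1
  val_inv := by linear_combination -hχ
  inv_val := by linear_combination -hχ

theorem cubic_norm_int (hχ : χ ^ 3 - 2 * χ ^ 2 + 2 = 0) (hdeg : finrank ℚ L = 3) (p q : ℤ) :
    Algebra.norm ℤ (p - q * χ : 𝓞 L) = p ^ 3 - 2 * p ^ 2 * q + 2 * q ^ 3 := by
  have hχ' : (χ : L) ^ 3 - 2 * (χ : L) ^ 2 + 2 = 0 := by
    simpa [map_ofNat] using congrArg (algebraMap (𝓞 L) L) hχ
  have := cubic_norm hχ' hdeg p q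
  have e := Algebra.coe_norm_int (p - q * χ : 𝓞 L)
  rw [← Int.cast_inj (α := ℚ), e]
  push_cast
  rw [← this]
  simp

theorem cubic_unit_class (hχ : χ ^ 3 - 2 * χ ^ 2 + 2 = 0) (hdeg : finrank ℚ L = 3) (u : (𝓞 L)ˣ)
    (hu : 0 < Algebra.norm ℤ (u : 𝓞 L)) :
    ∃ w : 𝓞 L, (u : 𝓞 L) = w ^ 2 ∨ (u : 𝓞 L) = (1 - χ) * w ^ 2 := by
  have hχ' : (χ : L) ^ 3 - 2 * (χ : L) ^ 2 + 2 = 0 := by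
    simpa [map_ofNat] using congrArg (algebraMap (𝓞 L) L) hχ
  have hr := (cubic_field hχ' hdeg).2
  let f : Bool × Bool → (𝓞 L)ˣ := fun p =>
    (if p.1 then -1 else 1) * (if p.2 then cubicUnit hχ else 1)
  have hN1 : Algebra.norm ℤ ((cubicUnit hχ : (𝓞 L)ˣ) : 𝓞 L) = 1 := by
    simpa [cubicUnit] using cubic_norm_int hχ hdeg 1 1
  have hN2 : Algebra.norm ℤ (-1 : 𝓞 L) = -1 := by
    simpa using cubic_norm_int hχ hdeg (-1) 0
  have hN3 : Algebra.norm ℤ (-((cubicUnit hχ : (𝓞 L)ˣ) : 𝓞 L)) = -1 := by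
    rw [← neg_one_mul, map_mul, hN1, hN2]; norm_num
  have hN : ∀ p, Algebra.norm ℤ ((f p : (𝓞 L)ˣ) : 𝓞 L) = if p.1 then -1 else 1 := by
    rintro ⟨a, b⟩
    cases a <;> cases b <;> simp [f, hN1, hN2, hN3]
  have hns : ∀ w : 𝓞 L, (1 - χ : 𝓞 L) ≠ w ^ 2 := fun w h => by
    refine cubic_not_sq hχ' hdeg w ?_
    simpa using congrArg (algebraMap (𝓞 L) L) h
  have hf : ∀ i j w, f i = f j * w ^ 2 → i = j := by
    intro i j w h
    have hn := congrArg (fun u : (𝓞 L)ˣ => Algebra.norm ℤ (u : 𝓞 L)) h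
    have h' := congrArg (fun u : (𝓞 L)ˣ => (u : 𝓞 L)) h
    simp only [Units.val_mul, map_mul, hN, Units.val_pow_eq_pow_val, map_pow] at hn
    obtain ⟨a, b⟩ := i
    obtain ⟨c, d⟩ := j
    have hac : a = c := by
      cases a <;> cases c <;> simp at hn ⊢ <;> nlinarith [sq_nonneg (Algebra.norm ℤ (w : 𝓞 L))]
    subst hac
    have hbd : b = d := by
      have h2 : (if b then 1 - χ else 1) = (if d then 1 - χ else 1) * (w : 𝓞 L) ^ 2 := by
        cases a
        · cases b <;> cases d <;> simpa [f, cubicUnit] using h'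
        · rw [← neg_inj]
          cases b <;> cases d <;> simpa [f, cubicUnit] using h'
      cases b <;> cases d <;> simp at h2 ⊢
      · refine hns ((w⁻¹ : (𝓞 L)ˣ) : 𝓞 L) ?_
        have hw : (w : 𝓞 L) * ((w⁻¹ : (𝓞 L)ˣ) : 𝓞 L) = 1 := w.mul_inv
        linear_combination -((w⁻¹ : (𝓞 L)ˣ) : 𝓞 L) ^ 2 * h2
          - (1 - χ) * ((w : 𝓞 L) * ((w⁻¹ : (𝓞 L)ˣ) : 𝓞 L) + 1) * hw
      · exact hns _ h2
    rw [hbd]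
  have htors : ∀ ζ ∈ Units.torsion L, ζ = 1 ∨ ζ = -1 := by
    intro ζ hζ
    have hodd : Odd (finrank ℚ L) := by rw [hdeg]; decide
    simpa [Subtype.ext_iff] using Units.torsion_eq_one_or_neg_one_of_odd_finrank hodd ⟨ζ, hζ⟩
  obtain ⟨⟨a, b⟩, w, hw⟩ := exists_unit_class L htors (by rw [hr]; simp) f hf u
  have ha : a = false := by
    by_contra h
    rw [Bool.not_eq_false] at h
    rw [hw, Units.val_mul, map_mul, hN, h, Units.val_pow_eq_pow_val, map_pow] at hu
    simp at hu
    nlinarith [sq_nonneg (Algebra.norm ℤ (w : 𝓞 L))]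
  subst ha
  refine ⟨w, ?_⟩
  rw [hw]
  cases b
  · left; simp [f]
  · right; simp [f, cubicUnit]

theorem even_of_norm_sq {s e m : ℤ} {i j : ℕ} (hs : s ≠ 0)
    (h : 2 ^ i * 11 ^ j * m ^ 2 * e ^ 2 = s ^ 2 ∨ -(2 ^ i * 11 ^ j * m ^ 2 * e ^ 2) = s ^ 2) :
    Even i ∧ Even j := by
  have h' : 2 ^ i * 11 ^ j * m.natAbs ^ 2 * e.natAbs ^ 2 = s.natAbs ^ 2 := by
    rcases h with h | h
    · simpa [Int.natAbs_mul, Int.natAbs_pow] using congrArg Int.natAbs h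
    · simpa [Int.natAbs_mul, Int.natAbs_pow] using congrArg Int.natAbs h
  have hs' : s.natAbs ≠ 0 := by simpa using hs
  have hm : m.natAbs ≠ 0 := by rintro h0; rw [h0] at h'; exact pow_ne_zero 2 hs' (by simpa using h'.symm)
  have he : e.natAbs ≠ 0 := by rintro h0; rw [h0] at h'; exact pow_ne_zero 2 hs' (by simpa using h'.symm)
  have : Fact (Nat.Prime 11) := ⟨by norm_num⟩
  constructor
  · have h2 := congrArg (padicValNat 2) h'
    rw [padicValNat.mul (by positivity) (by positivity), padicValNat.mul (by positivity) (by positivity),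
      padicValNat.mul (by positivity) (by positivity), padicValNat.prime_pow, padicValNat.pow, padicValNat.pow,
      padicValNat.pow, padicValNat.pow,
      padicValNat.eq_zero_of_not_dvd (by norm_num : ¬ 2 ∣ 11)] at h2
    rw [Nat.even_iff]; omega
  · have h2 := congrArg (padicValNat 11) h'
    rw [padicValNat.mul (by positivity) (by positivity), padicValNat.mul (by positivity) (by positivity),
      padicValNat.mul (by positivity) (by positivity), padicValNat.prime_pow, padicValNat.pow, padicValNat.pow,
      padicValNat.pow, padicValNat.pow,
      padicValNat.eq_zero_of_not_dvd (by norm_num : ¬ 11 ∣ 2)] at h2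
    rw [Nat.even_iff]; omega

theorem exists_sq_of_eleven (hχ : χ ^ 3 - 2 * χ ^ 2 + 2 = 0) (hdeg : finrank ℚ L = 3) {x y : ℚ}
    (h : y ^ 2 = x ^ 3 - 4 * x ^ 2 + 16) : ∃ w : L, (x : L) - 2 * χ = w ^ 2 := by
  have hχ' : (χ : L) ^ 3 - 2 * (χ : L) ^ 2 + 2 = 0 := by
    simpa [map_ofNat] using congrArg (algebraMap (𝓞 L) L) hχ
  have hPID := (cubic_field hχ' hdeg).1
  set p := x.num with hp
  set q : ℤ := (x.den : ℤ) with hq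
  have hq0 : 0 < q := by simp [hq, x.den_pos]
  have hq0' : (q : ℚ) ≠ 0 := by exact_mod_cast hq0.ne'
  have hxpq : x = p / q := (Rat.num_div_den x).symm
  have hpq : IsCoprime p q := by
    rw [Int.isCoprime_iff_gcd_eq_one]; exact x.reduced
  obtain ⟨s, hs⟩ : IsSquare (q * (p ^ 3 - 4 * p ^ 2 * q + 16 * q ^ 3)) := by
    rw [← Rat.isSquare_intCast_iff]
    refine ⟨y * q ^ 2, ?_⟩
    push_cast
    rw [show y * (q : ℚ) ^ 2 * (y * q ^ 2) = y ^ 2 * q ^ 4 by ring, h, hxpq]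
    field_simp
  rw [← pow_two] at hs
  obtain ⟨e, he⟩ : ∃ e : ℤ, q = e ^ 2 := by
    have hc : IsCoprime q (p ^ 3 - 4 * p ^ 2 * q + 16 * q ^ 3) := by
      have : p ^ 3 - 4 * p ^ 2 * q + 16 * q ^ 3 = p ^ 3 + q * (-4 * p ^ 2 + 16 * q ^ 2) := by ring
      rw [this]
      exact (hpq.symm.pow_right).add_mul_left_right _
    obtain ⟨n, hn | hn⟩ := Int.sq_of_isCoprime hc hs
    · exact ⟨n, hn⟩
    · nlinarith [sq_nonneg n]
  have he0 : e ≠ 0 := by rintro rfl; simp [he] at hq0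
  set g : 𝓞 L := p - (2 * q : ℤ) * χ with hg
  have hgp : (g : L) = p - 2 * q * χ := by simp [hg, map_ofNat]
  set k : 𝓞 L := p ^ 2 + (2 * χ - 4) * p * q + (4 * χ ^ 2 - 8 * χ) * q ^ 2 with hk
  have hNg : Algebra.norm ℤ g * e ^ 2 = s ^ 2 := by
    rw [hg, cubic_norm_int hχ hdeg, ← hs, ← he]; ring
  have hs0 : s ≠ 0 := by
    rintro rfl
    have : Algebra.norm ℤ g = 0 := by
      have := hNg; simpa [he0] using this
    rw [Algebra.norm_eq_zero_iff] at this
    have h0 : (g : L) = 0 := by rw [this]; rfl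
    have := cubic_coordinates_eq hχ' hdeg (a := p) (b := -(2 * q)) (c := 0) (by
      rw [← h0, hgp]; push_cast; ring)
    simp [hq0.ne'] at this
  have hgk : (e ^ 2 : 𝓞 L) * (g * k) = s ^ 2 := by
    have : (q * (p ^ 3 - 4 * p ^ 2 * q + 16 * q ^ 3) : 𝓞 L) = s ^ 2 := by exact_mod_cast hs
    have he' : (q : 𝓞 L) = e ^ 2 := by exact_mod_cast he
    rw [← he', ← this, hg, hk]
    push_cast
    linear_combination (-8 * (q : 𝓞 L) ^ 4) * hχ
  obtain ⟨y', hy'⟩ : (e : 𝓞 L) ∣ s := by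
    rw [← IsIntegrallyClosed.pow_dvd_pow_iff two_ne_zero, ← hgk]
    exact Dvd.intro _ rfl
  have he0' : (e : 𝓞 L) ≠ 0 := by exact_mod_cast he0
  have hs0' : (s : 𝓞 L) ≠ 0 := by exact_mod_cast hs0
  have hgk' : g * k = y' ^ 2 := by
    refine mul_left_cancel₀ (pow_ne_zero 2 he0') ?_
    rw [hgk, hy']; ring
  have hy0 : y' ≠ 0 := by rintro rfl; rw [mul_zero] at hy'; exact hs0' hy'
  obtain ⟨d, m, u, hdg, hdk, hgm⟩ := exists_eq_gcd_mul_sq hy0 hgk'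
  set lam : 𝓞 L := 3 - 4 * χ + 2 * χ ^ 2 with hlam
  have hcop : IsCoprime d (q : 𝓞 L) := by
    obtain ⟨a, b, hab⟩ := hpq
    have hab' : (a * p + b * q : 𝓞 L) = 1 := by exact_mod_cast hab
    have : IsCoprime g (q : 𝓞 L) := ⟨a, b + 2 * a * χ, by rw [hg]; push_cast; linear_combination hab'⟩
    exact this.of_isCoprime_of_dvd_left hdg
  have hd : d ∣ χ ^ 8 * lam := by
    have h1 : d ∣ (q : 𝓞 L) ^ 2 * (4 * χ ^ 2 * lam) := by
      have : (q : 𝓞 L) ^ 2 * (4 * χ ^ 2 * lam)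
          = k - g * (p + (4 * χ - 4) * q) + (q : 𝓞 L) ^ 2 * (8 * χ) * (χ ^ 3 - 2 * χ ^ 2 + 2) := by
        rw [hk, hg, hlam]; push_cast; ring
      rw [this, hχ, mul_zero, add_zero]
      exact dvd_sub hdk (hdg.mul_right _)
    have h2 := (hcop.pow_right (n := 2)).dvd_of_dvd_mul_left h1
    have : χ ^ 8 * lam = 4 * χ ^ 2 * lam * (χ ^ 2 - 1) ^ 2 := by
      linear_combination lam * χ ^ 2 * (χ ^ 3 + 2 * (χ ^ 2 - 1)) * hχ
    rw [this]
    exact h2.mul_right _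
  have hNχ : Algebra.norm ℤ χ = -2 := by simpa using cubic_norm_int hχ hdeg 0 (-1)
  have hNlam : Algebra.norm ℤ lam = 11 := by
    have h1 := cubic_norm_int hχ hdeg (-4) (-3)
    have : ((-4 : ℤ) : 𝓞 L) - (-3 : ℤ) * χ = χ * lam := by
      rw [hlam]; push_cast; linear_combination -2 * hχ
    rw [this, map_mul, hNχ] at h1
    linarith
  have hprime : ∀ z : 𝓞 L, (Algebra.norm ℤ z).natAbs.Prime → Prime z := fun z hz => by
    have hz0 : z ≠ 0 := by rintro rfl; rw [Algebra.norm_zero] at hz; norm_num at hz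
    exact (Ideal.span_singleton_prime hz0).1 (Ideal.isPrime_of_irreducible_absNorm
      (by rw [Ideal.absNorm_span_singleton]; exact hz))
  have hχp : Prime χ := hprime _ (by rw [hNχ]; norm_num)
  have hlp : Prime lam := hprime _ (by rw [hNlam]; norm_num)
  obtain ⟨d₁, d₂, hd₁, hd₂, rfl⟩ := exists_dvd_and_dvd_of_dvd_mul hd
  obtain ⟨i, -, hi⟩ := (dvd_prime_pow hχp 8).1 hd₁
  obtain ⟨j, -, hj⟩ := (dvd_prime_pow hlp 1).1 (by simpa using hd₂)
  obtain ⟨u₁, hu₁⟩ := hi.symm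
  obtain ⟨u₂, hu₂⟩ := hj.symm
  set v := u * u₁ * u₂ with hv
  have hgv : g = v * (χ ^ i * lam ^ j * m ^ 2) := by
    rw [hgm, ← hu₁, ← hu₂, hv]; push_cast; ring
  have hNv : Algebra.norm ℤ (v : 𝓞 L) = 1 ∨ Algebra.norm ℤ (v : 𝓞 L) = -1 :=
    Int.isUnit_iff.1 (v.isUnit.map _)
  have hNg' := hNg
  rw [hgv] at hNg'
  simp only [map_mul, map_pow, hNχ, hNlam] at hNg'
  obtain ⟨⟨i, rfl⟩, ⟨j, rfl⟩⟩ := even_of_norm_sq (m := Algebra.norm ℤ m) (e := e) (i := i) (j := j) hs0 (by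
    have h2 : (-2 : ℤ) ^ i = 2 ^ i ∨ (-2 : ℤ) ^ i = -2 ^ i := by
      rcases Nat.even_or_odd i with hi | hi
      · left; exact hi.neg_pow 2
      · right; exact hi.neg_pow 2
    rcases hNv with e1 | e1 <;> rcases h2 with e2 | e2 <;> rw [e1, e2] at hNg' <;> rw [← hNg']
    · left; ring
    · right; ring
    · right; ring
    · left; ring)
  have hvpos : 0 < Algebra.norm ℤ (v : 𝓞 L) := by
    rcases hNv with e1 | e1
    · rw [e1]; norm_num
    · exfalso
      rw [e1] at hNg'
      have h1 : 0 < s ^ 2 := by positivity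
      have h2 : 0 ≤ ((-2 : ℤ) ^ i * 11 ^ j * Algebra.norm ℤ m * e) ^ 2 := sq_nonneg _
      have h3 : -1 * ((-2 : ℤ) ^ (i + i) * 11 ^ (j + j) * Algebra.norm ℤ m ^ 2) * e ^ 2
          = -((-2 : ℤ) ^ i * 11 ^ j * Algebra.norm ℤ m * e) ^ 2 := by ring
      linarith
  obtain ⟨w, hw⟩ := cubic_unit_class hχ hdeg v hvpos
  have heL : (e : L) ≠ 0 := by exact_mod_cast he0
  have hx : ((x : L) - 2 * χ) * e ^ 2 = (g : L) := by
    have he' : (q : L) = e ^ 2 := by exact_mod_cast he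
    rw [hgp, hxpq]
    push_cast
    rw [he']
    field_simp
  set r : L := (χ : L) ^ i * (lam : L) ^ j * m / e with hr
  have hgL : (g : L) = v * (r * e) ^ 2 := by
    have h1 : (g : L) = v * ((χ : L) ^ (i + i) * (lam : L) ^ (j + j) * m ^ 2) := by
      rw [hgv]; push_cast; rfl
    rw [h1, hr]
    field_simp
    ring
  rcases hw with hw | hw
  · refine ⟨w * r, ?_⟩
    have hw' : algebraMap (𝓞 L) L (v : 𝓞 L) = (w : L) ^ 2 := by rw [hw]; simp
    refine mul_right_cancel₀ (pow_ne_zero 2 heL) ?_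
    rw [hx, hgL, hw']; ring
  · exfalso
    refine cubic_ne_twisted_sq hχ' hdeg x (w * r) ?_
    have hw' : algebraMap (𝓞 L) L (v : 𝓞 L) = (1 - χ) * (w : L) ^ 2 := by rw [hw]; simp
    refine mul_right_cancel₀ (pow_ne_zero 2 heL) ?_
    rw [hx, hgL, hw']; ring

end CubicField

theorem eleven_coordinates {x y : ℚ} (h : y ^ 2 = x ^ 3 - 4 * x ^ 2 + 16) :
    ∃ a b c : ℚ, x = a ^ 2 - 4 * b * c - 4 * c ^ 2 ∧ 2 * a * b - 2 * c ^ 2 + 2 = 0 ∧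
      b ^ 2 + 2 * a * c + 4 * b * c + 4 * c ^ 2 = 0 := by
  have := Fact.mk cubic_irreducible
  have hne : (X ^ 3 - 2 * X ^ 2 + 2 : ℚ[X]) ≠ 0 := cubic_irreducible.ne_zero
  let L := AdjoinRoot (X ^ 3 - 2 * X ^ 2 + 2 : ℚ[X])
  have : FiniteDimensional ℚ L := (AdjoinRoot.powerBasis hne).finite
  have : NumberField L := { to_charZero := algebraRat.charZero L }
  have hdeg : finrank ℚ L = 3 := by
    rw [(AdjoinRoot.powerBasis hne).finrank, AdjoinRoot.powerBasis_dim]; compute_degree!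
  have hχ : (AdjoinRoot.root (X ^ 3 - 2 * X ^ 2 + 2 : ℚ[X]) : L) ^ 3
      - 2 * AdjoinRoot.root (X ^ 3 - 2 * X ^ 2 + 2 : ℚ[X]) ^ 2 + 2 = 0 := by
    have h := AdjoinRoot.mk_self (f := (X ^ 3 - 2 * X ^ 2 + 2 : ℚ[X]))
    rwa [map_add, map_sub, map_mul, map_pow, map_pow, AdjoinRoot.mk_X, map_ofNat] at h
  set χ : L := AdjoinRoot.root (X ^ 3 - 2 * X ^ 2 + 2 : ℚ[X])
  have hIntegral : IsIntegral ℤ χ :=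
    ⟨X ^ 3 - 2 * X ^ 2 + 2, by monicity!, by simpa [← aeval_def, map_ofNat] using hχ⟩
  let χ' : 𝓞 L := ⟨χ, hIntegral⟩
  have hχ' : χ' ^ 3 - 2 * χ' ^ 2 + 2 = 0 := by
    apply RingOfIntegers.ext
    change algebraMap (𝓞 L) L _ = algebraMap (𝓞 L) L _
    rw [map_add, map_sub, map_mul, map_pow, map_pow, map_ofNat, map_zero]
    exact hχ
  obtain ⟨w, hw⟩ := exists_sq_of_eleven hχ' hdeg h
  obtain ⟨a, b, c, rfl⟩ := cubic_coordinates hχ hdeg w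
  obtain ⟨h0, h1, h2⟩ := cubic_coordinates_eq hχ hdeg (a := a ^ 2 - 4 * b * c - 4 * c ^ 2 - x)
    (b := 2 * a * b - 2 * c ^ 2 + 2) (c := b ^ 2 + 2 * a * c + 4 * b * c + 4 * c ^ 2) (by
      push_cast
      have hw' : (x : L) - 2 * χ = (a + b * χ + c * χ ^ 2) ^ 2 := hw
      linear_combination -hw' - (2 * b * c + c ^ 2 * χ + 2 * c ^ 2) * hχ)
  exact ⟨a, b, c, by linarith, h1, h2⟩

theorem finite_eleven : Finite (Pt (-4 : ℚ) 0 16) := by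
  apply finite_pt
  intro P
  refine ⟨0, ?_⟩
  rcases eq_zero_or P with rfl | ⟨x, y, h, rfl⟩
  · exact ⟨0, by simp⟩
  obtain ⟨a, b, c, hx, h1, h2⟩ := eleven_coordinates (x := x) (y := y) (by rw [h]; ring)
  have hc : c ≠ 0 := by
    rintro rfl
    have hb : b = 0 := by simpa using h2
    rw [hb] at h1; norm_num at h1
  set t := b + 2 * c with ht
  have hb : b = t - 2 * c := by rw [ht]; ring
  have ha : a = -t ^ 2 / (2 * c) := by
    rw [eq_div_iff (by simpa using hc), ht]; linear_combination h2
  have h3 : t ^ 3 = 2 * c * t ^ 2 - 2 * c ^ 3 + 2 * c := by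
    rw [hb, ha] at h1
    field_simp at h1
    linear_combination -h1
  have hQ : (4 / c) ^ 2 = (2 * t / c) ^ 3 + (-4) * (2 * t / c) ^ 2 + 0 * (2 * t / c) + 16 := by
    field_simp
    linear_combination -8 * h3
  obtain ⟨h', hd⟩ := double hQ (by positivity) (l := (3 * t ^ 2 - 4 * t * c) / (2 * c)) (x := x)
    (y := -(4 / c + (3 * t ^ 2 - 4 * t * c) / (2 * c) * (x - 2 * t / c)))
    (by field_simp; ring) (by
      rw [hx, hb, ha]
      field_simp
      linear_combination (-8 * t + 8 * c) * h3) rfl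
  have hyy := h.trans h'.symm
  rcases sq_eq_sq_iff_eq_or_eq_neg.1 hyy with e | e
  · subst e
    exact ⟨pt hQ, by simp, by rw [zero_add, hd]⟩
  · refine ⟨-pt hQ, by simp, ?_⟩
    rw [zero_add, ← neg_add, hd, neg_pt]
    subst e
    rfl

open Polynomial NumberField Module

section QuarticField

variable {F : Type*} [Field F] [NumberField F]

theorem quartic_powerBasis {θ : F} (hθ : θ ^ 4 - 4 * θ ^ 2 + 2 = 0) (hdeg : finrank ℚ F = 4) :
    ∃ pb : PowerBasis ℚ F, pb.gen = θ ∧ pb.dim = 4 ∧ minpoly ℚ θ = X ^ 4 - 4 * X ^ 2 + 2 := by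
  have hd : (X ^ 4 - 4 * X ^ 2 + 2 : ℚ[X]).natDegree = 4 := by compute_degree!
  obtain ⟨h, pb, h1, h2⟩ := exists_powerBasis (K := F) (θ := θ) (g := X ^ 4 - 4 * X ^ 2 + 2)
    (by monicity!) quartic_irreducible (by simpa [map_ofNat] using hθ) (by rw [hd, hdeg])
  exact ⟨pb, h1, h2.trans hd, h⟩

theorem quartic_coordinates {θ : F} (hθ : θ ^ 4 - 4 * θ ^ 2 + 2 = 0) (hdeg : finrank ℚ F = 4)
    (z : F) : ∃ a b c d : ℚ, z = a + b * θ + c * θ ^ 2 + d * θ ^ 3 := by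
  obtain ⟨pb, rfl, hd, -⟩ := quartic_powerBasis hθ hdeg
  obtain ⟨f, hf⟩ := exists_coordinates pb z
  refine ⟨f 0, f 1, f 2, f 3, ?_⟩
  rw [hf, hd]
  simp [Finset.sum_range_succ]

theorem exists_real_roots : ∃ r s : ℝ, r ^ 4 - 4 * r ^ 2 + 2 = 0 ∧ s ^ 4 - 4 * s ^ 2 + 2 = 0 ∧
    1.8 ≤ r ∧ r ≤ 1.9 ∧ 0.7 ≤ s ∧ s ≤ 0.8 := by
  have hc : Continuous fun x : ℝ => x ^ 4 - 4 * x ^ 2 + 2 := by fun_prop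
  obtain ⟨r, ⟨h1, h2⟩, h⟩ := intermediate_value_Icc (a := (1.8 : ℝ)) (b := 1.9) (by norm_num)
    hc.continuousOn (show (0 : ℝ) ∈ Set.Icc _ _ by constructor <;> norm_num)
  obtain ⟨s, ⟨h3, h4⟩, h'⟩ := intermediate_value_Icc' (a := (0.7 : ℝ)) (b := 0.8) (by norm_num)
    hc.continuousOn (show (0 : ℝ) ∈ Set.Icc _ _ by constructor <;> norm_num)
  exact ⟨r, s, h, h', h1, h2, h3, h4⟩

theorem exists_real_embedding {θ : F} (hθ : θ ^ 4 - 4 * θ ^ 2 + 2 = 0) (hdeg : finrank ℚ F = 4)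
    {r : ℝ} (hr : r ^ 4 - 4 * r ^ 2 + 2 = 0) : ∃ φ : F →+* ℝ, φ θ = r := by
  obtain ⟨pb, rfl, hd, hmin⟩ := quartic_powerBasis hθ hdeg
  have hy : aeval r (minpoly ℚ pb.gen) = 0 := by rw [hmin]; simpa [map_ofNat] using hr
  exact ⟨(pb.lift r hy).toRingHom, pb.lift_gen r hy⟩

theorem exists_real_embeddings {θ : F} (hθ : θ ^ 4 - 4 * θ ^ 2 + 2 = 0) (hdeg : finrank ℚ F = 4) :
    ∃ φ : Fin 4 → F →+* ℝ, (1.8 ≤ φ 0 θ ∧ φ 0 θ ≤ 1.9) ∧ (-1.9 ≤ φ 1 θ ∧ φ 1 θ ≤ -1.8) ∧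
      (0.7 ≤ φ 2 θ ∧ φ 2 θ ≤ 0.8) ∧ (-0.8 ≤ φ 3 θ ∧ φ 3 θ ≤ -0.7) := by
  obtain ⟨r, s, hr, hs, h1, h2, h3, h4⟩ := exists_real_roots
  obtain ⟨φ₀, e₀⟩ := exists_real_embedding hθ hdeg hr
  obtain ⟨φ₁, e₁⟩ := exists_real_embedding hθ hdeg (r := -r) (by rw [← hr]; ring)
  obtain ⟨φ₂, e₂⟩ := exists_real_embedding hθ hdeg hs
  obtain ⟨φ₃, e₃⟩ := exists_real_embedding hθ hdeg (r := -s) (by rw [← hs]; ring)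
  refine ⟨![φ₀, φ₁, φ₂, φ₃], ?_⟩
  simp only [Matrix.cons_val]
  rw [e₀, e₁, e₂, e₃]
  refine ⟨⟨h1, h2⟩, ⟨?_, ?_⟩, ⟨h3, h4⟩, ?_, ?_⟩ <;> linarith

theorem quartic_nrComplexPlaces {θ : F} (hθ : θ ^ 4 - 4 * θ ^ 2 + 2 = 0)
    (hdeg : finrank ℚ F = 4) : InfinitePlace.nrComplexPlaces F = 0 := by
  classical
  obtain ⟨φ, h0, h1, h2, h3⟩ := exists_real_embeddings hθ hdeg
  let f : Fin 4 → { ψ : F →+* ℂ // ComplexEmbedding.IsReal ψ } := fun i =>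
    ⟨Complex.ofRealHom.comp (φ i), by
      rw [ComplexEmbedding.isReal_iff]; ext z; simp [ComplexEmbedding.conjugate]⟩
  have hf : Function.Injective f := by
    intro i j hij
    have h := congrArg (fun ψ : { ψ : F →+* ℂ // ComplexEmbedding.IsReal ψ } => ψ.1 θ) hij
    have h' : φ i θ = φ j θ := Complex.ofReal_injective h
    fin_cases i <;> fin_cases j <;> first | rfl | (exfalso; simp at h'; linarith)
  have hc := Fintype.card_le_of_injective f hf
  rw [Fintype.card_fin, InfinitePlace.card_real_embeddings] at hc
  have := InfinitePlace.card_add_two_mul_card_eq_rank F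
  omega

theorem quartic_rank (hdeg : finrank ℚ F = 4) : Units.rank F ≤ 3 := by
  have := InfinitePlace.card_add_two_mul_card_eq_rank F
  rw [Units.rank, InfinitePlace.card_eq_nrRealPlaces_add_nrComplexPlaces]
  omega

theorem quartic_norm {θ : F} (hθ : θ ^ 4 - 4 * θ ^ 2 + 2 = 0) (hdeg : finrank ℚ F = 4) :
    Algebra.norm ℚ θ = 2 := by
  obtain ⟨pb, rfl, hd, hmin⟩ := quartic_powerBasis hθ hdeg
  have h := norm_algebraMap_sub_gen pb 0
  have e : algebraMap ℚ F 0 - pb.gen = algebraMap ℚ F (-1) * pb.gen := by simp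
  rw [e, map_mul, Algebra.norm_algebraMap, hdeg, hmin] at h
  norm_num at h
  exact h

theorem quartic_discr {θ : F} (hθ : θ ^ 4 - 4 * θ ^ 2 + 2 = 0) (hdeg : finrank ℚ F = 4) :
    |NumberField.discr F| ≤ 2048 := by
  obtain ⟨pb, rfl, hd, hmin⟩ := quartic_powerBasis hθ hdeg
  have hIntegral : IsIntegral ℤ pb.gen :=
    ⟨X ^ 4 - 4 * X ^ 2 + 2, by monicity!, by simpa [← aeval_def, map_ofNat] using hθ⟩
  obtain ⟨n, hn⟩ := exists_discr_eq pb hIntegral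
  rw [Algebra.discr_powerBasis_eq_norm, hmin, hdeg] at hn
  have e : (aeval pb.gen) (derivative (X ^ 4 - 4 * X ^ 2 + 2 : ℚ[X]))
      = algebraMap ℚ F 4 * (pb.gen * (pb.gen ^ 2 - 2)) := by
    simp [map_ofNat]
    ring
  have h2 : Algebra.norm ℚ (pb.gen ^ 2 - 2) ^ 2 = 16 := by
    rw [← map_pow, show (pb.gen ^ 2 - 2) ^ 2 = algebraMap ℚ F 2 by
      rw [map_ofNat]; linear_combination hθ, Algebra.norm_algebraMap, hdeg]
    norm_num
  rw [e, map_mul, map_mul, quartic_norm hθ hdeg, Algebra.norm_algebraMap, hdeg] at hn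
  norm_num at hn
  have h3 : (2048 : ℤ) ^ 2 = (n ^ 2 * NumberField.discr F) ^ 2 := by
    have : (2048 : ℚ) ^ 2 = (n ^ 2 * NumberField.discr F) ^ 2 := by
      rw [← hn]
      linear_combination (-(512 : ℚ) ^ 2) * h2
    exact_mod_cast this
  have h4 : |n ^ 2 * NumberField.discr F| = 2048 := by
    have := (sq_eq_sq_iff_abs_eq_abs _ _).1 h3.symm
    simpa using this
  rw [abs_mul] at h4
  have hn0 : n ^ 2 ≠ 0 := by intro h0; rw [h0] at h4; norm_num at h4
  have h5 : 1 ≤ |n ^ 2| := Int.one_le_abs hn0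
  nlinarith [abs_nonneg (NumberField.discr F)]

variable {t : 𝓞 F}

theorem quartic_coe (ht : t ^ 4 - 4 * t ^ 2 + 2 = 0) : (t : F) ^ 4 - 4 * (t : F) ^ 2 + 2 = 0 := by
  simpa [map_ofNat] using congrArg (algebraMap (𝓞 F) F) ht

theorem quartic_absNorm (ht : t ^ 4 - 4 * t ^ 2 + 2 = 0) (hdeg : finrank ℚ F = 4) :
    Ideal.absNorm (Ideal.span {t}) = 2 := by
  have h := quartic_norm (quartic_coe ht) hdeg
  rw [← Algebra.coe_norm_int] at h
  rw [Ideal.absNorm_span_singleton, show Algebra.norm ℤ t = 2 by exact_mod_cast h]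
  rfl

theorem quartic_prime (ht : t ^ 4 - 4 * t ^ 2 + 2 = 0) (hdeg : finrank ℚ F = 4) :
    Prime t := by
  have ht0 : t ≠ 0 := by rintro rfl; norm_num at ht
  refine (Ideal.span_singleton_prime ht0).1 (Ideal.isPrime_of_irreducible_absNorm ?_)
  rw [quartic_absNorm ht hdeg]
  exact Nat.prime_two

theorem quartic_dvd_or (ht : t ^ 4 - 4 * t ^ 2 + 2 = 0) (hdeg : finrank ℚ F = 4) (z : 𝓞 F) :
    t ∣ z ∨ t ∣ z - 1 := by
  have h := quartic_absNorm ht hdeg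
  rw [Ideal.absNorm_apply, Submodule.cardQuot_apply] at h
  obtain ⟨x, y, hxy, huniv⟩ := Nat.card_eq_two_iff.1 h
  have hne : (0 : 𝓞 F ⧸ Ideal.span {t}) ≠ 1 := by
    intro h01
    have : (1 : 𝓞 F) ∈ Ideal.span {t} := Ideal.Quotient.eq_zero_iff_mem.1 h01.symm
    rw [Ideal.mem_span_singleton] at this
    exact (quartic_prime ht hdeg).not_isUnit (isUnit_of_dvd_one this)
  have hall : ∀ w : 𝓞 F ⧸ Ideal.span {t}, w = x ∨ w = y := fun w => by
    have : w ∈ ({x, y} : Set _) := by rw [huniv]; trivial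
    simpa using this
  have hz : (Ideal.Quotient.mk (Ideal.span {t}) z) = 0 ∨ (Ideal.Quotient.mk (Ideal.span {t}) z) = 1 := by
    rcases hall 0 with h0 | h0 <;> rcases hall 1 with h1 | h1 <;>
      rcases hall (Ideal.Quotient.mk (Ideal.span {t}) z) with hz | hz <;> rw [hz] <;>
      simp_all
  rcases hz with hz | hz
  · left; rwa [Ideal.Quotient.eq_zero_iff_mem, Ideal.mem_span_singleton] at hz
  · right
    rw [← sub_eq_zero, ← map_one (Ideal.Quotient.mk _), ← map_sub, Ideal.Quotient.eq_zero_iff_mem,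
      Ideal.mem_span_singleton] at hz
    exact hz

theorem quartic_principal (ht : t ^ 4 - 4 * t ^ 2 + 2 = 0) (hdeg : finrank ℚ F = 4) :
    IsPrincipalIdealRing (𝓞 F) := by
  apply RingOfIntegers.isPrincipalIdealRing_of_isPrincipal_of_norm_le_of_isPrime
  intro I hI hle
  have hn0 : Ideal.absNorm (I : Ideal (𝓞 F)) ≠ 0 := Ideal.absNorm_ne_zero_of_nonZeroDivisors I
  have hn1 : Ideal.absNorm (I : Ideal (𝓞 F)) ≠ 1 := by
    rw [Ne, Ideal.absNorm_eq_one_iff]; exact hI.ne_top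
  have hbound : Ideal.absNorm (I : Ideal (𝓞 F)) < 5 := by
    rw [quartic_nrComplexPlaces (quartic_coe ht) hdeg, hdeg] at hle
    have hd : (|NumberField.discr F| : ℝ) ≤ 2048 := by
      exact_mod_cast quartic_discr (quartic_coe ht) hdeg
    have hs : √(|NumberField.discr F| : ℝ) ≤ 46 := by
      rw [Real.sqrt_le_left (by norm_num)]; linarith
    norm_num [Nat.factorial] at hle
    have : (Ideal.absNorm (I : Ideal (𝓞 F)) : ℝ) < 5 := by
      linarith
    exact_mod_cast this
  have hmem := Ideal.absNorm_mem (I : Ideal (𝓞 F))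
  have htwo : (2 : 𝓞 F) ∈ (I : Ideal (𝓞 F)) → Submodule.IsPrincipal (I : Ideal (𝓞 F)) := by
    intro h2
    have h4 : t ^ 4 ∈ (I : Ideal (𝓞 F)) := by
      have : t ^ 4 = 2 * (2 * t ^ 2 - 1) := by linear_combination ht
      rw [this]; exact Ideal.mul_mem_right _ _ h2
    have hti := hI.mem_of_pow_mem _ h4
    have ht0 : t ≠ 0 := (quartic_prime ht hdeg).ne_zero
    have hmax : (Ideal.span {t}).IsMaximal :=
      ((Ideal.span_singleton_prime ht0).2 (quartic_prime ht hdeg)).isMaximal (by simpa using ht0)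
    have := hmax.eq_of_le hI.ne_top ((Ideal.span_singleton_le_iff_mem _).2 hti)
    exact ⟨t, this.symm⟩
  have hcases : Ideal.absNorm (I : Ideal (𝓞 F)) = 2 ∨ Ideal.absNorm (I : Ideal (𝓞 F)) = 3 ∨
      Ideal.absNorm (I : Ideal (𝓞 F)) = 4 := by omega
  rcases hcases with h | h | h
  · rw [h] at hmem
    exact htwo (by exact_mod_cast hmem)
  · exfalso
    have h3 : (3 : 𝓞 F) ∈ (I : Ideal (𝓞 F)) := by rw [h] at hmem; exact_mod_cast hmem
    have hmax : (I : Ideal (𝓞 F)).IsMaximal :=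
      hI.isMaximal (nonZeroDivisors.coe_ne_zero I)
    let _ : Field (𝓞 F ⧸ (I : Ideal (𝓞 F))) := Ideal.Quotient.field _
    have hcard : Nat.card (𝓞 F ⧸ (I : Ideal (𝓞 F))) = 3 := by
      rwa [Ideal.absNorm_apply, Submodule.cardQuot_apply] at h
    have : Finite (𝓞 F ⧸ (I : Ideal (𝓞 F))) := Nat.finite_of_card_ne_zero (by rw [hcard]; norm_num)
    let _ : Fintype (𝓞 F ⧸ (I : Ideal (𝓞 F))) := Fintype.ofFinite _
    have hp := FiniteField.pow_card (Ideal.Quotient.mk (I : Ideal (𝓞 F)) t)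
    rw [← Nat.card_eq_fintype_card, hcard, ← map_pow, ← sub_eq_zero, ← map_sub,
      Ideal.Quotient.eq_zero_iff_mem] at hp
    have h1 : (1 : 𝓞 F) ∈ (I : Ideal (𝓞 F)) := by
      have : (1 : 𝓞 F) = 3 * (1 - t ^ 2) + t * (t ^ 3 - t) := by linear_combination -ht
      rw [this]
      exact add_mem (Ideal.mul_mem_right _ _ h3) (Ideal.mul_mem_left _ _ hp)
    exact hI.ne_top ((Ideal.eq_top_iff_one _).2 h1)
  · rw [h] at hmem
    refine htwo (hI.mem_of_pow_mem 2 ?_)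
    have : (2 : 𝓞 F) ^ 2 = ((4 : ℕ) : 𝓞 F) := by norm_num
    rw [this]; exact hmem

end QuarticField

section DyadicCongruence

variable {R : Type*} [CommRing R] [IsDomain R] {t : R}

theorem sq_eq_one_add_of_not_dvd (hdvd : ∀ z : R, t ∣ z ∨ t ∣ z - 1) {e : R}
    (h2 : (2 : R) = t ^ 4 * e) {z : R} (hz : ¬t ∣ z) : ∃ c, z ^ 2 = 1 + t ^ 2 * c := by
  obtain ⟨c, hc⟩ := (hdvd z).resolve_left hz
  obtain rfl : z = 1 + t * c := by linear_combination hc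
  exact ⟨t ^ 3 * e * c + c ^ 2, by linear_combination t * c * h2⟩

theorem one_add_ne_sq (hp : Prime t) (hdvd : ∀ z : R, t ∣ z ∨ t ∣ z - 1) {e : R}
    (h2 : (2 : R) = t ^ 4 * e) (z s : R) : 1 + t + t ^ 2 * z ≠ s ^ 2 := by
  intro h
  by_cases hs : t ∣ s
  · obtain ⟨r, rfl⟩ := hs
    exact hp.not_isUnit (isUnit_of_dvd_one ⟨t * r ^ 2 - 1 - t * z, by linear_combination h⟩)
  · obtain ⟨c, hc⟩ := sq_eq_one_add_of_not_dvd hdvd h2 hs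
    have : t * (1 - t * (c - z)) = 0 := by linear_combination h + hc
    rcases mul_eq_zero.1 this with h0 | h0
    · exact hp.ne_zero h0
    · exact hp.not_isUnit (isUnit_of_dvd_one ⟨c - z, by linear_combination h0⟩)

theorem unit_class_excluded (hp : Prime t) (hdvd : ∀ z : R, t ∣ z ∨ t ∣ z - 1) {e : R}
    (h2 : (2 : R) = t ^ 4 * e) {ε a ε' a' : R} (hε : ε = 1 + t ^ 2 * ε') (ha : a = 1 + t ^ 2 * a')
    (hεa : ε * (1 - a ^ 2) = 2 * a) {u₁ u₂ : Rˣ} {m n s u : R} (hu : (u₁ : R) * u₂ = 1 + t + t ^ 2 * u)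
    (hcop : IsCoprime (u₁ * m ^ 2) (u₂ * n ^ 2))
    (h : (u₁ : R) * u₂ * ((u₁ * m ^ 2 - ε * (u₂ * n ^ 2)) * (u₁ * m ^ 2 - ε * a ^ 2 * (u₂ * n ^ 2)))
      = s ^ 2) : False := by
  have hunit : ∀ w : Rˣ, ¬t ∣ (w : R) := fun w hw => hp.not_isUnit (isUnit_of_dvd_unit hw w.isUnit)
  have hmn : ¬(t ∣ m ∧ t ∣ n) := by
    rintro ⟨h1, h2⟩
    exact hp.not_isUnit (hcop.isUnit_of_dvd' (Dvd.dvd.mul_left (dvd_pow h1 two_ne_zero) _)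
      (Dvd.dvd.mul_left (dvd_pow h2 two_ne_zero) _))
  have hmul : ∀ (w : Rˣ) (z : R), ¬t ∣ z → ¬t ∣ w * z ^ 2 := fun w z hz hw =>
    (hp.dvd_or_dvd hw).elim (hunit w) fun h => hz (hp.dvd_of_dvd_pow h)
  by_cases hm : t ∣ m
  · have hn : ¬t ∣ n := fun hn => hmn ⟨hm, hn⟩
    obtain ⟨m', rfl⟩ := hm
    obtain ⟨c, hc⟩ := sq_eq_one_add_of_not_dvd hdvd h2 (hmul u₂ n hn)
    rw [hu] at h
    generalize (u₂ : R) * n ^ 2 = q at h hc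
    generalize (u₁ : R) = v at h
    obtain ⟨k, hk⟩ : ∃ k, (v * (t * m') ^ 2 - ε * q) * (v * (t * m') ^ 2 - ε * a ^ 2 * q)
        = 1 + t ^ 2 * k := by
      obtain ⟨j, hj⟩ : ∃ j, ε ^ 2 * a ^ 2 = 1 + t ^ 2 * j :=
        ⟨2 * ε' + 2 * a' + t ^ 2 * (4 * ε' * a' + ε' ^ 2 + a' ^ 2)
          + t ^ 4 * (2 * ε' ^ 2 * a' + 2 * ε' * a' ^ 2) + t ^ 6 * ε' ^ 2 * a' ^ 2,
          by rw [hε, ha]; ring⟩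
      exact ⟨v * m' ^ 2 * (v * (t * m') ^ 2 - ε * a ^ 2 * q) - ε * q * v * m' ^ 2 + c + j
        + t ^ 2 * j * c, by linear_combination q ^ 2 * hj + (1 + t ^ 2 * j) * hc⟩
    rw [hk] at h
    exact one_add_ne_sq hp hdvd h2 (u + k + t * k + t ^ 2 * u * k) s (by linear_combination h)
  by_cases hn : t ∣ n
  · obtain ⟨n', rfl⟩ := hn
    obtain ⟨c, hc⟩ := sq_eq_one_add_of_not_dvd hdvd h2 (hmul u₁ m hm)
    rw [hu] at h
    generalize (u₁ : R) * m ^ 2 = p at h hc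
    generalize (u₂ : R) = v at h
    exact one_add_ne_sq hp hdvd h2 (u + (1 + t + t ^ 2 * u) * (c - ε * a ^ 2 * v * n' ^ 2 * p
      - ε * v * n' ^ 2 * (p - ε * a ^ 2 * (v * (t * n') ^ 2)))) s
      (by linear_combination h - (1 + t + t ^ 2 * u) * hc)
  obtain ⟨c, hc⟩ := sq_eq_one_add_of_not_dvd hdvd h2
    (show ¬t ∣ m * n from fun h => (hp.dvd_or_dvd h).elim hm hn)
  obtain ⟨c', hc'⟩ := sq_eq_one_add_of_not_dvd hdvd h2 (hmul u₂ n hn)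
  have hq := hmul u₂ n hn
  have hpq : (u₁ : R) * m ^ 2 * (u₂ * n ^ 2) = (1 + t + t ^ 2 * u) * (1 + t ^ 2 * c) := by
    rw [← hu, ← hc]; ring
  rw [hu] at h
  generalize (u₂ : R) * n ^ 2 = q at *
  generalize (u₁ : R) * m ^ 2 = p at *
  have e1 : (p - q) * q = t * (1 + t * (u + c + t * c + t ^ 2 * u * c - c')) := by
    linear_combination hpq - hc'
  obtain ⟨d, hd⟩ := (hp.dvd_or_dvd (Dvd.intro _ e1.symm)).resolve_right hq
  have e2 : d * q = 1 + t * (u + c + t * c + t ^ 2 * u * c - c') :=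
    mul_left_cancel₀ hp.ne_zero (by linear_combination e1 - q * hd)
  have hdt : ¬t ∣ d := by
    rintro ⟨d', rfl⟩
    exact hp.not_isUnit (isUnit_of_dvd_one
      ⟨d' * q - (u + c + t * c + t ^ 2 * u * c - c'), by linear_combination -e2⟩)
  obtain ⟨g, hg⟩ : ∃ g, g = d - t * ε' * q := ⟨_, rfl⟩
  have hgt : ¬t ∣ g := fun h' => hdt (by
    have : d = g + t * (ε' * q) := by rw [hg]; ring
    rw [this]; exact dvd_add h' (dvd_mul_right _ _))
  have e3 : p - ε * q = t * g := by rw [hg, hε]; linear_combination hd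
  have e4 : p - ε * a ^ 2 * q = t * (g + t ^ 3 * e * a * q) := by
    linear_combination e3 + q * hεa + a * q * h2
  rw [e3, e4] at h
  have hs : t ∣ s := hp.dvd_of_dvd_pow (n := 2)
    ⟨(1 + t + t ^ 2 * u) * (g * (t * (g + t ^ 3 * e * a * q))), by rw [← h]; ring⟩
  obtain ⟨s', rfl⟩ := hs
  obtain ⟨c₂, hc₂⟩ := sq_eq_one_add_of_not_dvd hdvd h2 hgt
  have e5 : (1 + t + t ^ 2 * u) * (g * (g + t ^ 3 * e * a * q)) = s' ^ 2 :=
    mul_left_cancel₀ (pow_ne_zero 2 hp.ne_zero) (by linear_combination h)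
  exact one_add_ne_sq hp hdvd h2
    (u + (1 + t + t ^ 2 * u) * (c₂ + t * e * a * q * g)) s'
    (by linear_combination e5 - (1 + t + t ^ 2 * u) * hc₂)

end DyadicCongruence

open Polynomial NumberField Module

section QuarticUnits

variable {F : Type*} [Field F] [NumberField F] {t : 𝓞 F}

theorem quartic_unit_class (ht : t ^ 4 - 4 * t ^ 2 + 2 = 0) (hdeg : finrank ℚ F = 4)
    (φ : Fin 4 → F →+* ℝ) (h0 : 1.8 ≤ φ 0 t ∧ φ 0 t ≤ 1.9) (h1 : -1.9 ≤ φ 1 t ∧ φ 1 t ≤ -1.8)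
    (h2 : 0.7 ≤ φ 2 t ∧ φ 2 t ≤ 0.8) (h3 : -0.8 ≤ φ 3 t ∧ φ 3 t ≤ -0.7)
    (U : (𝓞 F)ˣ) (hU0 : 0 < φ 0 (algebraMap (𝓞 F) F U)) (hU1 : 0 < φ 1 (algebraMap (𝓞 F) F U)) :
    ∃ w : (𝓞 F)ˣ, (U : 𝓞 F) = w ^ 2 ∨ (U : 𝓞 F) = (t ^ 2 - 1) * w ^ 2 ∨
      (U : 𝓞 F) = (1 + t ^ 3 - 3 * t) * w ^ 2 ∨
      (U : 𝓞 F) = (t ^ 2 - 1) * (1 + t ^ 3 - 3 * t) * w ^ 2 := by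
  let e : (𝓞 F)ˣ := Units.mkOfMulEqOne (t ^ 2 - 1) (t ^ 2 - 3) (by linear_combination ht)
  let r : (𝓞 F)ˣ := Units.mkOfMulEqOne (1 + t) (t ^ 3 - t ^ 2 - 3 * t + 3) (by linear_combination ht)
  let s : (𝓞 F)ˣ := Units.mkOfMulEqOne (1 + t ^ 3 - 3 * t)
    ((t ^ 3 - 3 * t) ^ 3 - (t ^ 3 - 3 * t) ^ 2 - 3 * (t ^ 3 - 3 * t) + 3)
    (by linear_combination (1 - 16 * t ^ 2 + 20 * t ^ 4 - 8 * t ^ 6 + t ^ 8) * ht)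
  let f : Bool × Bool × Bool × Bool → (𝓞 F)ˣ := fun i =>
    (bif i.1 then -1 else 1) * (bif i.2.1 then e else 1) * (bif i.2.2.1 then r else 1) *
      (bif i.2.2.2 then s else 1)
  let sg : Fin 4 → (𝓞 F)ˣ → SignType := fun k u => SignType.sign (φ k (algebraMap (𝓞 F) F u))
  have sg_mul : ∀ k u v, sg k (u * v) = sg k u * sg k v := fun k u v => by simp [sg, sign_mul]
  have sg_one : ∀ k, sg k 1 = 1 := fun k => by simp [sg]
  have sg_neg : ∀ k, sg k (-1) = -1 := fun k => by simp [sg]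
  have sg_sq : ∀ k w, sg k (w ^ 2) = 1 := fun k w => by
    have h0 : φ k (algebraMap (𝓞 F) F w) ≠ 0 := by simp
    simp only [sg, Units.val_pow_eq_pow_val, map_pow]
    exact sign_pos (lt_of_le_of_ne (sq_nonneg _) (Ne.symm (pow_ne_zero 2 h0)))
  have val : ∀ k, φ k (algebraMap (𝓞 F) F e) = φ k t ^ 2 - 1 ∧
      φ k (algebraMap (𝓞 F) F r) = 1 + φ k t ∧
      φ k (algebraMap (𝓞 F) F s) = 1 + φ k t * (φ k t ^ 2 - 3) := fun k => by
    refine ⟨by simp [e], by simp [r], ?_⟩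
    simp [s, map_ofNat]
    ring
  have pos : ∀ k (u : (𝓞 F)ˣ), 0 < φ k (algebraMap (𝓞 F) F u) → sg k u = 1 := fun k u h => sign_pos h
  have neg : ∀ k (u : (𝓞 F)ˣ), φ k (algebraMap (𝓞 F) F u) < 0 → sg k u = -1 := fun k u h => sign_neg h
  have e0 : sg 0 e = 1 := pos _ _ (by rw [(val 0).1]; nlinarith)
  have e1 : sg 1 e = 1 := pos _ _ (by rw [(val 1).1]; nlinarith)
  have e2 : sg 2 e = -1 := neg _ _ (by rw [(val 2).1]; nlinarith)
  have e3 : sg 3 e = -1 := neg _ _ (by rw [(val 3).1]; nlinarith)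
  have r0 : sg 0 r = 1 := pos _ _ (by rw [(val 0).2.1]; linarith)
  have r1 : sg 1 r = -1 := neg _ _ (by rw [(val 1).2.1]; linarith)
  have r2 : sg 2 r = 1 := pos _ _ (by rw [(val 2).2.1]; linarith)
  have r3 : sg 3 r = 1 := pos _ _ (by rw [(val 3).2.1]; linarith)
  have s0 : sg 0 s = 1 := pos _ _ (by
    rw [(val 0).2.2]; have : (0.2 : ℝ) ≤ φ 0 t ^ 2 - 3 := by nlinarith
    nlinarith)
  have s1 : sg 1 s = 1 := pos _ _ (by
    rw [(val 1).2.2]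
    have hx : φ 1 t ^ 4 - 4 * φ 1 t ^ 2 + 2 = 0 := by
      simpa [map_ofNat] using congrArg (fun z : 𝓞 F => φ 1 (algebraMap (𝓞 F) F z)) ht
    have : φ 1 t ^ 2 - 3 ≤ 0.5 := by nlinarith
    have : 0.2 ≤ φ 1 t ^ 2 - 3 := by nlinarith
    nlinarith)
  have s2 : sg 2 s = -1 := neg _ _ (by
    rw [(val 2).2.2]; have : φ 2 t ^ 2 - 3 ≤ -2.3 := by nlinarith
    nlinarith)
  have s3 : sg 3 s = 1 := pos _ _ (by
    rw [(val 3).2.2]; have : φ 3 t ^ 2 - 3 ≤ -2.3 := by nlinarith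
    nlinarith)
  have sgf : ∀ k i, sg k (f i) = (bif i.1 then -1 else 1) * (bif i.2.1 then sg k e else 1) *
      (bif i.2.2.1 then sg k r else 1) * (bif i.2.2.2 then sg k s else 1) := by
    intro k i
    simp only [f, sg_mul]
    obtain ⟨_ | _, _ | _, _ | _, _ | _⟩ := i <;> simp only [cond_true, cond_false, sg_one, sg_neg]
  obtain ⟨i, w, hw⟩ := exists_unit_class F (torsion_of_real F (φ 0))
    (ι := Bool × Bool × Bool × Bool) (by
      have := quartic_rank (F := F) hdeg
      have : 2 ^ (Units.rank F + 1) ≤ 2 ^ 4 := Nat.pow_le_pow_right (by norm_num) (by omega)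
      simpa using this) f (by
    intro i j w h
    have hk : ∀ k, sg k (f i) = sg k (f j) := fun k => by rw [h, sg_mul, sg_sq, mul_one]
    have k0 := hk 0
    have k1 := hk 1
    have k2 := hk 2
    have k3 := hk 3
    rw [sgf, sgf] at k0 k1 k2 k3
    rw [e0, r0, s0] at k0
    rw [e1, r1, s1] at k1
    rw [e2, r2, s2] at k2
    rw [e3, r3, s3] at k3
    clear hk h
    revert i j
    decide) U
  have hs0 : sg 0 (f i) = 1 := by
    have := pos _ _ hU0; rwa [hw, sg_mul, sg_sq, mul_one] at this
  have hs1 : sg 1 (f i) = 1 := by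
    have := pos _ _ hU1; rwa [hw, sg_mul, sg_sq, mul_one] at this
  rw [sgf, e0, r0, s0] at hs0
  rw [sgf, e1, r1, s1] at hs1
  refine ⟨w, ?_⟩
  rw [hw]
  obtain ⟨_ | _, _ | _, _ | _, _ | _⟩ := i <;>
    first
    | (exfalso; revert hs0 hs1; decide)
    | simp [f, e, r, s]

end QuarticUnits

open Polynomial NumberField Module

section QuarticDescent

variable {F : Type*} [Field F] [NumberField F]

theorem quarticTan_unit {R : Type*} [CommRing R] {t : R} (ht : t ^ 4 - 4 * t ^ 2 + 2 = 0) :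
    (3 + 4 * t - t ^ 2 - t ^ 3) * (3 + 4 * t - t ^ 2 - t ^ 3 + 2 * (t ^ 2 - 3)) = 1 := by
  linear_combination (t ^ 2 - 5) * ht

theorem quarticTan_rel {R : Type*} [CommRing R] {t : R} (ht : t ^ 4 - 4 * t ^ 2 + 2 = 0) :
    (t ^ 2 - 1) * (1 - (3 + 4 * t - t ^ 2 - t ^ 3) ^ 2) = 2 * (3 + 4 * t - t ^ 2 - t ^ 3) := by
  linear_combination (1 + 8 * t + 4 * t ^ 2 - 2 * t ^ 3 - t ^ 4) * ht

theorem quartic_integral_descent {t : 𝓞 F} (ht : t ^ 4 - 4 * t ^ 2 + 2 = 0)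
    (hdeg : finrank ℚ F = 4) {a : 𝓞 F} (ha : a = 3 + 4 * t - t ^ 2 - t ^ 3) {p q s : 𝓞 F}
    (hp : p ≠ 0) (hq : q ≠ 0) (hpq : IsCoprime p q)
    (h : s ^ 2 = p * q * ((p - (t ^ 2 - 1) * q) * (p - (t ^ 2 - 1) * a ^ 2 * q)))
    (φ : Fin 4 → F →+* ℝ) (h0 : 1.8 ≤ φ 0 t ∧ φ 0 t ≤ 1.9) (h1 : -1.9 ≤ φ 1 t ∧ φ 1 t ≤ -1.8)
    (h2 : 0.7 ≤ φ 2 t ∧ φ 2 t ≤ 0.8) (h3 : -0.8 ≤ φ 3 t ∧ φ 3 t ≤ -0.7)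
    (hpos0 : 0 < φ 0 (algebraMap (𝓞 F) F (p * q))) (hpos1 : 0 < φ 1 (algebraMap (𝓞 F) F (p * q))) :
    ∃ w, p * q = w ^ 2 ∨ p * q = (t ^ 2 - 1) * w ^ 2 := by
  have := quartic_principal ht hdeg
  have hunit : (t ^ 2 - 1) * (t ^ 2 - 3) = 1 := by linear_combination ht
  have haunit : a * (a + 2 * (t ^ 2 - 3)) = 1 := by rw [ha]; exact quarticTan_unit ht
  have ea : (t ^ 2 - 1) * (1 - a ^ 2) = 2 * a := by rw [ha]; exact quarticTan_rel ht
  have hcp : IsCoprime p (q * ((p - (t ^ 2 - 1) * q) * (p - (t ^ 2 - 1) * a ^ 2 * q))) := by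
    refine IsCoprime.mul_right hpq (IsCoprime.mul_right ?_ ?_)
    · obtain ⟨x, y, hxy⟩ := hpq
      exact ⟨x + y * (t ^ 2 - 3), -y * (t ^ 2 - 3), by linear_combination hxy + y * q * hunit⟩
    · obtain ⟨x, y, hxy⟩ := hpq
      refine ⟨x + y * (t ^ 2 - 3) * (a + 2 * (t ^ 2 - 3)) ^ 2,
        -y * (t ^ 2 - 3) * (a + 2 * (t ^ 2 - 3)) ^ 2, ?_⟩
      linear_combination hxy + y * q * (a * (a + 2 * (t ^ 2 - 3))) ^ 2 * hunit
        + y * q * (a * (a + 2 * (t ^ 2 - 3)) + 1) * haunit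
  have hcq : IsCoprime q (p * ((p - (t ^ 2 - 1) * q) * (p - (t ^ 2 - 1) * a ^ 2 * q))) := by
    have : ∀ k, IsCoprime q (p - k * q) := fun k => by
      obtain ⟨x, y, hxy⟩ := hpq
      exact ⟨y + x * k, x, by linear_combination hxy⟩
    exact IsCoprime.mul_right hpq.symm (IsCoprime.mul_right (this _) (this _))
  obtain ⟨m, u₁, hm⟩ := exists_associated_pow_of_mul_eq_pow' hcp (c := s) (k := 2)
    (by rw [h]; ring)
  obtain ⟨n, u₂, hn⟩ := exists_associated_pow_of_mul_eq_pow' hcq (c := s) (k := 2)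
    (by rw [h]; ring)
  have hm' : p = u₁ * m ^ 2 := by rw [← hm, mul_comm]
  have hn' : q = u₂ * n ^ 2 := by rw [← hn, mul_comm]
  have hmn : m * n ≠ 0 := by
    refine mul_ne_zero ?_ ?_ <;> rintro rfl <;> simp_all
  have hprod : p * q = u₁ * u₂ * (m * n) ^ 2 := by rw [hm', hn']; ring
  obtain ⟨s', rfl⟩ : m * n ∣ s := by
    rw [← IsIntegrallyClosed.pow_dvd_pow_iff two_ne_zero]
    exact ⟨u₁ * u₂ * ((p - (t ^ 2 - 1) * q) * (p - (t ^ 2 - 1) * a ^ 2 * q)), by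
      rw [h, hprod]; ring⟩
  have hs' : (u₁ : 𝓞 F) * u₂ * ((p - (t ^ 2 - 1) * q) * (p - (t ^ 2 - 1) * a ^ 2 * q)) = s' ^ 2 := by
    refine mul_left_cancel₀ (pow_ne_zero 2 hmn) ?_
    rw [hprod] at h
    linear_combination -h
  have hsign : ∀ k, 0 < φ k (algebraMap (𝓞 F) F (p * q)) →
      0 < φ k (algebraMap (𝓞 F) F ((u₁ * u₂ : (𝓞 F)ˣ) : 𝓞 F)) := by
    intro k hk
    rw [hprod, map_mul, map_pow, map_mul, map_pow] at hk
    rw [Units.val_mul]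
    exact pos_of_mul_pos_left hk (sq_nonneg _)
  obtain ⟨w, hw⟩ := quartic_unit_class ht hdeg φ h0 h1 h2 h3 (u₁ * u₂) (hsign 0 hpos0)
    (hsign 1 hpos1)
  rw [Units.val_mul] at hw
  have htwo : (2 : 𝓞 F) = t ^ 4 * (t ^ 2 - 3) ^ 2 := by
    linear_combination (1 + 2 * t ^ 2 - t ^ 4) * ht
  have hpr := quartic_prime ht hdeg
  obtain ⟨c, hc⟩ := sq_eq_one_add_of_not_dvd (quartic_dvd_or ht hdeg) htwo (z := (w : 𝓞 F))
    fun h => hpr.not_isUnit (isUnit_of_dvd_unit h w.isUnit)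
  have hε : t ^ 2 - 1 = 1 + t ^ 2 * (t ^ 2 - 3) := by linear_combination -ht
  have ha' : a = 1 + t ^ 2 * ((4 - t ^ 2) * (1 + 2 * t) - 1 - t) := by
    rw [ha]; linear_combination (1 + 2 * t) * ht
  have hτ : 1 + t ^ 3 - 3 * t = 1 + t + t ^ 2 * (t - 2 * t * (4 - t ^ 2)) := by
    linear_combination -2 * t * ht
  rw [hm', hn'] at hs' hpq
  rcases hw with hw | hw | hw | hw
  · exact ⟨w * (m * n), Or.inl (by rw [hprod, hw]; ring)⟩
  · exact ⟨w * (m * n), Or.inr (by rw [hprod, hw]; ring)⟩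
  · exfalso
    rw [hc, hτ] at hw
    generalize t - 2 * t * (4 - t ^ 2) = k at hw
    exact unit_class_excluded hpr (quartic_dvd_or ht hdeg) htwo hε ha' ea
      (u := k + c + t * c + t ^ 2 * k * c) (by rw [hw]; ring) hpq hs'
  · exfalso
    rw [hc, hτ] at hw
    generalize t - 2 * t * (4 - t ^ 2) = k at hw
    obtain ⟨j, hj⟩ : ∃ j, t ^ 2 - 1 = 1 + t ^ 2 * j := ⟨_, hε⟩
    exact unit_class_excluded hpr (quartic_dvd_or ht hdeg) htwo hε ha' ea
      (u := k + c + t * c + t ^ 2 * k * c + j * ((1 + t + t ^ 2 * k) * (1 + t ^ 2 * c)))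
      (by rw [hw, hj]; ring) hpq hs'

/-- A nonzero `x`-coordinate on `y² = x(x - ε)(x - εa²)` is a square up to a power of `ε`. -/
theorem quartic_descent {θ ε a : F} (hθ : θ ^ 4 - 4 * θ ^ 2 + 2 = 0) (hdeg : finrank ℚ F = 4)
    (hε : ε = θ ^ 2 - 1) (ha : a = 3 + 4 * θ - θ ^ 2 - θ ^ 3) {x y : F} (hx : x ≠ 0)
    (h : y ^ 2 = x * (x - ε) * (x - ε * a ^ 2)) : ∃ w, x = w ^ 2 ∨ x = ε * w ^ 2 := by
  have hIntegral : IsIntegral ℤ θ :=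
    ⟨X ^ 4 - 4 * X ^ 2 + 2, by monicity!, by simpa [← aeval_def, map_ofNat] using hθ⟩
  obtain ⟨t, rfl⟩ : ∃ t : 𝓞 F, algebraMap (𝓞 F) F t = θ := ⟨⟨θ, hIntegral⟩, rfl⟩
  have ht : t ^ 4 - 4 * t ^ 2 + 2 = 0 := by
    apply RingOfIntegers.ext
    simpa [map_ofNat] using hθ
  obtain ⟨φ, h0, h1, h2, h3⟩ := exists_real_embeddings hθ hdeg
  have := quartic_principal ht hdeg
  obtain ⟨p, ⟨q, hq⟩, hrel, hpq⟩ := IsFractionRing.exists_reduced_fraction (A := 𝓞 F) x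
  have hq0 : q ≠ 0 := nonZeroDivisors.ne_zero hq
  have hq0' : algebraMap (𝓞 F) F q ≠ 0 := by simpa using hq0
  have hxq : x * algebraMap (𝓞 F) F q = algebraMap (𝓞 F) F p := by
    rw [← hpq]; exact IsLocalization.mk'_spec F p ⟨q, hq⟩
  have hp0 : p ≠ 0 := by
    rintro rfl
    simp [hx, hq0'] at hxq
  have hcop : IsCoprime p q := hrel.isCoprime
  let b : 𝓞 F := 3 + 4 * t - t ^ 2 - t ^ 3
  have hb : algebraMap (𝓞 F) F b = a := by rw [ha]; simp [b, map_ofNat]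
  have hs : (y * algebraMap (𝓞 F) F q ^ 2) ^ 2 =
      algebraMap (𝓞 F) F (p * q * ((p - (t ^ 2 - 1) * q) * (p - (t ^ 2 - 1) * b ^ 2 * q))) := by
    simp only [map_mul, map_sub, map_pow, map_one, hb]
    rw [← hxq, ← hε]
    linear_combination algebraMap (𝓞 F) F q ^ 4 * h
  obtain ⟨s, hs'⟩ := IsIntegrallyClosed.exists_algebraMap_eq_of_isIntegral_pow (R := 𝓞 F)
    (x := y * algebraMap (𝓞 F) F q ^ 2) two_pos (by rw [hs]; exact isIntegral_algebraMap)
  have hs2 : s ^ 2 = p * q * ((p - (t ^ 2 - 1) * q) * (p - (t ^ 2 - 1) * b ^ 2 * q)) := by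
    apply RingOfIntegers.ext
    change algebraMap (𝓞 F) F _ = algebraMap (𝓞 F) F _
    rw [← hs, ← hs', map_pow]
  have hpos : ∀ k, 1 ≤ φ k (algebraMap (𝓞 F) F t) ^ 2 → 0 < φ k (algebraMap (𝓞 F) F (p * q)) := by
    intro k hk
    have e : φ k (algebraMap (𝓞 F) F (p * q)) = φ k x * φ k (algebraMap (𝓞 F) F q) ^ 2 := by
      rw [map_mul, ← hxq, map_mul, map_mul]; ring
    have hεk : 0 ≤ φ k ε := by rw [hε]; simpa using hk
    have hq2 : 0 < φ k (algebraMap (𝓞 F) F q) ^ 2 := by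
      have : φ k (algebraMap (𝓞 F) F q) ≠ 0 := by simpa using hq0
      positivity
    have hx0 : φ k x ≠ 0 := by simpa using hx
    rw [e]
    refine mul_pos (lt_of_le_of_ne ?_ hx0.symm) hq2
    by_contra! hneg
    have hk := congrArg (φ k) h
    simp only [map_mul, map_pow, map_sub] at hk
    have : 0 < (φ k x - φ k ε) * (φ k x - φ k ε * φ k a ^ 2) :=
      mul_pos_of_neg_of_neg (by linarith) (by nlinarith [sq_nonneg (φ k a), mul_nonneg hεk (sq_nonneg (φ k a))])
    nlinarith [sq_nonneg (φ k y), mul_neg_of_neg_of_pos hneg this]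
  obtain ⟨w, hw⟩ := quartic_integral_descent ht hdeg rfl hp0 hq0 hcop hs2 φ h0 h1 h2 h3
    (hpos 0 (by nlinarith)) (hpos 1 (by nlinarith))
  have hxw : x * algebraMap (𝓞 F) F q ^ 2 = algebraMap (𝓞 F) F (p * q) := by rw [map_mul, ← hxq]; ring
  refine ⟨algebraMap (𝓞 F) F w / algebraMap (𝓞 F) F q, ?_⟩
  rcases hw with hw | hw
  · left
    rw [hw, map_pow] at hxw
    field_simp
    exact hxw
  · right
    rw [hw, map_mul, map_pow] at hxw
    field_simp
    rw [hxw, hε]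
    simp

end QuarticDescent

open Polynomial NumberField Module

theorem isElliptic_of_rel {F : Type*} [Field F] [CharZero F] {ε a : F} (hε : ε ≠ 0) (ha : a ≠ 0)
    (hrel : ε * (1 - a ^ 2) = 2 * a) : (cubicCurve (-(ε * (1 + a ^ 2))) (ε ^ 2 * a ^ 2) 0).IsElliptic := by
  refine isElliptic_of_ne ?_
  have : 16 * ((-(ε * (1 + a ^ 2))) ^ 2 * (ε ^ 2 * a ^ 2) ^ 2 - 4 * (ε ^ 2 * a ^ 2) ^ 3
      - 4 * (-(ε * (1 + a ^ 2))) ^ 3 * 0 - 27 * 0 ^ 2 + 18 * (-(ε * (1 + a ^ 2))) * (ε ^ 2 * a ^ 2) * 0)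
      = 64 * (ε ^ 4 * a ^ 6) := by
    linear_combination 16 * ε ^ 4 * a ^ 4 * (ε * (1 - a ^ 2) + 2 * a) * hrel
  rw [this]
  exact mul_ne_zero (by norm_num) (mul_ne_zero (pow_ne_zero _ hε) (pow_ne_zero _ ha))

section QuarticHalving

variable {F : Type*} [Field F] [NumberField F] [DecidableEq F] {θ ε a : F}
  [(cubicCurve (-(ε * (1 + a ^ 2))) (ε ^ 2 * a ^ 2) 0).IsElliptic]

omit [DecidableEq F] [(cubicCurve (-(ε * (1 + a ^ 2))) (ε ^ 2 * a ^ 2) 0).IsElliptic] in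
theorem quartic_conjugate_descent (hθ : θ ^ 4 - 4 * θ ^ 2 + 2 = 0) (hdeg : finrank ℚ F = 4)
    (hε : ε = θ ^ 2 - 1) (ha : a = 3 + 4 * θ - θ ^ 2 - θ ^ 3) (hε0 : ε ≠ 0) (ha1 : 1 - a ≠ 0)
    {q r : F} (hq : q ≠ 0) (h : r ^ 2 = q * (q + ε * (1 - a) ^ 2) * (q + ε * (1 + a) ^ 2)) :
    ∃ w, q = w ^ 2 ∨ q = -ε * w ^ 2 := by
  obtain ⟨ε', hε'⟩ : ∃ ε', ε' = (θ ^ 3 - 3 * θ) ^ 2 - 1 := ⟨_, rfl⟩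
  obtain ⟨a', ha'⟩ : ∃ a', a' = 3 + 4 * (θ ^ 3 - 3 * θ) - (θ ^ 3 - 3 * θ) ^ 2
    - (θ ^ 3 - 3 * θ) ^ 3 := ⟨_, rfl⟩
  have e1 : ε' = -1 / ε := by
    rw [eq_div_iff hε0, hε', hε]; linear_combination (1 - 3 * θ ^ 2 + θ ^ 4) * hθ
  have e2 : a' = (1 + a) / (1 - a) := by
    rw [eq_div_iff ha1, ha', ha]
    linear_combination (-5 + 4 * θ + 25 * θ ^ 2 - 9 * θ ^ 3 - 26 * θ ^ 4 + 6 * θ ^ 5 + 9 * θ ^ 6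
      - θ ^ 7 - θ ^ 8) * hθ
  have hκ : ε * (1 - a) ≠ 0 := mul_ne_zero hε0 ha1
  obtain ⟨w, hw⟩ := quartic_descent (θ := θ ^ 3 - 3 * θ)
    (by linear_combination (1 - 16 * θ ^ 2 + 20 * θ ^ 4 - 8 * θ ^ 6 + θ ^ 8) * hθ) hdeg hε' ha'
    (x := q / (ε * (1 - a)) ^ 2) (y := r / (ε * (1 - a)) ^ 3)
    (div_ne_zero hq (pow_ne_zero 2 hκ)) (by
      rw [e1, e2]
      field_simp
      linear_combination h)
  rcases hw with hw | hw
  · exact ⟨w * (ε * (1 - a)), Or.inl (by rw [div_eq_iff (pow_ne_zero 2 hκ)] at hw; rw [hw]; ring)⟩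
  · refine ⟨w * (1 - a), Or.inr ?_⟩
    rw [div_eq_iff (pow_ne_zero 2 hκ), e1] at hw
    rw [hw]
    field_simp

theorem exists_half_of_square (hθ : θ ^ 4 - 4 * θ ^ 2 + 2 = 0) (hdeg : finrank ℚ F = 4)
    (hε : ε = θ ^ 2 - 1) (ha : a = 3 + 4 * θ - θ ^ 2 - θ ^ 3) (hε0 : ε ≠ 0) (ha0 : a ≠ 0)
    (hrel : ε * (1 - a ^ 2) = 2 * a) {x y X : F} (hX : X ≠ 0) (hx : x = X ^ 2)
    (h : y ^ 2 = x ^ 3 + -(ε * (1 + a ^ 2)) * x ^ 2 + ε ^ 2 * a ^ 2 * x + 0) :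
    ∃ T Q : Pt (-(ε * (1 + a ^ 2))) (ε ^ 2 * a ^ 2) 0, T + T = 0 ∧ pt h = T + (Q + Q) := by
  subst hx
  have ha1 : 1 - a ≠ 0 := by
    intro h0
    have : 2 * a = 0 := by rw [← hrel]; linear_combination ε * (1 + a) * h0
    simp [ha0] at this
  have hB : ε ^ 2 * a ^ 2 ≠ 0 := by positivity
  have hAB : (-(ε * (1 + a ^ 2))) ^ 2 ≠ 4 * (ε ^ 2 * a ^ 2) := by
    intro h0
    have : 4 * a ^ 2 = 0 := by linear_combination h0 - (ε * (1 - a ^ 2) + 2 * a) * hrel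
    simp [ha0] at this
  obtain ⟨V, rfl⟩ : ∃ V, y = X * V := ⟨y / X, by field_simp⟩
  have hV : V ^ 2 = X ^ 4 + -(ε * (1 + a ^ 2)) * X ^ 2 + ε ^ 2 * a ^ 2 :=
    mul_left_cancel₀ (pow_ne_zero 2 hX) (by linear_combination h)
  obtain ⟨q, hq⟩ : ∃ q, q = 2 * X ^ 2 + -(ε * (1 + a ^ 2)) + 2 * V := ⟨_, rfl⟩
  have hqq : q * (2 * X ^ 2 + -(ε * (1 + a ^ 2)) - 2 * V) = 4 * a ^ 2 := by
    rw [hq]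
    linear_combination -4 * hV + (ε * (1 - a ^ 2) + 2 * a) * hrel
  have hq0 : q ≠ 0 := by
    rintro h0
    rw [h0, zero_mul] at hqq
    simp [ha0] at hqq
  obtain ⟨w, hw⟩ := quartic_conjugate_descent hθ hdeg hε ha hε0 ha1 hq0 (r := 2 * X * q) (by
    have : 4 * X ^ 2 * q = q ^ 2 + 2 * ε * (1 + a ^ 2) * q + ε ^ 2 * (1 - a ^ 2) ^ 2 := by
      rw [hq]; linear_combination -4 * hV
    linear_combination q * this)
  rcases hw with hw | hw
  · obtain ⟨Q, hQ⟩ := exists_half hB hAB hV (n := w) (by rw [← hw, hq]) h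
    exact ⟨0, Q, by simp, by rw [hQ, zero_add]⟩
  · have hw0 : w ≠ 0 := by rintro rfl; simp [hq0] at hw
    have h₀ : (0 : F) ^ 2 = 0 ^ 3 + -(ε * (1 + a ^ 2)) * 0 ^ 2 + ε ^ 2 * a ^ 2 * 0 + 0 := by ring
    obtain ⟨h', e⟩ := add_origin (pow_ne_zero 2 hX) h h₀
    have hV' : (-(V * ε * a / X ^ 2)) ^ 2 = (ε * a / X) ^ 4
        + -(ε * (1 + a ^ 2)) * (ε * a / X) ^ 2 + ε ^ 2 * a ^ 2 := by
      field_simp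
      linear_combination hV
    have hn : ((1 + a) * (X ^ 2 - ε * a + V) / (w * X)) ^ 2
        = 2 * (ε * a / X) ^ 2 + -(ε * (1 + a ^ 2)) + 2 * -(V * ε * a / X ^ 2) := by
      have key : -ε * q * (2 * ε ^ 2 * a ^ 2 - ε * (1 + a ^ 2) * X ^ 2 - 2 * ε * a * V)
          = ε ^ 2 * ((1 + a) * (X ^ 2 - ε * a + V)) ^ 2 := by
        rw [hq]; linear_combination (-ε ^ 2 * (1 - a) ^ 2) * hV
      rw [hw] at key
      field_simp
      refine mul_left_cancel₀ (pow_ne_zero 2 hε0) ?_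
      linear_combination -key
    have ex : ε ^ 2 * a ^ 2 / X ^ 2 = (ε * a / X) ^ 2 := by field_simp
    have ey : -(X * V * (ε ^ 2 * a ^ 2) / (X ^ 2) ^ 2) = ε * a / X * (-(V * ε * a / X ^ 2)) := by
      field_simp
    have h'' := h'
    rw [ex, ey] at h''
    obtain ⟨Q, hQ⟩ := exists_half hB hAB hV' hn h''
    have e' : pt h' = (pt h'' : Pt (-(ε * (1 + a ^ 2))) (ε ^ 2 * a ^ 2) 0) := pt_inj.2 ⟨ex, ey⟩
    have hT : (pt h₀ : Pt (-(ε * (1 + a ^ 2))) (ε ^ 2 * a ^ 2) 0) + pt h₀ = 0 :=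
      pt_add_eq_zero.2 ⟨rfl, by simp⟩
    refine ⟨pt h₀, Q, hT, ?_⟩
    rw [← hQ, ← e', ← e, add_comm (pt h), ← add_assoc, hT, zero_add]

theorem finite_sixteen (hθ : θ ^ 4 - 4 * θ ^ 2 + 2 = 0) (hdeg : finrank ℚ F = 4)
    (hε : ε = θ ^ 2 - 1) (ha : a = 3 + 4 * θ - θ ^ 2 - θ ^ 3) (hε0 : ε ≠ 0) (ha0 : a ≠ 0)
    (hrel : ε * (1 - a ^ 2) = 2 * a) :
    Finite (Pt (-(ε * (1 + a ^ 2))) (ε ^ 2 * a ^ 2) 0) := by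
  refine finite_pt fun P => ?_
  rcases eq_zero_or P with rfl | ⟨x, y, h, rfl⟩
  · exact ⟨0, 0, by simp, by simp⟩
  by_cases hy : y = 0
  · exact ⟨pt h, 0, pt_add_eq_zero.2 ⟨rfl, by simp [hy]⟩, by simp⟩
  have hx0 : x ≠ 0 := by
    rintro rfl
    apply hy
    have : y ^ 2 = 0 := by linear_combination h
    exact pow_eq_zero_iff two_ne_zero |>.1 this
  obtain ⟨w, hw | hw⟩ := quartic_descent hθ hdeg hε ha hx0 (y := y) (by linear_combination h)
  · have hw0 : w ≠ 0 := by rintro rfl; simp [hx0] at hw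
    exact exists_half_of_square hθ hdeg hε ha hε0 ha0 hrel hw0 hw h
  · have hxe : x ≠ ε := by
      rintro rfl
      apply hy
      have : y ^ 2 = 0 := by linear_combination h
      exact pow_eq_zero_iff two_ne_zero |>.1 this
    have hxe' : x - ε ≠ 0 := sub_ne_zero.2 hxe
    have hw0 : w ≠ 0 := by rintro rfl; simp [hx0] at hw
    have h₁ : (0 : F) ^ 2 = ε ^ 3 + -(ε * (1 + a ^ 2)) * ε ^ 2 + ε ^ 2 * a ^ 2 * ε + 0 := by ring
    obtain ⟨h', e⟩ := add_chord h h₁ hxe (l := y / (x - ε)) (x := (y / (w * (x - ε))) ^ 2)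
      (by field_simp; ring) (by
        field_simp
        refine mul_left_cancel₀ hε0 ?_
        linear_combination (ε - w ^ 2 * ε) * h
          + (ε * x ^ 2 - ε ^ 2 * (1 + a ^ 2) * x + ε ^ 3 * a ^ 2) * hw) rfl
    obtain ⟨T, Q, hT, hQ⟩ := exists_half_of_square hθ hdeg hε ha hε0 ha0 hrel
      (X := y / (w * (x - ε))) (div_ne_zero hy (mul_ne_zero hw0 hxe')) rfl h'
    have hT₁ : (pt h₁ : Pt (-(ε * (1 + a ^ 2))) (ε ^ 2 * a ^ 2) 0) + pt h₁ = 0 :=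
      pt_add_eq_zero.2 ⟨rfl, by simp⟩
    refine ⟨T + pt h₁, Q, ?_, ?_⟩
    · rw [add_add_add_comm, hT, hT₁, zero_add]
    · rw [add_right_comm, ← hQ, ← e, add_assoc, hT₁, add_zero]

end QuarticHalving

end CubicCurve

universe u

namespace CubicCurve

open Polynomial NumberField Module

section ResidueField

variable {Ω : Type u} [Field Ω] {v : AbsoluteValue Ω ℝ} (hv : IsNonarchimedean v) (h3 : v 3 < 1)

include h3 in
theorem exists_residueField : ∃ (k : Type u) (_ : Field k) (_ : CharP k 3)
    (red : intRing hv →+* k), ∀ z : intRing hv, red z = 0 ↔ v z < 1 := by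
  let m : Ideal (intRing hv) :=
    { carrier := {z | v z < 1}
      add_mem' := fun {x y} hx hy => by
        simp only [Set.mem_ofPred_eq, Subring.coe_add] at *
        exact v_add_lt_one hv hx hy
      zero_mem' := by simp
      smul_mem' := fun c x hx => by
        simp only [Set.mem_ofPred_eq, smul_eq_mul, Subring.coe_mul] at *
        exact v_mul_lt_one' hv c.2 hx }
  have hm : ∀ z, z ∈ m ↔ v z < 1 := fun z => Iff.rfl
  have hmax : m.IsMaximal := by
    refine Ideal.isMaximal_iff.2 ⟨by rw [hm]; simp, fun J x _ hx hxJ => ?_⟩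
    rw [hm, not_lt] at hx
    have hx1 : v x = 1 := le_antisymm x.2 hx
    have hx0 : (x : Ω) ≠ 0 := by rw [← v.ne_zero_iff, hx1]; exact one_ne_zero
    have hinv : (x : Ω)⁻¹ ∈ intRing hv := by rw [mem_intRing, map_inv₀, hx1, inv_one]
    have : (1 : intRing hv) = ⟨(x : Ω)⁻¹, hinv⟩ * x := by ext; simp [hx0]
    rw [this]
    exact J.mul_mem_left _ hxJ
  let _ := Ideal.Quotient.field m
  have hred : ∀ z : intRing hv, Ideal.Quotient.mk m z = 0 ↔ v z < 1 := fun z => by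
    rw [Ideal.Quotient.eq_zero_iff_mem, hm]
  refine ⟨intRing hv ⧸ m, inferInstance, ?_, Ideal.Quotient.mk m, hred⟩
  rw [CharP.charP_iff_prime_eq_zero Nat.prime_three, ← map_natCast (Ideal.Quotient.mk m), hred]
  have : (((3 : ℕ) : intRing hv) : Ω) = 3 :=
    (map_natCast (intRing hv).subtype 3).trans (by norm_num)
  rwa [this]

variable [CharZero Ω]

/-- The restriction of an absolute value to the rational numbers. -/
noncomputable def ratAbs (v : AbsoluteValue Ω ℝ) : AbsoluteValue ℚ ℝ :=
  v.comp (algebraMap ℚ Ω).injective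

theorem ratAbs_apply (q : ℚ) : ratAbs v q = v (q : Ω) := rfl

include hv in
theorem ratAbs_isNonarchimedean : IsNonarchimedean (ratAbs v) := fun x y => by
  simpa [ratAbs_apply] using hv (x : Ω) y

include h3 in
theorem ratAbs_three : ratAbs v 3 < 1 := by simpa [ratAbs_apply] using h3

include hv h3 in
theorem ratCast_residue {q : ℚ} (hq : v (q : Ω) ≤ 1) : ∃ n : ZMod 3, ∀ {k : Type u} [Field k]
    [CharP k 3] (red : intRing hv →+* k) (_ : ∀ z : intRing hv, red z = 0 ↔ v z < 1),
    red ⟨q, hq⟩ = ZMod.castHom (dvd_refl 3) k n := by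
  rcases rat_residue (ratAbs_isNonarchimedean hv) (ratAbs_three h3) (u := q) hq with h | h | h
  · refine ⟨0, fun red hred => ?_⟩
    rw [map_zero, hred]
    exact h
  · refine ⟨1, fun red hred => ?_⟩
    rw [map_one, ← sub_eq_zero, ← map_one red, ← map_sub, hred]
    simpa [ratAbs_apply] using h
  · refine ⟨-1, fun red hred => ?_⟩
    rw [map_neg, map_one, eq_neg_iff_add_eq_zero, ← map_one red, ← map_add, hred]
    simpa [ratAbs_apply] using h

theorem exists_dominant {ι : Type*} [Finite ι] (v : AbsoluteValue ℚ ℝ) (q : ι → ℚ) {i : ι}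
    (hi : q i ≠ 0) : ∃ j, q j ≠ 0 ∧ ∀ l, v (q l / q j) ≤ 1 := by
  have : Nonempty ι := ⟨i⟩
  obtain ⟨j, hj⟩ := Finite.exists_max fun l => v (q l)
  have hpos : 0 < v (q j) := (v.pos hi).trans_le (hj i)
  exact ⟨j, v.pos_iff.1 hpos, fun l => by rw [map_div₀]; exact (div_le_one hpos).2 (hj l)⟩

theorem quartic_independent_charThree {k : Type*} [Field k] [CharP k 3] {t : k}
    (ht : t ^ 4 - 4 * t ^ 2 + 2 = 0) {m n p q : ZMod 3}
    (h : ZMod.castHom (dvd_refl 3) k m + ZMod.castHom (dvd_refl 3) k n * t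
      + ZMod.castHom (dvd_refl 3) k p * t ^ 2 + ZMod.castHom (dvd_refl 3) k q * t ^ 3 = 0) :
    m = 0 ∧ n = 0 ∧ p = 0 ∧ q = 0 := by
  have key : ∀ m n p q : ZMod 3,
      (m ^ 2 + p ^ 2 - 2 * n * q - q ^ 2) ^ 2 + (m ^ 2 + p ^ 2 - 2 * n * q - q ^ 2) *
        (2 * m * p + p ^ 2 - n ^ 2 - 2 * n * q - 2 * q ^ 2)
        - (2 * m * p + p ^ 2 - n ^ 2 - 2 * n * q - 2 * q ^ 2) ^ 2 = 0 →
      m = 0 ∧ n = 0 ∧ p = 0 ∧ q = 0 := by decide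
  apply key
  apply (ZMod.castHom (dvd_refl 3) k).injective
  have e2 : (ZMod.castHom (dvd_refl 3) k) 2 = 2 := map_ofNat _ 2
  simp only [map_add, map_sub, map_mul, map_pow, map_zero, e2]
  have h30 : (3 : k) = 0 := by exact_mod_cast CharP.cast_eq_zero k 3
  generalize (ZMod.castHom (dvd_refl 3) k) m = m' at *
  generalize (ZMod.castHom (dvd_refl 3) k) n = n' at *
  generalize (ZMod.castHom (dvd_refl 3) k) p = p' at *
  generalize (ZMod.castHom (dvd_refl 3) k) q = q' at *
  have hD : (t ^ 2) ^ 2 = t ^ 2 + 1 := by linear_combination ht + (t ^ 2 - 1) * h30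
  have h1 : (m' + p' * t ^ 2) ^ 2 = t ^ 2 * (n' + q' * t ^ 2) ^ 2 := by
    linear_combination (m' + p' * t ^ 2 - t * (n' + q' * t ^ 2)) * h
  generalize t ^ 2 = D at *
  set A := m' ^ 2 + p' ^ 2 - 2 * n' * q' - q' ^ 2 with hA
  set B := 2 * m' * p' + p' ^ 2 - n' ^ 2 - 2 * n' * q' - 2 * q' ^ 2 with hB
  have h2 : A + B * D = 0 := by
    rw [hA, hB]
    linear_combination h1 + (2 * n' * q' + q' ^ 2 * D + q' ^ 2 - p' ^ 2) * hD
  linear_combination (A + B - B * D) * h2 + B ^ 2 * hD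

theorem pow_nine_of_quadratic {k : Type*} [Field k] [CharP k 3] {a b c : ZMod 3}
    (h0 : a ≠ 0 ∨ b ≠ 0 ∨ c ≠ 0) {z : k} (h : ZMod.castHom (dvd_refl 3) k a * z ^ 2
      + ZMod.castHom (dvd_refl 3) k b * z + ZMod.castHom (dvd_refl 3) k c = 0) : z ^ 9 = z := by
  have h30 : (3 : k) = 0 := by exact_mod_cast CharP.cast_eq_zero k 3
  have hcube : ∀ x : ZMod 3, x ^ 3 = x := by decide
  have hsq : ∀ x : ZMod 3, x ≠ 0 → x ^ 2 = 1 := by decide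
  have cube : ∀ x : ZMod 3, ZMod.castHom (dvd_refl 3) k x ^ 3 = ZMod.castHom (dvd_refl 3) k x :=
    fun x => by rw [← map_pow, hcube]
  have sq : ∀ x : ZMod 3, x ≠ 0 → ZMod.castHom (dvd_refl 3) k x ^ 2 = 1 :=
    fun x hx => by rw [← map_pow, hsq x hx, map_one]
  have cb := cube b
  have cc := cube c
  by_cases ha : a = 0
  · rw [ha, map_zero, zero_mul, zero_add] at h
    by_cases hb : b = 0
    · rw [hb, map_zero, zero_mul, zero_add] at h
      refine absurd ?_ (h0.resolve_left (not_not.2 ha) |>.resolve_left (not_not.2 hb))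
      exact (ZMod.castHom (dvd_refl 3) k).injective (h.trans (map_zero _).symm)
    · have sb := sq b hb
      generalize (ZMod.castHom (dvd_refl 3) k) b = b' at *
      generalize (ZMod.castHom (dvd_refl 3) k) c = c' at *
      have e : z = -(b' * c') := by linear_combination b' * h - z * sb
      have e3 : z ^ 3 = z := by rw [e, neg_pow, mul_pow, cb, cc]; ring
      linear_combination (z ^ 6 + z ^ 4 + z ^ 2) * e3 + e3
  · have sa := sq a ha
    have ca := cube a
    generalize (ZMod.castHom (dvd_refl 3) k) a = a' at *
    generalize (ZMod.castHom (dvd_refl 3) k) b = b' at *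
    generalize (ZMod.castHom (dvd_refl 3) k) c = c' at *
    obtain ⟨B, hB⟩ : ∃ B, B = -(a' * b') := ⟨_, rfl⟩
    obtain ⟨C, hC⟩ : ∃ C, C = -(a' * c') := ⟨_, rfl⟩
    have hB3 : B ^ 3 = B := by rw [hB, neg_pow, mul_pow, ca, cb]; ring
    have hC3 : C ^ 3 = C := by rw [hC, neg_pow, mul_pow, ca, cc]; ring
    have e : z ^ 2 = B * z + C := by rw [hB, hC]; linear_combination a' * h - z ^ 2 * sa
    have e3 : (z ^ 3) ^ 2 = B * z ^ 3 + C := by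
      calc (z ^ 3) ^ 2 = (z ^ 2) ^ 3 := by ring
        _ = B ^ 3 * z ^ 3 + C ^ 3 := by
          rw [e]; linear_combination (B ^ 2 * z ^ 2 * C + B * z * C ^ 2) * h30
        _ = _ := by rw [hB3, hC3]
    have e4 : (z ^ 3 - z) * (z ^ 3 + z - B) = 0 := by linear_combination e3 - e
    rcases mul_eq_zero.1 e4 with e5 | e5
    · linear_combination (z ^ 6 + z ^ 4 + z ^ 2 + 1) * e5
    · have e6 : z ^ 3 = B - z := by linear_combination e5
      calc z ^ 9 = (z ^ 3) ^ 3 := by ring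
        _ = (B - z) ^ 3 := by rw [e6]
        _ = z := by linear_combination hB3 - e6 + (-B ^ 2 * z + B * z ^ 2) * h30

end ResidueField

open Polynomial NumberField Module

section ResidueField

variable {Ω : Type u} [Field Ω] [CharZero Ω] {v : AbsoluteValue Ω ℝ} (hv : IsNonarchimedean v)
  (h3 : v 3 < 1)

omit [CharZero Ω] in
include hv in
theorem quartic_root_mem {θ : Ω} (hθ : θ ^ 4 - 4 * θ ^ 2 + 2 = 0) : θ ∈ intRing hv := by
  by_contra h
  rw [mem_intRing, not_le] at h
  have h4 : v (4 : Ω) ≤ 1 := ofNat_mem (intRing hv) 4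
  have h2 : v (2 : Ω) ≤ 1 := ofNat_mem (intRing hv) 2
  have e : θ ^ 4 + (-(4 * θ ^ 2) + 2) = 0 := by linear_combination hθ
  have hlt : v (-(4 * θ ^ 2) + 2) < v (θ ^ 4) := by
    refine (hv _ _).trans_lt (max_lt ?_ ?_)
    · rw [AbsoluteValue.map_neg, map_mul, map_pow, map_pow]
      have : v θ ^ 2 < v θ ^ 4 := pow_lt_pow_right₀ h (by norm_num)
      nlinarith [sq_nonneg (v θ)]
    · rw [map_pow]
      exact h2.trans_lt (one_lt_pow₀ h (by norm_num))
  have := v_add_eq hv hlt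
  rw [e, map_zero] at this
  rw [← this] at hlt
  exact absurd hlt (not_lt.2 (v.nonneg _))

include hv h3 in
theorem quartic_unramified {θ : Ω} (hθ : θ ^ 4 - 4 * θ ^ 2 + 2 = 0) {a b c d : ℚ}
    (hu : v ((a : Ω) + b * θ + c * θ ^ 2 + d * θ ^ 3) < 1) :
    v ((a : Ω) + b * θ + c * θ ^ 2 + d * θ ^ 3) ≤ v 3 := by
  have hθi := quartic_root_mem hv hθ
  by_cases hz : ∀ i, (![a, b, c, d] : Fin 4 → ℚ) i = 0
  · have h0 := hz 0
    have h1 := hz 1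
    have h2 := hz 2
    have h4 := hz 3
    simp only [Matrix.cons_val] at h0 h1 h2 h4
    simp [h0, h1, h2, h4]
  push Not at hz
  obtain ⟨i, hi⟩ := hz
  obtain ⟨j, hj, hmax⟩ := exists_dominant (ratAbs v) _ hi
  set q := (![a, b, c, d] : Fin 4 → ℚ) with hq
  have hqj : (q j : Ω) ≠ 0 := by exact_mod_cast hj
  obtain ⟨k, _, _, red, hred⟩ := exists_residueField hv h3
  choose n hn using fun l => ratCast_residue hv h3 (hmax l)
  let r : Fin 4 → intRing hv := fun l => ⟨((q l / q j : ℚ) : Ω), hmax l⟩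
  let t : intRing hv := ⟨θ, hθi⟩
  let w : intRing hv := r 0 + r 1 * t + r 2 * t ^ 2 + r 3 * t ^ 3
  have hw : (a : Ω) + b * θ + c * θ ^ 2 + d * θ ^ 3 = q j * w := by
    simp only [w, r, t, Subring.coe_add, Subring.coe_mul, Subring.coe_pow]
    push_cast
    have e : ∀ l, (q l : Ω) = q j * (q l / q j) := fun l => by field_simp
    have e0 : (a : Ω) = q 0 := rfl
    have e1 : (b : Ω) = q 1 := rfl
    have e2 : (c : Ω) = q 2 := rfl
    have e3 : (d : Ω) = q 3 := rfl
    rw [e0, e1, e2, e3]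
    linear_combination e 0 + θ * e 1 + θ ^ 2 * e 2 + θ ^ 3 * e 3
  have hw1 : v w = 1 := by
    refine le_antisymm w.2 (not_lt.1 fun hlt => ?_)
    rw [← hred] at hlt
    simp only [w, map_add, map_mul, map_pow] at hlt
    have hr : ∀ l, red (r l) = ZMod.castHom (dvd_refl 3) k (n l) := fun l => hn l red hred
    rw [hr, hr, hr, hr] at hlt
    have ht : red t ^ 4 - 4 * red t ^ 2 + 2 = 0 := by
      have e : t ^ 4 - 4 * t ^ 2 + 2 = 0 := Subtype.ext hθ
      have := congrArg red e
      simpa only [map_add, map_sub, map_mul, map_pow, map_ofNat, map_zero] using this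
    obtain ⟨n0, n1, n2, n3⟩ := quartic_independent_charThree ht hlt
    have hnj : n j = 0 := by fin_cases j <;> assumption
    have hj1 := hr j
    rw [hnj, map_zero, hred] at hj1
    simp [r, hj] at hj1
  rw [hw, map_mul, hw1, mul_one] at hu ⊢
  simpa [ratAbs_apply] using
    rat_unramified (ratAbs_isNonarchimedean hv) (ratAbs_three h3) (u := q j) hu

theorem quadratic_residue {k : Type u} [Field k] [CharP k 3] {red : intRing hv →+* k}
    (hred : ∀ z : intRing hv, red z = 0 ↔ v z < 1) {z : intRing hv} {a b c : ℚ}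
    (h0 : a ≠ 0 ∨ b ≠ 0 ∨ c ≠ 0) (h : (a : Ω) * z ^ 2 + b * z + c = 0) : red z ^ 9 = red z := by
  have h3 : v 3 < 1 := by
    have := (hred 3).1 (by rw [map_ofNat]; exact_mod_cast CharP.cast_eq_zero k 3)
    exact this
  obtain ⟨i, hi⟩ : ∃ i, (![a, b, c] : Fin 3 → ℚ) i ≠ 0 := by
    rcases h0 with h | h | h
    exacts [⟨0, h⟩, ⟨1, h⟩, ⟨2, h⟩]
  obtain ⟨j, hj, hmax⟩ := exists_dominant (ratAbs v) _ hi
  set q := (![a, b, c] : Fin 3 → ℚ) with hq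
  have hqj : (q j : Ω) ≠ 0 := by exact_mod_cast hj
  choose n hn using fun l => ratCast_residue hv h3 (hmax l)
  let r : Fin 3 → intRing hv := fun l => ⟨((q l / q j : ℚ) : Ω), hmax l⟩
  have hr : ∀ l, red (r l) = ZMod.castHom (dvd_refl 3) k (n l) := fun l => hn l red hred
  have hnj : n j ≠ 0 := fun hnj => by
    have hj1 := hr j
    rw [hnj, map_zero, hred] at hj1
    simp [r, hj] at hj1
  have e : r 0 * z ^ 2 + r 1 * z + r 2 = 0 := by
    ext
    simp only [r, Subring.coe_add, Subring.coe_mul, Subring.coe_pow]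
    push_cast
    have e0 : (a : Ω) = q 0 := rfl
    have e1 : (b : Ω) = q 1 := rfl
    have e2 : (c : Ω) = q 2 := rfl
    rw [e0, e1, e2] at h
    linear_combination (q j : Ω)⁻¹ * h
  have := congrArg red e
  simp only [map_add, map_mul, map_pow, hr, map_zero] at this
  refine pow_nine_of_quadratic ?_ this
  fin_cases j
  exacts [.inl hnj, .inr (.inl hnj), .inr (.inr hnj)]

end ResidueField

open NumberField Module

section Galois

variable {Ω : Type*} [Field Ω] {a b c : Ω} [(cubicCurve a b c).IsElliptic]

omit [(cubicCurve a b c).IsElliptic] in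
theorem map_equation {σ : Ω →+* Ω} (ha : σ a = a) (hb : σ b = b) (hc : σ c = c) {x y : Ω}
    (h : y ^ 2 = x ^ 3 + a * x ^ 2 + b * x + c) :
    σ y ^ 2 = σ x ^ 3 + a * σ x ^ 2 + b * σ x + c := by
  have := congrArg σ h
  simpa only [map_add, map_mul, map_pow, ha, hb, hc] using this

/-- The action of a ring endomorphism fixing the coefficients on the points of the curve. -/
def mapPt (σ : Ω →+* Ω) (ha : σ a = a) (hb : σ b = b) (hc : σ c = c) : Pt a b c → Pt a b c
  | .zero => 0
  | .some _ _ h => pt (map_equation ha hb hc (equation_iff.1 h.1))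

variable {σ : Ω →+* Ω} (ha : σ a = a) (hb : σ b = b) (hc : σ c = c)

theorem mapPt_zero : mapPt σ ha hb hc 0 = 0 := rfl

theorem mapPt_pt {x y : Ω} (h : y ^ 2 = x ^ 3 + a * x ^ 2 + b * x + c) :
    mapPt σ ha hb hc (pt h) = pt (map_equation ha hb hc h) := rfl

theorem mapPt_neg (P : Pt a b c) : mapPt σ ha hb hc (-P) = -mapPt σ ha hb hc P := by
  rcases eq_zero_or P with rfl | ⟨x, y, h, rfl⟩
  · rfl
  · rw [neg_pt, mapPt_pt, mapPt_pt, neg_pt, pt_inj]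
    exact ⟨rfl, map_neg σ y⟩

variable [DecidableEq Ω]

theorem mapPt_add (P Q : Pt a b c) :
    mapPt σ ha hb hc (P + Q) = mapPt σ ha hb hc P + mapPt σ ha hb hc Q := by
  rcases eq_zero_or P with rfl | ⟨x₁, y₁, h₁, rfl⟩
  · rw [mapPt_zero, zero_add, zero_add]
  rcases eq_zero_or Q with rfl | ⟨x₂, y₂, h₂, rfl⟩
  · rw [mapPt_zero, add_zero, add_zero]
  by_cases h0 : x₁ = x₂ ∧ y₁ = -y₂
  · rw [pt_add_eq_zero.2 h0, mapPt_pt, mapPt_pt, mapPt_zero, eq_comm, pt_add_eq_zero]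
    exact ⟨by rw [h0.1], by rw [h0.2, map_neg]⟩
  by_cases hx : x₁ = x₂
  · subst hx
    have hy : y₁ = y₂ := (sq_eq_sq_iff_eq_or_eq_neg.1 (h₁.trans h₂.symm)).resolve_right
      fun e => h0 ⟨rfl, e⟩
    subst hy
    have h2 : 2 * y₁ ≠ 0 := fun e => h0 ⟨rfl, by linear_combination e⟩
    have hl : (3 * x₁ ^ 2 + 2 * a * x₁ + b) / (2 * y₁) * (2 * y₁)
      = 3 * x₁ ^ 2 + 2 * a * x₁ + b := div_mul_cancel₀ _ h2
    obtain ⟨h, e⟩ := double h₁ h2 hl rfl rfl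
    obtain ⟨h', e'⟩ := double (map_equation ha hb hc h₁)
      (by simpa using (map_ne_zero σ).2 h2)
      (by simpa only [map_add, map_mul, map_pow, ha, hb, hc, map_ofNat] using congrArg σ hl)
      rfl rfl
    rw [e, mapPt_pt, mapPt_pt, e', pt_inj]
    simp only [map_add, map_mul, map_sub, map_neg, map_pow, ha, map_ofNat, and_self]
  · have hl : (y₁ - y₂) / (x₁ - x₂) * (x₁ - x₂) = y₁ - y₂ :=
      div_mul_cancel₀ _ (sub_ne_zero.2 hx)
    obtain ⟨h, e⟩ := add_chord h₁ h₂ hx hl rfl rfl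
    obtain ⟨h', e'⟩ := add_chord (map_equation ha hb hc h₁) (map_equation ha hb hc h₂)
      (fun e => hx (σ.injective e))
      (by simpa only [map_sub, map_mul] using congrArg σ hl) rfl rfl
    rw [e, mapPt_pt, mapPt_pt, mapPt_pt, e', pt_inj]
    simp only [map_add, map_mul, map_sub, map_neg, map_pow, ha, and_self]

theorem mapPt_sub (P Q : Pt a b c) :
    mapPt σ ha hb hc (P - Q) = mapPt σ ha hb hc P - mapPt σ ha hb hc Q := by
  rw [sub_eq_add_neg, mapPt_add, mapPt_neg, ← sub_eq_add_neg]

omit [DecidableEq Ω] in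
/-- The kernel of reduction contains no nonzero point rational over an unramified field over
which the curve has finitely many points. -/
theorem InKernel.eq_zero_of_fixed {F : Type*} [Field F] [CharZero F] [DecidableEq F]
    [Algebra F Ω] {v : AbsoluteValue Ω ℝ} (hv : IsNonarchimedean v) (h3 : v 3 < 1)
    (hunr : ∀ u : F, v (algebraMap F Ω u) < 1 → v (algebraMap F Ω u) ≤ v 3)
    (hfix : ∀ x : Ω, (∀ σ : Ω →ₐ[F] Ω, σ x = x) → x ∈ (algebraMap F Ω).range)
    {a' b' c' : F} [(cubicCurve a' b' c').IsElliptic] [Finite (Pt a' b' c')]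
    (ha' : algebraMap F Ω a' = a) (hb' : algebraMap F Ω b' = b) (hc' : algebraMap F Ω c' = c)
    (ha : a ∈ intRing hv) (hb : b ∈ intRing hv) (hc : c ∈ intRing hv) {P : Pt a b c}
    (hP : InKernel v P)
    (hσ : ∀ σ : Ω →ₐ[F] Ω, mapPt (σ : Ω →+* Ω) (by rw [← ha']; exact σ.commutes a')
      (by rw [← hb']; exact σ.commutes b') (by rw [← hc']; exact σ.commutes c') P = P) :
    P = 0 := by
  rcases hP with rfl | ⟨x, y, h, rfl, hx⟩
  · rfl
  exfalso
  have hσ' : ∀ σ : Ω →ₐ[F] Ω, σ x = x ∧ σ y = y := fun σ => by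
    have := hσ σ
    rw [mapPt_pt, pt_inj] at this
    exact this
  obtain ⟨x', rfl⟩ := hfix x fun σ => (hσ' σ).1
  obtain ⟨y', rfl⟩ := hfix y fun σ => (hσ' σ).2
  let w : AbsoluteValue F ℝ := v.comp (algebraMap F Ω).injective
  have hw : ∀ u, w u = v (algebraMap F Ω u) := fun u => rfl
  have hwn : IsNonarchimedean w := fun s t => by
    simpa only [hw, map_add] using hv (algebraMap F Ω s) (algebraMap F Ω t)
  have h3' : w 3 = v 3 := by rw [hw, map_ofNat]
  refine absurd ?_ (not_le.2 hx)
  refine v_le_one_of_finite (v := w) hwn (a := a') (b := b') (c := c') (x := x') (y := y')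
    (by rw [mem_intRing, hw, ha']; exact ha) (by rw [mem_intRing, hw, hb']; exact hb)
    (by rw [mem_intRing, hw, hc']; exact hc) three_ne_zero (by rwa [h3'])
    (fun u hu => by rw [h3']; exact hunr u hu) ?_
  apply (algebraMap F Ω).injective
  simp only [map_add, map_mul, map_pow, ha', hb', hc']
  exact h

end Galois

section Slopes

variable {Ω : Type*} [Field Ω] {v : AbsoluteValue Ω ℝ} (hv : IsNonarchimedean v)

section Sum

variable {a b c : Ω} [(cubicCurve a b c).IsElliptic] [DecidableEq Ω]

include hv in
/-- If the differences of two pairs of integral points are opposite, then the slopes of the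
corresponding chords are almost opposite. -/
theorem v_slope_add_lt_one (ha : a ∈ intRing hv) {x y x₁ y₁ x' y' x₂ y₂ l l' : Ω}
    {h : y ^ 2 = x ^ 3 + a * x ^ 2 + b * x + c} {h₁ : y₁ ^ 2 = x₁ ^ 3 + a * x₁ ^ 2 + b * x₁ + c}
    {h' : y' ^ 2 = x' ^ 3 + a * x' ^ 2 + b * x' + c}
    {h₂ : y₂ ^ 2 = x₂ ^ 3 + a * x₂ ^ 2 + b * x₂ + c}
    (hx : x ∈ intRing hv) (hx₁ : x₁ ∈ intRing hv) (hx' : x' ∈ intRing hv)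
    (hx₂ : x₂ ∈ intRing hv) (hy₁ : y₁ ∈ intRing hv) (hy₂ : y₂ ∈ intRing hv)
    (hne : x ≠ x₁) (hne' : x' ≠ x₂) (hl : l * (x - x₁) = y + y₁) (hl' : l' * (x' - x₂) = y' + y₂)
    (hl1 : 1 < v l) (hl1' : 1 < v l')
    (hsum : ((pt h : Pt a b c) - pt h₁) + (pt h' - pt h₂) = 0) : v (l + l') < 1 := by
  rw [sub_eq_add_neg, sub_eq_add_neg, neg_pt, neg_pt] at hsum
  obtain ⟨hA, eA⟩ := add_chord h (by rw [neg_sq, h₁] : (-y₁) ^ 2 = _) hne (l := l)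
    (by linear_combination hl) rfl rfl
  obtain ⟨hA', eA'⟩ := add_chord h' (by rw [neg_sq, h₂] : (-y₂) ^ 2 = _) hne' (l := l')
    (by linear_combination hl') rfl rfl
  rw [eA, eA', pt_add_eq_zero] at hsum
  obtain ⟨eX, eY⟩ := hsum
  have size : ∀ {l u : Ω}, 1 < v l → u ∈ intRing hv → v (l ^ 2 + u) = v l ^ 2 :=
    fun {l u} hl hu => by
      rw [v_add_eq hv, map_pow]
      rw [map_pow]
      exact hu.trans_lt (one_lt_pow₀ hl two_ne_zero)
  set X := l ^ 2 - a - x - x₁ with hX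
  have v1 : v X = v l ^ 2 := by
    rw [← size hl1 (u := -a + -x + -x₁)
      (by repeat' (first | assumption | apply neg_mem | apply add_mem)), hX]
    congr 1; ring
  have v2 : v X = v l' ^ 2 := by
    rw [← size hl1' (u := -a + -x' + -x₂)
      (by repeat' (first | assumption | apply neg_mem | apply add_mem)), eX]
    congr 1; ring
  have v3 : v l' = v l :=
    (pow_left_inj₀ (v.nonneg _) (v.nonneg _) two_ne_zero).1 (v2.symm.trans v1)
  have key : (l + l') * X = (y₁ + y₂) + (l * x₁ + l' * x₂) := by
    rw [← eX] at eY
    linear_combination -eY + hl + hl'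
  have bound : v ((l + l') * X) ≤ v l := by
    rw [key]
    refine (hv _ _).trans (max_le ?_ ((hv _ _).trans (max_le ?_ ?_)))
    · exact (add_mem hy₁ hy₂ : y₁ + y₂ ∈ intRing hv).trans hl1.le
    · rw [map_mul]; exact mul_le_of_le_one_right (v.nonneg _) hx₁
    · rw [map_mul, v3]; exact mul_le_of_le_one_right (v.nonneg _) hx₂
  rw [map_mul, v1] at bound
  by_contra! hge
  nlinarith [mul_le_mul_of_nonneg_right hge (sq_nonneg (v l))]

end Sum

include hv in
/-- The two slopes attached to a pair of congruent points on `η² = k³ (w² + 1) ⋯` are almost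
proportional. -/
theorem v_slope_relation (h3 : v 3 < 1) {k w η w₁ η₁ : Ω} (hk : v k = 1) (hw₁ : v w₁ = 1)
    (hη₁ : η₁ ∈ intRing hv) (hw : v (w - w₁) < 1) (hη : v (η - η₁) < 1) (hne : w ≠ w₁) :
    v ((η / w ^ 3 + η₁ / w₁ ^ 3) / (k * ((w⁻¹) ^ 2 + 1) - k * ((w₁⁻¹) ^ 2 + 1))
      + w₁ * ((η + η₁) / (k * (w ^ 2 + 1) - k * (w₁ ^ 2 + 1))) - η₁ / (k * w₁)) < 1 := by
  have hw1 : v w = 1 := v_eq_one_of_sub hv hw₁ hw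
  have h2 := v_two hv h3
  have hs : v (w + w₁) = 1 := by
    refine v_eq_one_of_sub hv (y := 2 * w₁) (by rw [map_mul, h2, hw₁, one_mul]) ?_
    rwa [show w + w₁ - 2 * w₁ = w - w₁ by ring]
  have ne : ∀ {z : Ω}, v z = 1 → z ≠ 0 := fun {z} hz => by
    rw [← v.ne_zero_iff, hz]; exact one_ne_zero
  have hk0 := ne hk
  have hw0 := ne hw1
  have hw₁0 := ne hw₁
  have hs0 := ne hs
  have hd0 := sub_ne_zero.2 hne
  have e : (η / w ^ 3 + η₁ / w₁ ^ 3) / (k * ((w⁻¹) ^ 2 + 1) - k * ((w₁⁻¹) ^ 2 + 1))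
      + w₁ * ((η + η₁) / (k * (w ^ 2 + 1) - k * (w₁ ^ 2 + 1))) - η₁ / (k * w₁)
      = ((η - η₁) * w₁ ^ 2 - η₁ * (3 * (w₁ ^ 2 + 2 * w₁ * (w - w₁)) + (w - w₁) * (2 * (w - w₁))))
        / (k * w * w₁ * (w + w₁)) := by
    have e1 : k * ((w⁻¹) ^ 2 + 1) - k * ((w₁⁻¹) ^ 2 + 1)
        = -(k * (w - w₁) * (w + w₁)) / (w ^ 2 * w₁ ^ 2) := by field_simp; ring
    have e2 : k * (w ^ 2 + 1) - k * (w₁ ^ 2 + 1) = k * (w - w₁) * (w + w₁) := by ring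
    rw [e1, e2]
    field_simp
    ring
  rw [e, map_div₀, map_mul, map_mul, map_mul, hk, hw1, hw₁, hs, one_mul, one_mul, one_mul, div_one]
  have m1 : w₁ ∈ intRing hv := hw₁.le
  have m2 : w - w₁ ∈ intRing hv := hw.le
  refine v_sub_lt_one hv (v_mul_lt_one hv hη (pow_mem m1 2)) (v_mul_lt_one' hv hη₁
    (v_add_lt_one hv (v_mul_lt_one hv h3 ?_) (v_mul_lt_one hv hw ?_))) <;>
  repeat' (first | assumption | apply ofNat_mem | apply add_mem | apply mul_mem | apply pow_mem)

end Slopes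

section Sextic

variable {Ω : Type*} [Field Ω] {v : AbsoluteValue Ω ℝ} {ε a k : Ω}

/-- Parameters of a sextic `η² = k³ (w² + 1) (w² - a²) (w² - a⁻²)` with good reduction. -/
structure SexticParams (v : AbsoluteValue Ω ℝ) (ε a k : Ω) : Prop where
  v_eps : v ε = 1
  v_a : v a = 1
  v_one_sub : v (1 - a ^ 2) = 1
  v_k : v k = 1
  rel : k * (1 + a ^ 2) = ε * a ^ 2

/-- The point `(w, η)` lies on the sextic. -/
def OnSextic (k a w η : Ω) : Prop :=
  η ^ 2 = k ^ 3 * (w ^ 2 + 1) * (w ^ 2 - a ^ 2) * (w ^ 2 - a⁻¹ ^ 2)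

theorem ne_zero_of_v_eq_one {z : Ω} (hz : v z = 1) : z ≠ 0 := by
  rw [← v.ne_zero_iff, hz]; exact one_ne_zero

theorem OnSextic.inv {w η : Ω} (ha : a ≠ 0) (hw : w ≠ 0) (h : OnSextic k a w η) :
    OnSextic k a w⁻¹ (η / w ^ 3) := by
  unfold OnSextic at *
  rw [div_pow, h]
  field_simp
  ring

theorem OnSextic.equation {w η : Ω} (ha : a ≠ 0) (hrel : k * (1 + a ^ 2) = ε * a ^ 2)
    (h : OnSextic k a w η) :
    η ^ 2 = (k * (w ^ 2 + 1)) ^ 3 + -(ε * (1 + a ^ 2)) * (k * (w ^ 2 + 1)) ^ 2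
      + ε ^ 2 * a ^ 2 * (k * (w ^ 2 + 1)) + 0 := by
  have e1 : ε * a ^ 2 = k * (1 + a ^ 2) := hrel.symm
  have e2 : ε = k * (1 + a⁻¹ ^ 2) := by field_simp; linear_combination -hrel
  have e3 : ε ^ 2 * a ^ 2 = (k * (1 + a⁻¹ ^ 2)) * (k * (1 + a ^ 2)) := by
    rw [← e2, ← e1]; ring
  have e4 : ε * (1 + a ^ 2) = k * (1 + a⁻¹ ^ 2) + k * (1 + a ^ 2) := by
    rw [← e2, ← e1]; ring
  rw [h, e3, e4]
  ring

/-- A point `(w, η)` reducing to a special point `(w₁, η₁)` of the sextic. -/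
structure NearSpecial (v : AbsoluteValue Ω ℝ) (k a w η w₁ η₁ : Ω) : Prop where
  on : OnSextic k a w η
  on_special : OnSextic k a w₁ η₁
  ne_zero : η ≠ 0
  v_special : v w₁ = 1
  special : v η₁ = 1 ∨ η₁ = 0 ∧ (w₁ ^ 2 = a ^ 2 ∨ w₁ ^ 2 = a⁻¹ ^ 2)
  v_sub : v (w - w₁) < 1
  v_sub_eta : v (η - η₁) < 1
  ne : w ≠ w₁

variable (hv : IsNonarchimedean v) (hp : SexticParams v ε a k)

include hv

theorem NearSpecial.v_eq_one {w η w₁ η₁ : Ω} (h : NearSpecial v k a w η w₁ η₁) : v w = 1 :=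
  v_eq_one_of_sub hv h.v_special h.v_sub

omit hv in
theorem NearSpecial.v_eta_le {w η w₁ η₁ : Ω} (h : NearSpecial v k a w η w₁ η₁) : v η₁ ≤ 1 := by
  rcases h.special with h | ⟨h, -⟩
  · exact h.le
  · simp [h]

theorem NearSpecial.inv (ha : a ≠ 0) {w η w₁ η₁ : Ω} (h : NearSpecial v k a w η w₁ η₁) :
    NearSpecial v k a w⁻¹ (η / w ^ 3) w₁⁻¹ (η₁ / w₁ ^ 3) := by
  have hw := h.v_eq_one hv
  have hw0 := ne_zero_of_v_eq_one hw
  have hw₁0 := ne_zero_of_v_eq_one h.v_special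
  have m1 : w₁ ∈ intRing hv := h.v_special.le
  have m2 : w ∈ intRing hv := hw.le
  have m3 : η₁ ∈ intRing hv := h.v_eta_le
  refine ⟨h.on.inv ha hw0, h.on_special.inv ha hw₁0, div_ne_zero h.ne_zero (pow_ne_zero 3 hw0),
    by rw [map_inv₀, h.v_special, inv_one], ?_, ?_, ?_, fun e => h.ne (inv_injective e)⟩
  · rcases h.special with h1 | ⟨h1, h2⟩
    · left; rw [map_div₀, map_pow, h1, h.v_special, one_pow, div_one]
    · right
      refine ⟨by rw [h1, zero_div], ?_⟩
      rw [inv_pow, inv_pow]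
      rcases h2 with h2 | h2
      · right; rw [h2]
      · left; rw [h2, inv_pow, inv_inv]
  · rw [show w⁻¹ - w₁⁻¹ = -(w - w₁) / (w * w₁) by field_simp; ring, map_div₀, map_mul, hw,
      h.v_special, one_mul, div_one, AbsoluteValue.map_neg]
    exact h.v_sub
  · rw [show η / w ^ 3 - η₁ / w₁ ^ 3
      = ((η - η₁) * w₁ ^ 3 - η₁ * ((w - w₁) * (w ^ 2 + w * w₁ + w₁ ^ 2))) / (w ^ 3 * w₁ ^ 3) by
        field_simp; ring, map_div₀, map_mul, map_pow, map_pow, hw, h.v_special, one_pow, one_mul,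
      div_one]
    refine v_sub_lt_one hv (v_mul_lt_one hv h.v_sub_eta ?_)
      (v_mul_lt_one' hv m3 (v_mul_lt_one hv h.v_sub ?_)) <;>
    repeat' (first | assumption | apply add_mem | apply mul_mem | apply pow_mem)

include hp

omit hv in
theorem NearSpecial.equation {w η w₁ η₁ : Ω} (h : NearSpecial v k a w η w₁ η₁) :
    η ^ 2 = (k * (w ^ 2 + 1)) ^ 3 + -(ε * (1 + a ^ 2)) * (k * (w ^ 2 + 1)) ^ 2
      + ε ^ 2 * a ^ 2 * (k * (w ^ 2 + 1)) + 0 :=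
  h.on.equation (ne_zero_of_v_eq_one hp.v_a) hp.rel

omit hv in
theorem NearSpecial.equation_special {w η w₁ η₁ : Ω} (h : NearSpecial v k a w η w₁ η₁) :
    η₁ ^ 2 = (k * (w₁ ^ 2 + 1)) ^ 3 + -(ε * (1 + a ^ 2)) * (k * (w₁ ^ 2 + 1)) ^ 2
      + ε ^ 2 * a ^ 2 * (k * (w₁ ^ 2 + 1)) + 0 :=
  h.on_special.equation (ne_zero_of_v_eq_one hp.v_a) hp.rel

omit hv in
theorem NearSpecial.smooth {w η w₁ η₁ : Ω} (h : NearSpecial v k a w η w₁ η₁) :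
    v η₁ = 1 ∨ v (3 * (k * (w₁ ^ 2 + 1)) ^ 2 + 2 * -(ε * (1 + a ^ 2)) * (k * (w₁ ^ 2 + 1))
      + ε ^ 2 * a ^ 2) = 1 := by
  have ha := ne_zero_of_v_eq_one hp.v_a
  have hrel := hp.rel
  rcases h.special with h1 | ⟨-, h1 | h1⟩
  · exact .inl h1
  · right
    have e : k * (w₁ ^ 2 + 1) = ε * a ^ 2 := by rw [h1]; linear_combination hrel
    rw [e, show 3 * (ε * a ^ 2) ^ 2 + 2 * -(ε * (1 + a ^ 2)) * (ε * a ^ 2) + ε ^ 2 * a ^ 2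
      = -(ε ^ 2 * a ^ 2 * (1 - a ^ 2)) by ring, AbsoluteValue.map_neg, map_mul, map_mul, map_pow,
      map_pow, hp.v_eps, hp.v_a, hp.v_one_sub]
    norm_num
  · right
    have e : k * (w₁ ^ 2 + 1) = ε := by rw [h1]; field_simp; linear_combination hrel
    rw [e, show 3 * ε ^ 2 + 2 * -(ε * (1 + a ^ 2)) * ε + ε ^ 2 * a ^ 2
      = ε ^ 2 * (1 - a ^ 2) by ring, map_mul, map_pow, hp.v_eps, hp.v_one_sub]
    norm_num

theorem NearSpecial.v_sub_X {w η w₁ η₁ : Ω} (h : NearSpecial v k a w η w₁ η₁) :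
    v (k * (w ^ 2 + 1) - k * (w₁ ^ 2 + 1)) < 1 := by
  have m1 : w₁ ∈ intRing hv := h.v_special.le
  have m2 : w ∈ intRing hv := (h.v_eq_one hv).le
  have m3 : k ∈ intRing hv := hp.v_k.le
  rw [show k * (w ^ 2 + 1) - k * (w₁ ^ 2 + 1) = (w - w₁) * (k * (w + w₁)) by ring]
  exact v_mul_lt_one hv h.v_sub (mul_mem m3 (add_mem m2 m1))

theorem NearSpecial.X_ne (h3 : v 3 < 1) {w η w₁ η₁ : Ω} (h : NearSpecial v k a w η w₁ η₁) :
    k * (w ^ 2 + 1) ≠ k * (w₁ ^ 2 + 1) := by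
  have hs : v (w + w₁) = 1 := by
    refine v_eq_one_of_sub hv (y := 2 * w₁)
      (by rw [map_mul, v_two hv h3, h.v_special, one_mul]) ?_
    rw [show w + w₁ - 2 * w₁ = w - w₁ by ring]
    exact h.v_sub
  intro e
  have : k * ((w - w₁) * (w + w₁)) = 0 := by linear_combination e
  simp only [mul_eq_zero, sub_eq_zero, ne_zero_of_v_eq_one hp.v_k, h.ne,
    ne_zero_of_v_eq_one hs, or_self] at this

theorem NearSpecial.one_lt_slope (h3 : v 3 < 1) {w η w₁ η₁ : Ω}
    (h : NearSpecial v k a w η w₁ η₁) :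
    1 < v ((η + η₁) / (k * (w ^ 2 + 1) - k * (w₁ ^ 2 + 1))) := by
  have m1 : w₁ ∈ intRing hv := h.v_special.le
  have m3 : k ∈ intRing hv := hp.v_k.le
  have m4 : ε ∈ intRing hv := hp.v_eps.le
  have m5 : a ∈ intRing hv := hp.v_a.le
  refine CubicCurve.one_lt_slope hv ?_ h3 (h.equation hp) (h.equation_special hp) ?_
    (h.v_sub_X hv hp) h.v_sub_eta (h.X_ne hv hp h3) (h.smooth hp) <;>
  apply_rules [one_mem, neg_mem, add_mem, mul_mem, pow_mem]

variable [(cubicCurve (-(ε * (1 + a ^ 2))) (ε ^ 2 * a ^ 2) 0).IsElliptic] [DecidableEq Ω]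

theorem NearSpecial.inKernel (h3 : v 3 < 1) {w η w₁ η₁ : Ω}
    (h : NearSpecial v k a w η w₁ η₁) :
    InKernel v (pt (h.equation hp) - pt (h.equation_special hp)) := by
  have m1 : w₁ ∈ intRing hv := h.v_special.le
  have m3 : k ∈ intRing hv := hp.v_k.le
  have m4 : ε ∈ intRing hv := hp.v_eps.le
  have m5 : a ∈ intRing hv := hp.v_a.le
  refine inKernel_sub hv ?_ h3 (h.equation hp) (h.equation_special hp) ?_
    (h.v_sub_X hv hp) h.v_sub_eta (h.smooth hp) <;>
  apply_rules [one_mem, neg_mem, add_mem, mul_mem, pow_mem]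

/-- If the divisors attached to two nearly special points vanish for both elliptic quotients,
then the first coordinates of the points agree. -/
theorem NearSpecial.eq_of_sum_eq_zero (h3 : v 3 < 1) {w η w₁ η₁ w' η' w₂ η₂ : Ω}
    (h : NearSpecial v k a w η w₁ η₁) (h' : NearSpecial v k a w' η' w₂ η₂)
    (hsep : w₁ = w₂ ∨ v (w₂ - w₁) = 1)
    (hsum : (pt (h.equation hp) - pt (h.equation_special hp))
      + (pt (h'.equation hp) - pt (h'.equation_special hp)) = 0)
    (hsum_inv : (pt ((h.inv hv (ne_zero_of_v_eq_one hp.v_a)).equation hp)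
        - pt ((h.inv hv (ne_zero_of_v_eq_one hp.v_a)).equation_special hp))
      + (pt ((h'.inv hv (ne_zero_of_v_eq_one hp.v_a)).equation hp)
        - pt ((h'.inv hv (ne_zero_of_v_eq_one hp.v_a)).equation_special hp)) = 0) :
    w = w' := by
  have ha := ne_zero_of_v_eq_one hp.v_a
  have m3 : k ∈ intRing hv := hp.v_k.le
  have m4 : ε ∈ intRing hv := hp.v_eps.le
  have m5 : a ∈ intRing hv := hp.v_a.le
  have mA : -(ε * (1 + a ^ 2)) ∈ intRing hv := by
    apply_rules [one_mem, neg_mem, add_mem, mul_mem, pow_mem]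
  have mX : ∀ {z : Ω}, v z = 1 → k * (z ^ 2 + 1) ∈ intRing hv := fun hz =>
    mul_mem m3 (add_mem (pow_mem (hz.le : _ ∈ intRing hv) 2) (one_mem _))
  have slopes : ∀ {w η w₁ η₁ w' η' w₂ η₂ : Ω}
      (h : NearSpecial v k a w η w₁ η₁) (h' : NearSpecial v k a w' η' w₂ η₂),
      (pt (h.equation hp) - pt (h.equation_special hp))
      + (pt (h'.equation hp) - pt (h'.equation_special hp)) = 0 →
      v ((η + η₁) / (k * (w ^ 2 + 1) - k * (w₁ ^ 2 + 1))
        + (η' + η₂) / (k * (w' ^ 2 + 1) - k * (w₂ ^ 2 + 1))) < 1 := fun h h' hsum =>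
    v_slope_add_lt_one hv mA (mX (h.v_eq_one hv)) (mX h.v_special) (mX (h'.v_eq_one hv))
      (mX h'.v_special) h.v_eta_le h'.v_eta_le (h.X_ne hv hp h3) (h'.X_ne hv hp h3)
      (div_mul_cancel₀ _ (sub_ne_zero.2 (h.X_ne hv hp h3)))
      (div_mul_cancel₀ _ (sub_ne_zero.2 (h'.X_ne hv hp h3)))
      (h.one_lt_slope hv hp h3) (h'.one_lt_slope hv hp h3) hsum
  have s1 := slopes h h' hsum
  have s2 := slopes (h.inv hv ha) (h'.inv hv ha) hsum_inv
  have r1 := v_slope_relation hv h3 hp.v_k h.v_special h.v_eta_le h.v_sub h.v_sub_eta h.ne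
  have r2 := v_slope_relation hv h3 hp.v_k h'.v_special h'.v_eta_le h'.v_sub h'.v_sub_eta h'.ne
  have big := h'.one_lt_slope hv hp h3
  generalize (η + η₁) / (k * (w ^ 2 + 1) - k * (w₁ ^ 2 + 1)) = l at s1 r1
  generalize (η' + η₂) / (k * (w' ^ 2 + 1) - k * (w₂ ^ 2 + 1)) = l' at s1 r2 big
  generalize (η / w ^ 3 + η₁ / w₁ ^ 3) / (k * (w⁻¹ ^ 2 + 1) - k * (w₁⁻¹ ^ 2 + 1)) = m at s2 r1
  generalize (η' / w' ^ 3 + η₂ / w₂ ^ 3) / (k * (w'⁻¹ ^ 2 + 1) - k * (w₂⁻¹ ^ 2 + 1)) = m'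
    at s2 r2
  have q : ∀ {w η w₁ η₁ : Ω}, NearSpecial v k a w η w₁ η₁ → η₁ / (k * w₁) ∈ intRing hv :=
    fun h => by
      rw [mem_intRing, map_div₀, map_mul, hp.v_k, h.v_special, one_mul, div_one]
      exact h.v_eta_le
  have key : v ((w₂ - w₁) * l' - (η₁ / (k * w₁) + η₂ / (k * w₂))) < 1 := by
    have := v_sub_lt_one hv (v_sub_lt_one hv (v_add_lt_one hv r1 r2) s2)
      (v_mul_lt_one' hv (h.v_special.le : w₁ ∈ intRing hv) s1)
    rwa [show m + w₁ * l - η₁ / (k * w₁) + (m' + w₂ * l' - η₂ / (k * w₂)) - (m + m')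
      - w₁ * (l + l') = (w₂ - w₁) * l' - (η₁ / (k * w₁) + η₂ / (k * w₂)) by ring] at this
  have hw : w₁ = w₂ := by
    refine hsep.resolve_right fun hd => ?_
    have h1 := v_add_lt_one hv (x := ((w₂ - w₁) * l' - (η₁ / (k * w₁) + η₂ / (k * w₂))) / l')
      (y := (η₁ / (k * w₁) + η₂ / (k * w₂)) / l')
      (by rw [map_div₀]; exact (div_lt_one (by linarith)).2 (key.trans big))
      (by rw [map_div₀]; exact (div_lt_one (by linarith)).2
            ((add_mem (q h) (q h') : _ ∈ intRing hv).trans_lt big))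
    have hl' : l' ≠ 0 := by rintro rfl; simp at big; linarith
    rw [← add_div, sub_add_cancel, mul_div_cancel_right₀ _ hl', hd] at h1
    exact lt_irrefl _ h1
  subst hw
  have hη : η₁ = -η₂ := by
    have hsq : η₁ ^ 2 = η₂ ^ 2 := h.on_special.trans h'.on_special.symm
    refine (sq_eq_sq_iff_eq_or_eq_neg.1 hsq).elim (fun e => ?_) id
    subst e
    rw [sub_self, zero_mul, zero_sub, AbsoluteValue.map_neg, ← two_mul, map_mul, v_two hv h3,
      one_mul, map_div₀, map_mul, hp.v_k, h.v_special, one_mul, div_one] at key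
    rcases h.special with h1 | ⟨h1, -⟩
    · rw [h1] at key; exact absurd key (lt_irrefl _)
    · simp [h1]
  subst hη
  have cancel : ∀ {G : Type _} [AddCommGroup G] {P Q C D : G}, (P - C) + (Q - D) = 0 → C + D = 0 →
      P + Q = 0 := fun {G} _ {P Q C D} h1 h2 => by
    have e : P + Q = ((P - C) + (Q - D)) + (C + D) := by abel
    rw [e, h1, h2, add_zero]
  have t1 := cancel hsum (pt_add_eq_zero.2 ⟨rfl, rfl⟩)
  have t2 := cancel hsum_inv (pt_add_eq_zero.2 ⟨rfl, by ring⟩)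
  obtain ⟨e1, e2⟩ := pt_add_eq_zero.1 t1
  obtain ⟨-, e3⟩ := pt_add_eq_zero.1 t2
  have hk0 := ne_zero_of_v_eq_one hp.v_k
  have hw0 := ne_zero_of_v_eq_one (h.v_eq_one hv)
  have hw0' := ne_zero_of_v_eq_one (h'.v_eq_one hv)
  have f1 : w ^ 2 = w' ^ 2 := by
    have : k * (w ^ 2 - w' ^ 2) = 0 := by linear_combination e1
    exact sub_eq_zero.1 ((mul_eq_zero.1 this).resolve_left hk0)
  have f2 : w ^ 3 = w' ^ 3 := by
    rw [e2] at e3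
    have hη' := h'.ne_zero
    field_simp at e3
    exact (sub_eq_zero.1 (by linear_combination -e3)).symm
  have f3 : w' ^ 2 * (w - w') = 0 := by linear_combination f2 - w * f1
  exact sub_eq_zero.1 ((mul_eq_zero.1 f3).resolve_left (pow_ne_zero 2 hw0'))

end Sextic

section Galois

variable {Ω : Type*} [Field Ω] {v : AbsoluteValue Ω ℝ} {ε a k : Ω}
  (hv : IsNonarchimedean v) (hp : SexticParams v ε a k) (h3 : v 3 < 1)
  [(cubicCurve (-(ε * (1 + a ^ 2))) (ε ^ 2 * a ^ 2) 0).IsElliptic] [DecidableEq Ω]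
  {F : Type*} [Field F] [CharZero F] [DecidableEq F] [Algebra F Ω]
  (hunr : ∀ u : F, v (algebraMap F Ω u) < 1 → v (algebraMap F Ω u) ≤ v 3)
  (hfix : ∀ x : Ω, (∀ σ : Ω →ₐ[F] Ω, σ x = x) → x ∈ (algebraMap F Ω).range)
  {ε' a' : F} [(cubicCurve (-(ε' * (1 + a' ^ 2))) (ε' ^ 2 * a' ^ 2) 0).IsElliptic]
  [Finite (Pt (-(ε' * (1 + a' ^ 2))) (ε' ^ 2 * a' ^ 2) 0)]
  (hε : algebraMap F Ω ε' = ε) (ha : algebraMap F Ω a' = a)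

/-- The automorphism `σ` fixes or exchanges the two points. -/
def FixesOrSwaps (σ : Ω → Ω) (w η w' η' : Ω) : Prop :=
  (σ w = w ∧ σ η = η ∧ σ w' = w' ∧ σ η' = η') ∨ (σ w = w' ∧ σ η = η' ∧ σ w' = w ∧ σ η' = η)

include hunr hfix hε ha h3 hv in
theorem NearSpecial.sum_eq_zero {w η w₁ η₁ w' η' w₂ η₂ : Ω}
    (h : NearSpecial v k a w η w₁ η₁) (h' : NearSpecial v k a w' η' w₂ η₂)
    (hC : ∀ σ : Ω →ₐ[F] Ω, σ w₁ = w₁ ∧ σ η₁ = η₁ ∧ σ w₂ = w₂ ∧ σ η₂ = η₂)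
    (hσ : ∀ σ : Ω →ₐ[F] Ω, FixesOrSwaps σ w η w' η') :
    (pt (h.equation hp) - pt (h.equation_special hp))
      + (pt (h'.equation hp) - pt (h'.equation_special hp)) = 0 := by
  have mε : ε ∈ intRing hv := hp.v_eps.le
  have ma : a ∈ intRing hv := hp.v_a.le
  have h1a : 1 + a ^ 2 ≠ 0 := fun e => by
    have := hp.rel
    rw [e, mul_zero, eq_comm] at this
    exact mul_ne_zero (ne_zero_of_v_eq_one hp.v_eps)
      (pow_ne_zero 2 (ne_zero_of_v_eq_one hp.v_a)) this
  have hε' : ∀ σ : Ω →ₐ[F] Ω, σ ε = ε := fun σ => by rw [← hε]; exact σ.commutes _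
  have ha' : ∀ σ : Ω →ₐ[F] Ω, σ a = a := fun σ => by rw [← ha]; exact σ.commutes _
  have hk : ∀ σ : Ω →ₐ[F] Ω, σ k = k := fun σ => by
    have := congrArg σ hp.rel
    simp only [map_mul, map_add, map_pow, map_one, hε', ha'] at this
    exact mul_right_cancel₀ h1a (this.trans hp.rel.symm)
  refine InKernel.eq_zero_of_fixed (F := F) hv h3 hunr hfix
    (a' := -(ε' * (1 + a' ^ 2))) (b' := ε' ^ 2 * a' ^ 2) (c' := 0)
    (by simp [hε, ha]) (by simp [hε, ha]) (by simp)
    (by apply_rules [one_mem, neg_mem, add_mem, mul_mem, pow_mem])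
    (by apply_rules [mul_mem, pow_mem]) (zero_mem _)
    (InKernel.add hv (by apply_rules [one_mem, neg_mem, add_mem, mul_mem, pow_mem])
      (by apply_rules [mul_mem, pow_mem]) (zero_mem _) h3
      (h.inKernel hv hp h3) (h'.inKernel hv hp h3)) fun σ => ?_
  simp only [mapPt_add, mapPt_sub, mapPt_pt]
  obtain ⟨c1, c2, c3, c4⟩ := hC σ
  have move : ∀ {x y x' y' z w : Ω} {e : y ^ 2 = x ^ 3 + -(ε * (1 + a ^ 2)) * x ^ 2
      + ε ^ 2 * a ^ 2 * x + 0} {e' : y' ^ 2 = x' ^ 3 + -(ε * (1 + a ^ 2)) * x' ^ 2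
      + ε ^ 2 * a ^ 2 * x' + 0}, x = σ (k * (z ^ 2 + 1)) → x' = k * (w ^ 2 + 1) → y = y' →
      σ z = w → (pt e : Pt (-(ε * (1 + a ^ 2))) (ε ^ 2 * a ^ 2) 0) = pt e' :=
    fun h1 h2 h3 h4 => by
      rw [pt_inj]
      refine ⟨?_, h3⟩
      rw [h1, h2, ← h4, map_mul, map_add, map_pow, map_one, hk]
  rcases hσ σ with ⟨e1, e2, e3, e4⟩ | ⟨e1, e2, e3, e4⟩
  · congr 1 <;> congr 1
    exacts [move rfl rfl e2 e1, move rfl rfl c2 c1, move rfl rfl e4 e3, move rfl rfl c4 c3]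
  · rw [show (pt (h.equation hp) - pt (h.equation_special hp))
      + (pt (h'.equation hp) - pt (h'.equation_special hp)) =
      (pt (h'.equation hp) - pt (h.equation_special hp))
      + (pt (h.equation hp) - pt (h'.equation_special hp)) by abel]
    congr 1 <;> congr 1
    exacts [move rfl rfl e2 e1, move rfl rfl c2 c1, move rfl rfl e4 e3, move rfl rfl c4 c3]

include hp hunr hfix hε ha h3 hv in
/-- Two nearly special points which are exchanged by Galois have the same first coordinate. -/
theorem NearSpecial.eq_of_galois {w η w₁ η₁ w' η' w₂ η₂ : Ω}
    (h : NearSpecial v k a w η w₁ η₁) (h' : NearSpecial v k a w' η' w₂ η₂)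
    (hsep : w₁ = w₂ ∨ v (w₂ - w₁) = 1)
    (hC : ∀ σ : Ω →ₐ[F] Ω, σ w₁ = w₁ ∧ σ η₁ = η₁ ∧ σ w₂ = w₂ ∧ σ η₂ = η₂)
    (hσ : ∀ σ : Ω →ₐ[F] Ω, FixesOrSwaps σ w η w' η') : w = w' := by
  have ha0 := ne_zero_of_v_eq_one hp.v_a
  refine h.eq_of_sum_eq_zero hv hp h3 h' hsep
    (h.sum_eq_zero hv hp h3 hunr hfix hε ha h' hC hσ)
    ((h.inv hv ha0).sum_eq_zero hv hp h3 hunr hfix hε ha (h'.inv hv ha0) (fun σ => ?_)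
      fun σ => ?_)
  · obtain ⟨c1, c2, c3, c4⟩ := hC σ
    simp only [map_inv₀, map_div₀, map_pow, c1, c2, c3, c4, and_self]
  · rcases hσ σ with ⟨e1, e2, e3, e4⟩ | ⟨e1, e2, e3, e4⟩
    · left; simp only [map_inv₀, map_div₀, map_pow, e1, e2, e3, e4, and_self]
    · right; simp only [map_inv₀, map_div₀, map_pow, e1, e2, e3, e4, and_self]

end Galois

section Special

variable {Ω : Type*} [Field Ω] {v : AbsoluteValue Ω ℝ} {ε a k : Ω}

/-- Parameters `a = tan α` and `ε = tan 2α` with `ε² = 2 ε + 1`. -/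
structure TanParams (v : AbsoluteValue Ω ℝ) (ε a k : Ω) : Prop extends SexticParams v ε a k where
  tan_rel : ε * (1 - a ^ 2) = 2 * a
  eps_rel : ε ^ 2 = 2 * ε + 1
  v_one_add : v (1 + a ^ 2) = 1
  v_eps_sub : v (1 - ε) = 1
  v_eps_add : v (1 + ε) = 1
  v_two : v 2 = 1

/-- The values of `w` at the special points. -/
def IsSpecialValue (a w : Ω) : Prop :=
  w = a ∨ w = -a ∨ w = a⁻¹ ∨ w = -a⁻¹ ∨ w = (1 - a) / (1 + a) ∨ w = -((1 + a) / (1 - a))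

variable (hv : IsNonarchimedean v) (hp : TanParams v ε a k)

include hp

theorem TanParams.a_ne_zero : a ≠ 0 := ne_zero_of_v_eq_one hp.v_a

theorem TanParams.eps_ne_zero : ε ≠ 0 := ne_zero_of_v_eq_one hp.v_eps

include hv in
theorem TanParams.v_one_add_a : v (1 + a) = 1 ∧ v (1 - a) = 1 := by
  have ma : a ∈ intRing hv := hp.v_a.le
  have h1 : v (1 + a) ≤ 1 := add_mem (one_mem _) ma
  have h2 : v (1 - a) ≤ 1 := sub_mem (one_mem _) ma
  have e : v (1 + a) * v (1 - a) = 1 := by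
    rw [← map_mul, ← hp.v_one_sub]; congr 1; ring
  constructor <;> nlinarith [v.nonneg (1 + a), v.nonneg (1 - a)]

include hv in
theorem IsSpecialValue.separated {w w' : Ω} (h : IsSpecialValue a w) (h' : IsSpecialValue a w') :
    w = w' ∨ v (w' - w) = 1 := by
  obtain ⟨u1, u2⟩ := hp.v_one_add_a hv
  have ha := hp.a_ne_zero
  have n1 := ne_zero_of_v_eq_one u1
  have n2 := ne_zero_of_v_eq_one u2
  have hε := hp.eps_ne_zero
  have v2 := hp.v_two
  have vt1 : v (1 - 2 * a - a ^ 2) = 1 := by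
    rw [show 1 - 2 * a - a ^ 2 = 2 * a * (1 - ε) / ε by
      field_simp; linear_combination hp.tan_rel]
    simp [hp.v_a, hp.v_eps, hp.v_eps_sub, v2]
  have vt2 : v (1 + 2 * a - a ^ 2) = 1 := by
    rw [show 1 + 2 * a - a ^ 2 = 2 * a * (1 + ε) / ε by
      field_simp; linear_combination hp.tan_rel]
    simp [hp.v_a, hp.v_eps, hp.v_eps_add, v2]
  have quot : ∀ {z d u : Ω}, v d = 1 → v u = 1 → z * d = u → v z = 1 := fun {z d u} hd hu e => by
    rw [← e, map_mul, hd, mul_one] at hu; exact hu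
  have va := hp.v_a
  have v4 := hp.v_one_add
  have v5 := hp.v_one_sub
  have mul1 : ∀ {s t : Ω}, v s = 1 → v t = 1 → v (s * t) = 1 := fun hs ht => by
    rw [map_mul, hs, ht, one_mul]
  have neg1 : ∀ {s : Ω}, v s = 1 → v (-s) = 1 := fun hs => by rwa [AbsoluteValue.map_neg]
  have d1 : v (-a - a) = 1 := quot (d := 1) (by simp) (neg1 (mul1 v2 va)) (by ring)
  have d2 : v (a⁻¹ - a) = 1 := quot va v5 (by field_simp)
  have d3 : v (-a⁻¹ - a) = 1 := quot va (neg1 v4) (by field_simp; ring)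
  have d4 : v ((1 - a) / (1 + a) - a) = 1 := quot u1 vt1 (by field_simp; ring)
  have d5 : v (-((1 + a) / (1 - a)) - a) = 1 := quot u2 (neg1 vt2) (by field_simp; ring)
  have d6 : v (a⁻¹ - -a) = 1 := quot va v4 (by field_simp; ring)
  have d7 : v (-a⁻¹ - -a) = 1 := quot va (neg1 v5) (by field_simp; ring)
  have d8 : v ((1 - a) / (1 + a) - -a) = 1 := quot u1 v4 (by field_simp; ring)
  have d9 : v (-((1 + a) / (1 - a)) - -a) = 1 := quot u2 (neg1 v4) (by field_simp; ring)
  have d10 : v (-a⁻¹ - a⁻¹) = 1 := quot va (neg1 v2) (by field_simp; ring)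
  have d11 : v ((1 - a) / (1 + a) - a⁻¹) = 1 := quot (mul1 va u1) (neg1 v4) (by field_simp; ring)
  have d12 : v (-((1 + a) / (1 - a)) - a⁻¹) = 1 :=
    quot (mul1 va u2) (neg1 v4) (by field_simp; ring)
  have d13 : v ((1 - a) / (1 + a) - -a⁻¹) = 1 := quot (mul1 va u1) vt2 (by field_simp; ring)
  have d14 : v (-((1 + a) / (1 - a)) - -a⁻¹) = 1 :=
    quot (mul1 va u2) vt1 (by field_simp; ring)
  have d15 : v (-((1 + a) / (1 - a)) - (1 - a) / (1 + a)) = 1 :=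
    quot (mul1 u1 u2) (neg1 (mul1 v2 v4)) (by field_simp; ring)
  rcases h with rfl | rfl | rfl | rfl | rfl | rfl <;>
  rcases h' with rfl | rfl | rfl | rfl | rfl | rfl <;>
  first
  | exact .inl rfl
  | (right; assumption)
  | (right; rw [v.map_sub]; assumption)

end Special

section Special

variable {Ω : Type*} [Field Ω] {v : AbsoluteValue Ω ℝ} {ε a k : Ω}
  (hv : IsNonarchimedean v) (hp : TanParams v ε a k)

include hp in
theorem TanParams.onSextic {x y : Ω} (hy : y ^ 2 = -x * (x ^ 2 + 1) * (x ^ 2 - 2 * x - 1))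
    (hx : 1 + a * x ≠ 0) :
    OnSextic k a ((x - a) / (1 + a * x)) (2 * ε * a ^ 3 * y / (1 + a * x) ^ 3) := by
  have ha := hp.a_ne_zero
  obtain ⟨d, hd⟩ : ∃ d, d = 1 + a * x := ⟨_, rfl⟩
  rw [← hd] at hx ⊢
  have f1 : ((x - a) / d) ^ 2 + 1 = (1 + a ^ 2) * (1 + x ^ 2) / d ^ 2 := by
    field_simp; rw [hd]; ring
  have f2 : ((x - a) / d) ^ 2 - a ^ 2
      = (1 - a ^ 2) * (x - ε) * (x * (1 + a ^ 2)) / d ^ 2 := by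
    field_simp; rw [hd]; linear_combination x * (1 + a ^ 2) * hp.tan_rel
  have f3 : ((x - a) / d) ^ 2 - a⁻¹ ^ 2
      = -((1 + a ^ 2) * (1 - a ^ 2) * (1 + ε * x)) / (a ^ 2 * d ^ 2) := by
    field_simp; rw [hd]; linear_combination (1 + a ^ 2) * x * hp.tan_rel
  have f4 : (x - ε) * (1 + ε * x) = ε * (x ^ 2 - 2 * x - 1) := by
    linear_combination -x * hp.eps_rel
  have f5 : k ^ 3 * (1 + a ^ 2) ^ 3 = ε ^ 3 * a ^ 6 := by
    rw [← mul_pow, hp.rel]; ring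
  have f6 : ε ^ 2 * (1 - a ^ 2) ^ 2 = 4 * a ^ 2 := by
    rw [← mul_pow, hp.tan_rel]; ring
  unfold OnSextic
  rw [f1, f2, f3]
  field_simp
  rw [hy]
  have e : k ^ 3 * (1 + a ^ 2) ^ 3 * (1 - a ^ 2) ^ 2 * (1 + x ^ 2) * x * ((x - ε) * (1 + ε * x))
      = 4 * ε ^ 2 * a ^ 8 * (1 + x ^ 2) * x * (x ^ 2 - 2 * x - 1) := by
    rw [f4, f5]
    linear_combination ε ^ 2 * a ^ 6 * (1 + x ^ 2) * x * (x ^ 2 - 2 * x - 1) * f6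
  linear_combination e

include hv in
theorem OnSextic.congruence (ha : v a = 1) (hk : v k = 1) {w η w₁ η₁ : Ω}
    (h : OnSextic k a w η) (h₁ : OnSextic k a w₁ η₁) (hw₁ : v w₁ = 1) (hw : v (w - w₁) < 1) :
    v (η - η₁) < 1 ∨ v (η - -η₁) < 1 := by
  have m1 : w₁ ∈ intRing hv := hw₁.le
  have m2 : w ∈ intRing hv := (v_eq_one_of_sub hv hw₁ hw).le
  have m3 : a ∈ intRing hv := ha.le
  have m4 : a⁻¹ ∈ intRing hv := by rw [mem_intRing, map_inv₀, ha, inv_one]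
  have m5 : k ∈ intRing hv := hk.le
  have haa : a * a⁻¹ = 1 := mul_inv_cancel₀ (ne_zero_of_v_eq_one ha)
  unfold OnSextic at h h₁
  have key : v ((η - η₁) * (η - -η₁)) < 1 := by
    rw [show (η - η₁) * (η - -η₁) = (w - w₁) * ((w + w₁) * (k ^ 3 * (w ^ 4 + w ^ 2 * w₁ ^ 2
      + w₁ ^ 4 + (1 - a ^ 2 - a⁻¹ ^ 2) * (w ^ 2 + w₁ ^ 2 + 1)
      + (a ^ 2 * a⁻¹ ^ 2 - 1)))) by
        linear_combination h - h₁]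
    refine v_mul_lt_one hv hw ?_
    apply_rules [one_mem, sub_mem, add_mem, mul_mem, pow_mem]
  by_contra! hc
  rw [map_mul] at key
  nlinarith [hc.1, hc.2]

/-- A point of the quintic whose reduction is one of the obvious points is close to one of the
special points of the sextic. -/
def HasSpecialReduction (v : AbsoluteValue Ω ℝ) (ε a k x y : Ω) : Prop :=
  1 + a * x ≠ 0 ∧ ∃ w₁ η₁, IsSpecialValue a w₁ ∧
    (∀ τ : Ω →+* Ω, τ a = a → τ ε = ε → τ w₁ = w₁ ∧ τ η₁ = η₁) ∧
    NearSpecial v k a ((x - a) / (1 + a * x)) (2 * ε * a ^ 3 * y / (1 + a * x) ^ 3) w₁ η₁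

include hp hv in
theorem TanParams.hasSpecialReduction {x y : Ω}
    (hy : y ^ 2 = -x * (x ^ 2 + 1) * (x ^ 2 - 2 * x - 1)) (hy0 : y ≠ 0) (hx1 : x ≠ 1)
    (hx2 : x ≠ -1)
    (hred : 1 < v x ∨ v x < 1 ∨ v (x - 1) < 1 ∨ v (x + 1) < 1 ∨ v (x ^ 2 - 2 * x - 1) < 1) :
    HasSpecialReduction v ε a k x y := by
  have ha := hp.a_ne_zero
  have hε := hp.eps_ne_zero
  obtain ⟨u1, u2⟩ := hp.v_one_add_a hv
  have n1 := ne_zero_of_v_eq_one u1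
  have n2 := ne_zero_of_v_eq_one u2
  have n3 := ne_zero_of_v_eq_one hp.v_one_add
  have n4 := ne_zero_of_v_eq_one hp.v_two
  have ma : a ∈ intRing hv := hp.v_a.le
  have hinv : ∀ {z : Ω}, v z = 1 → v z⁻¹ = 1 := fun hz => by rw [map_inv₀, hz, inv_one]
  have finish : ∀ w₁ η₁ : Ω, 1 + a * x ≠ 0 → IsSpecialValue a w₁ → OnSextic k a w₁ η₁ →
      v w₁ = 1 → (v η₁ = 1 ∨ η₁ = 0 ∧ (w₁ ^ 2 = a ^ 2 ∨ w₁ ^ 2 = a⁻¹ ^ 2)) →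
      v ((x - a) / (1 + a * x) - w₁) < 1 → (x - a) / (1 + a * x) ≠ w₁ →
      (∀ τ : Ω →+* Ω, τ a = a → τ ε = ε → τ w₁ = w₁ ∧ τ η₁ = η₁) →
      HasSpecialReduction v ε a k x y := by
    intro w₁ η₁ hd hs hon hv1 hsp hsub hne hτ
    have h := hp.onSextic hy hd
    have h0 : 2 * ε * a ^ 3 * y / (1 + a * x) ^ 3 ≠ 0 :=
      div_ne_zero (mul_ne_zero (mul_ne_zero (mul_ne_zero n4 hε) (pow_ne_zero 3 ha)) hy0)
        (pow_ne_zero 3 hd)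
    refine ⟨hd, ?_⟩
    rcases h.congruence hv hp.v_a hp.v_k hon hv1 hsub with h1 | h1
    · exact ⟨w₁, η₁, hs, hτ, h, hon, h0, hv1, hsp, hsub, h1, hne⟩
    · refine ⟨w₁, -η₁, hs, fun τ t1 t2 => ⟨(hτ τ t1 t2).1, ?_⟩, h, ?_, h0, hv1, ?_, hsub, h1, hne⟩
      · rw [map_neg, (hτ τ t1 t2).2]
      · unfold OnSextic at *; rw [neg_sq]; exact hon
      · rw [AbsoluteValue.map_neg, neg_eq_zero]; exact hsp
  have near : ∀ x₀ : Ω, v (1 + a * x₀) = 1 → v (x - x₀) < 1 → x ≠ x₀ → 1 + a * x ≠ 0 ∧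
      v ((x - a) / (1 + a * x) - (x₀ - a) / (1 + a * x₀)) < 1 ∧
      (x - a) / (1 + a * x) ≠ (x₀ - a) / (1 + a * x₀) := by
    intro x₀ hx₀ hx hne
    have hd : v (1 + a * x) = 1 := by
      refine v_eq_one_of_sub hv hx₀ ?_
      rw [show 1 + a * x - (1 + a * x₀) = a * (x - x₀) by ring]
      exact v_mul_lt_one' hv ma hx
    have d1 := ne_zero_of_v_eq_one hd
    have d2 := ne_zero_of_v_eq_one hx₀
    have e : (x - a) / (1 + a * x) - (x₀ - a) / (1 + a * x₀)
        = (1 + a ^ 2) * (x - x₀) / ((1 + a * x) * (1 + a * x₀)) := by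
      rw [div_sub_div _ _ d1 d2]; congr 1; ring
    refine ⟨d1, ?_, ?_⟩
    · rw [e, map_div₀, map_mul, map_mul, hd, hx₀, hp.v_one_add, one_mul, one_mul, div_one]
      exact hx
    · rw [← sub_ne_zero, e]
      exact div_ne_zero (mul_ne_zero n3 (sub_ne_zero.2 hne)) (mul_ne_zero d1 d2)
  have on0 : ∀ {w : Ω}, w ^ 2 = a ^ 2 ∨ w ^ 2 = a⁻¹ ^ 2 → OnSextic k a w 0 := fun hw => by
    unfold OnSextic
    rcases hw with h | h <;> rw [h] <;> ring
  have hx0 : x ≠ 0 := by rintro rfl; apply hy0; simpa using hy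
  have hfac : x ^ 2 - 2 * x - 1 = (x - ε) * (x - (2 - ε)) := by
    linear_combination hp.eps_rel
  have hxε : x ≠ ε := by
    rintro rfl
    rw [hfac, sub_self, zero_mul, mul_zero] at hy
    exact hy0 (pow_eq_zero_iff two_ne_zero |>.1 hy)
  have hxε' : x ≠ 2 - ε := fun e => by
    rw [hfac, sub_eq_zero.2 e, mul_zero, mul_zero] at hy
    exact hy0 (pow_eq_zero_iff two_ne_zero |>.1 hy)
  rcases hred with h | h | h | h | h
  · have hax : v (1 + a * x) = v x := by
      rw [add_comm, v_add_eq hv] <;> rw [map_mul, hp.v_a, one_mul]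
      rwa [map_one]
    have d1 : 1 + a * x ≠ 0 := by rw [← v.ne_zero_iff, hax]; linarith
    have e : (x - a) / (1 + a * x) - a⁻¹ = -(1 + a ^ 2) / (a * (1 + a * x)) := by
      rw [inv_eq_one_div, div_sub_div _ _ d1 ha]; congr 1 <;> ring
    refine finish a⁻¹ 0 d1 (.inr (.inr (.inl rfl))) (on0 (.inr rfl)) (hinv hp.v_a)
      (.inr ⟨rfl, .inr rfl⟩) ?_ ?_ fun τ t1 _ => ⟨by rw [map_inv₀, t1], map_zero τ⟩
    · rw [e, map_div₀, AbsoluteValue.map_neg, map_mul, hp.v_one_add, hp.v_a, hax, one_mul,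
        div_lt_one (by linarith)]
      exact h
    · rw [← sub_ne_zero, e]
      exact div_ne_zero (neg_ne_zero.2 n3) (mul_ne_zero ha d1)
  · obtain ⟨d, c1, c2⟩ := near 0 (by simp) (by simpa using h) hx0
    have e : (0 - a) / (1 + a * 0) = -a := by simp
    rw [e] at c1 c2
    exact finish (-a) 0 d (.inr (.inl rfl)) (on0 (.inl (by ring)))
      (by rw [AbsoluteValue.map_neg, hp.v_a]) (.inr ⟨rfl, .inl (by ring)⟩) c1 c2
      fun τ t1 _ => ⟨by rw [map_neg, t1], map_zero τ⟩
  · obtain ⟨d, c1, c2⟩ := near 1 (by rwa [mul_one]) h hx1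
    rw [mul_one] at c1 c2
    have hon := hp.onSextic (x := 1) (y := 2) (by norm_num) (by rwa [mul_one])
    rw [mul_one] at hon
    refine finish _ _ d (.inr (.inr (.inr (.inr (.inl rfl))))) hon
      (by rw [map_div₀, u1, u2, div_one]) (.inl ?_) c1 c2 fun τ t1 t2 => ?_
    · simp only [map_div₀, map_mul, map_pow, hp.v_two, hp.v_eps, hp.v_a, u1]; norm_num
    · simp only [map_div₀, map_mul, map_pow, map_add, map_sub, map_one, map_ofNat, t1, t2,
        and_self]
  · obtain ⟨d, c1, c2⟩ := near (-1) (by rwa [mul_neg_one, ← sub_eq_add_neg])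
      (by rwa [sub_neg_eq_add]) hx2
    have hon := hp.onSextic (x := -1) (y := 2) (by norm_num)
      (by rwa [mul_neg_one, ← sub_eq_add_neg])
    have e : (-1 - a) / (1 + a * -1) = -((1 + a) / (1 - a)) := by
      rw [mul_neg_one, ← sub_eq_add_neg, ← neg_div]; congr 1; ring
    rw [e] at c1 c2 hon
    rw [mul_neg_one, ← sub_eq_add_neg] at hon
    refine finish _ _ d (.inr (.inr (.inr (.inr (.inr rfl))))) hon
      (by rw [AbsoluteValue.map_neg, map_div₀, u1, u2, div_one]) (.inl ?_) c1 c2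
      fun τ t1 t2 => ?_
    · simp only [map_div₀, map_mul, map_pow, hp.v_two, hp.v_eps, hp.v_a, u2]; norm_num
    · simp only [map_div₀, map_mul, map_pow, map_add, map_sub, map_neg, map_one, map_ofNat, t1,
        t2, and_self]
  · have hcase : v (x - ε) < 1 ∨ v (x - (2 - ε)) < 1 := by
      rw [hfac, map_mul] at h
      by_contra! hc
      nlinarith [hc.1, hc.2]
    rcases hcase with h | h
    · have e1 : (1 + a * ε) * (1 - a ^ 2) = 1 + a ^ 2 := by linear_combination a * hp.tan_rel
      have d1 : v (1 + a * ε) = 1 := by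
        have := congrArg v e1
        rwa [map_mul, hp.v_one_sub, hp.v_one_add, mul_one] at this
      obtain ⟨d, c1, c2⟩ := near ε d1 h hxε
      have e : (ε - a) / (1 + a * ε) = a := by
        rw [div_eq_iff (ne_zero_of_v_eq_one d1)]; linear_combination hp.tan_rel
      rw [e] at c1 c2
      exact finish a 0 d (.inl rfl) (on0 (.inl rfl)) hp.v_a (.inr ⟨rfl, .inl rfl⟩) c1 c2
        fun τ t1 _ => ⟨t1, map_zero τ⟩
    · have e0 : 2 * a * ε + a ^ 2 - 4 * a - 1 = 0 := by
        linear_combination -(ε - 2) * hp.tan_rel + (1 - a ^ 2) * hp.eps_rel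
      have e1 : 2 * (1 + a * (2 - ε)) = 1 + a ^ 2 := by linear_combination -e0
      have d1 : v (1 + a * (2 - ε)) = 1 := by
        have := congrArg v e1
        rwa [map_mul, hp.v_two, hp.v_one_add, one_mul] at this
      obtain ⟨d, c1, c2⟩ := near (2 - ε) d1 h hxε'
      have e : (2 - ε - a) / (1 + a * (2 - ε)) = -a⁻¹ := by
        rw [div_eq_iff (ne_zero_of_v_eq_one d1)]; field_simp; linear_combination -e0
      rw [e] at c1 c2
      exact finish (-a⁻¹) 0 d (.inr (.inr (.inr (.inl rfl)))) (on0 (.inr (by ring)))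
        (by rw [AbsoluteValue.map_neg, hinv hp.v_a]) (.inr ⟨rfl, .inr (by ring)⟩) c1 c2
        fun τ t1 _ => ⟨by rw [map_neg, map_inv₀, t1], map_zero τ⟩

end Special

section Reduction

variable {Ω : Type*} [Field Ω] {v : AbsoluteValue Ω ℝ}

/-- `z` is a root of a nonzero rational polynomial of degree at most two. -/
def IsQuadratic (z : Ω) : Prop :=
  ∃ a b c : ℚ, (a ≠ 0 ∨ b ≠ 0 ∨ c ≠ 0) ∧ (a : Ω) * z ^ 2 + b * z + c = 0

theorem mem_intRing_of_sq (hv : IsNonarchimedean v) {z : Ω} (hz : z ^ 2 ∈ intRing hv) :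
    z ∈ intRing hv := by
  rw [mem_intRing, map_pow] at hz
  rw [mem_intRing]
  by_contra! h
  nlinarith

theorem neg_one_ne_one_of_charThree {k : Type*} [Field k] [CharP k 3] : (-1 : k) ≠ 1 := by
  intro h
  have h3 : (3 : k) = 0 := by exact_mod_cast CharP.cast_eq_zero k 3
  exact one_ne_zero (by linear_combination h3 + h : (1 : k) = 0)

theorem not_pow_eight_eq_neg_one {k : Type*} [Field k] [CharP k 3] {z : k} (h9 : z ^ 9 = z)
    (h8 : z ^ 8 = -1) : False := by
  have hz : z ≠ 0 := by rintro rfl; simp at h8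
  apply neg_one_ne_one_of_charThree (k := k)
  rw [← h8]
  exact mul_right_cancel₀ hz (by linear_combination h9)

theorem special_reduction_charThree {k : Type*} [Field k] [CharP k 3] {x y s : k}
    (hx9 : x ^ 9 = x) (hy9 : y ^ 9 = y) (hs9 : s ^ 9 = s)
    (hy : y ^ 2 = -x * (x ^ 2 + 1) * (x ^ 2 - 2 * x - 1))
    (hs : s ^ 2 * ((x ^ 2 - 1) ^ 2 * x) = -((x ^ 2 - 1) ^ 3 + 4 * x * (x ^ 2 - 1) ^ 2 - 16 * x ^ 3)) :
    x = 0 ∨ x - 1 = 0 ∨ x + 1 = 0 ∨ x ^ 2 - 2 * x - 1 = 0 := by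
  have h3 : (3 : k) = 0 := by exact_mod_cast CharP.cast_eq_zero k 3
  have hfac : x * ((x - 1) * ((x + 1) * ((x ^ 2 - 2 * x - 1) * ((x ^ 2 + 1) * (x ^ 2 - x - 1)))))
      = 0 := by
    linear_combination hx9 + (-x^2*(x-1)*(x+1)*(x^2+1)*(x^2-x-1)
      - x^3*(x^2-1)*(x^2+1)) * h3
  rcases mul_eq_zero.1 hfac with h | h
  · exact .inl h
  rcases mul_eq_zero.1 h with h | h
  · exact .inr (.inl h)
  rcases mul_eq_zero.1 h with h | h
  · exact .inr (.inr (.inl h))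
  rcases mul_eq_zero.1 h with h | h
  · exact .inr (.inr (.inr h))
  exfalso
  rcases mul_eq_zero.1 h with h | h
  · have hx2 : x ^ 2 = -1 := by linear_combination h
    have hs2 : s ^ 2 = 1 + x := by
      have hs' : s ^ 2 * 4 * x = 8 - 32 * x := by
        have e3 : x ^ 3 = -x := by linear_combination x * hx2
        rw [e3, hx2] at hs
        linear_combination hs
      linear_combination (-x) * hs' + (4 * s ^ 2 + 32) * hx2 - (s ^ 2 + 11 + 3 * x) * h3
    apply not_pow_eight_eq_neg_one hs9
    rw [show s ^ 8 = (s ^ 2) ^ 4 by ring, hs2]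
    linear_combination (x ^ 2 + 4 * x + 5) * h - h3
  · have hy2 : y ^ 2 = x := by
      rw [hy]; linear_combination (3 + x ^ 2 - x ^ 3) * h + (1 + x) * h3
    apply not_pow_eight_eq_neg_one hy9
    rw [show y ^ 8 = (y ^ 2) ^ 4 by ring, hy2]
    linear_combination (2 + x + x ^ 2) * h + (1 + x) * h3

theorem reduction_cases [CharZero Ω] (hv : IsNonarchimedean v) (h3 : v 3 < 1) {x y s : Ω}
    (hxq : IsQuadratic x) (hyq : IsQuadratic y) (hsq : IsQuadratic s)
    (hy : y ^ 2 = -x * (x ^ 2 + 1) * (x ^ 2 - 2 * x - 1))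
    (hs : s ^ 2 * ((x ^ 2 - 1) ^ 2 * x)
      = -((x ^ 2 - 1) ^ 3 + 4 * x * (x ^ 2 - 1) ^ 2 - 16 * x ^ 3)) :
    1 < v x ∨ v x < 1 ∨ v (x - 1) < 1 ∨ v (x + 1) < 1 ∨ v (x ^ 2 - 2 * x - 1) < 1 := by
  by_contra! hc
  obtain ⟨c1, c2, c3, c4, c5⟩ := hc
  have mx : x ∈ intRing hv := c1
  have m2 : (2 : Ω) ∈ intRing hv := ofNat_mem _ 2
  have m4 : (4 : Ω) ∈ intRing hv := ofNat_mem _ 4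
  have m16 : (16 : Ω) ∈ intRing hv := ofNat_mem _ 16
  have my : y ∈ intRing hv := mem_intRing_of_sq hv (by
    rw [hy]; apply_rules [one_mem, neg_mem, sub_mem, add_mem, mul_mem, pow_mem])
  have ms : s ∈ intRing hv := mem_intRing_of_sq hv (by
    have e : s ^ 2 * ((x ^ 2 - 1) ^ 2 * x) ∈ intRing hv := by
      rw [hs]; apply_rules [one_mem, neg_mem, sub_mem, add_mem, mul_mem, pow_mem]
    rw [mem_intRing, map_mul] at e
    rw [mem_intRing]
    have hu : 1 ≤ v ((x ^ 2 - 1) ^ 2 * x) := by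
      rw [show (x ^ 2 - 1) ^ 2 * x = ((x - 1) * (x + 1)) ^ 2 * x by ring, map_mul, map_pow, map_mul]
      exact one_le_mul_of_one_le_of_one_le (one_le_pow₀ (one_le_mul_of_one_le_of_one_le c3 c4)) c2
    nlinarith [v.nonneg (s ^ 2)])
  obtain ⟨k, _, _, red, hred⟩ := exists_residueField hv h3
  obtain ⟨a, b, c, h0, hq⟩ := hxq
  have x9 := quadratic_residue hv hred (z := ⟨x, mx⟩) h0 hq
  obtain ⟨a, b, c, h0, hq⟩ := hyq
  have y9 := quadratic_residue hv hred (z := ⟨y, my⟩) h0 hq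
  obtain ⟨a, b, c, h0, hq⟩ := hsq
  have s9 := quadratic_residue hv hred (z := ⟨s, ms⟩) h0 hq
  generalize hX : (⟨x, mx⟩ : intRing hv) = X at *
  generalize hY : (⟨y, my⟩ : intRing hv) = Y at *
  generalize hS : (⟨s, ms⟩ : intRing hv) = S at *
  have vX : (X : Ω) = x := by rw [← hX]
  have vY : (Y : Ω) = y := by rw [← hY]
  have vS : (S : Ω) = s := by rw [← hS]
  have ey : Y ^ 2 = -X * (X ^ 2 + 1) * (X ^ 2 - 2 * X - 1) := by
    apply Subtype.ext; push_cast; rw [vX, vY, hy]; rfl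
  have es : S ^ 2 * ((X ^ 2 - 1) ^ 2 * X)
      = -((X ^ 2 - 1) ^ 3 + 4 * X * (X ^ 2 - 1) ^ 2 - 16 * X ^ 3) := by
    apply Subtype.ext; push_cast; rw [vX, vS, hs]; rfl
  have ey' := congrArg red ey
  have es' := congrArg red es
  simp only [map_mul, map_pow, map_add, map_sub, map_neg, map_one, map_ofNat] at ey' es'
  have hcases := special_reduction_charThree x9 y9 s9 ey' es'
  have h2 : red 2 = 2 := map_ofNat red 2
  rw [← h2, ← map_one red, ← map_pow, ← map_mul, ← map_sub, ← map_sub, ← map_sub, ← map_add,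
    hred, hred, hred, hred] at hcases
  push_cast at hcases
  rw [vX, show ((2 : intRing hv) : Ω) = 2 from rfl] at hcases
  rcases hcases with h | h | h | h <;> linarith

end Reduction

theorem exists_algebraicClosure : ∃ (Ω : Type) (_ : Field Ω) (_ : CharZero Ω),
    IsAlgClosed Ω ∧ Algebra.IsAlgebraic ℚ Ω := by
  refine ⟨AlgebraicClosure ℚ, inferInstance, inferInstance, inferInstance, ?_⟩
  have transfer : ∀ i j : Algebra ℚ (AlgebraicClosure ℚ),
      @Algebra.IsAlgebraic ℚ (AlgebraicClosure ℚ) _ _ i →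
      @Algebra.IsAlgebraic ℚ (AlgebraicClosure ℚ) _ _ j := by
    intro i j h
    rwa [Subsingleton.elim j i]
  exact transfer _ _ (AlgebraicClosure.isAlgebraic ℚ)

theorem exists_threeAdic_absoluteValue {Ω : Type*} [Field Ω] [CharZero Ω]
    [Algebra.IsAlgebraic ℚ Ω] :
    ∃ v : AbsoluteValue Ω ℝ, IsNonarchimedean v ∧ v 3 < 1 := by
  let f : Ω →ₐ[ℚ] PadicAlgCl 3 := IsAlgClosed.lift
  refine ⟨(NormedField.toAbsoluteValue (PadicAlgCl 3)).comp (f := f.toRingHom) f.toRingHom.injective, ?_, ?_⟩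
  · intro x y
    show ‖f (x + y)‖ ≤ max ‖f x‖ ‖f y‖
    rw [map_add]
    exact PadicAlgCl.isNonarchimedean 3 (f x) (f y)
  · show ‖f 3‖ < 1
    have e : f 3 = ((3 : ℚ_[3]) : PadicAlgCl 3) := by
      rw [map_ofNat]; norm_cast
    rw [e, PadicAlgCl.norm_extends]
    have := Padic.norm_p_lt_one (p := 3)
    exact_mod_cast this

section QuarticParams

variable {Ω : Type*} [Field Ω] {v : AbsoluteValue Ω ℝ}

theorem v_eq_one_of_mul (hv : IsNonarchimedean v) {x y : Ω} (hx : x ∈ intRing hv)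
    (hy : y ∈ intRing hv) (h : v (x * y) = 1) : v x = 1 := by
  rw [mem_intRing] at hx hy
  rw [map_mul] at h
  nlinarith [v.nonneg x, v.nonneg y]

theorem v_eq_one_of_sq {x : Ω} (h : v (x ^ 2) = 1) : v x = 1 := by
  rw [map_pow] at h
  exact (pow_eq_one_iff_of_nonneg (v.nonneg x) two_ne_zero).1 h

theorem tanParams_of_quartic [CharZero Ω] (hv : IsNonarchimedean v) (h3 : v 3 < 1) {θ ε a : Ω}
    (hθ : θ ^ 4 - 4 * θ ^ 2 + 2 = 0) (hε : ε = θ ^ 2 - 1) (ha : a = 3 + 4 * θ - θ ^ 2 - θ ^ 3) :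
    TanParams v ε a (ε * a ^ 2 / (1 + a ^ 2)) := by
  have m := quartic_root_mem hv hθ
  have v2 := v_two hv h3
  have v4 := v_four hv h3
  have m2 : (2 : Ω) ∈ intRing hv := ofNat_mem _ 2
  have m3 : (3 : Ω) ∈ intRing hv := ofNat_mem _ 3
  have m4 : (4 : Ω) ∈ intRing hv := ofNat_mem _ 4
  have vθ : v (θ ^ 2) = 1 := by
    refine v_eq_one_of_mul hv (y := 4 - θ ^ 2) (pow_mem m 2) (sub_mem m4 (pow_mem m 2)) ?_
    rw [show θ ^ 2 * (4 - θ ^ 2) = 2 by linear_combination -hθ, v2]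
  have mε : ε ∈ intRing hv := by rw [hε]; exact sub_mem (pow_mem m 2) (one_mem _)
  have eps_rel : ε ^ 2 = 2 * ε + 1 := by rw [hε]; linear_combination hθ
  have vε : v ε = 1 := by
    refine v_eq_one_of_mul hv (y := ε - 2) mε (sub_mem mε m2) ?_
    rw [show ε * (ε - 2) = 1 by linear_combination eps_rel, map_one]
  have ma : a ∈ intRing hv := by
    rw [ha]; apply_rules [sub_mem, add_mem, mul_mem, pow_mem]
  have va : v a = 1 := by
    refine v_eq_one_of_mul hv (y := a + 2 * (θ ^ 2 - 3)) ma
      (by apply_rules [sub_mem, add_mem, mul_mem, pow_mem]) ?_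
    rw [ha, quarticTan_unit hθ, map_one]
  have tan_rel : ε * (1 - a ^ 2) = 2 * a := by rw [hε, ha]; exact quarticTan_rel hθ
  have v1s : v (1 - a ^ 2) = 1 := by
    have := congrArg v tan_rel
    rwa [map_mul, map_mul, vε, v2, va, one_mul, one_mul] at this
  have v1a : v (1 + a ^ 2) = 1 := by
    apply v_eq_one_of_sq
    have e : ε ^ 2 * (1 + a ^ 2) ^ 2 = 2 ^ 3 * a ^ 2 * θ ^ 2 := by
      have e1 : 1 + ε ^ 2 = 2 * θ ^ 2 := by rw [hε]; linear_combination hθ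
      linear_combination (ε * (1 - a ^ 2) + 2 * a) * tan_rel + 4 * a ^ 2 * e1
    have := congrArg v e
    simpa only [map_mul, map_pow, vε, v2, va, vθ, one_pow, one_mul, mul_one] using this
  refine { v_eps := vε, v_a := va, v_one_sub := v1s, v_k := ?_, rel := ?_, tan_rel := tan_rel,
           eps_rel := eps_rel, v_one_add := v1a, v_eps_sub := ?_, v_eps_add := ?_, v_two := v2 }
  · rw [map_div₀, map_mul, map_pow, vε, va, v1a]; norm_num
  · exact div_mul_cancel₀ _ (ne_zero_of_v_eq_one v1a)
  · apply v_eq_one_of_sq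
    rw [show (1 - ε) ^ 2 = 2 by linear_combination eps_rel, v2]
  · rw [show 1 + ε = θ ^ 2 by rw [hε]; ring, vθ]

end QuarticParams

section QuarticField

open Polynomial IntermediateField in
theorem exists_quarticField (Ω : Type u) [Field Ω] [CharZero Ω] [IsAlgClosed Ω]
    [Algebra.IsAlgebraic ℚ Ω] :
    ∃ (F : Type u) (_ : Field F) (_ : NumberField F) (_ : Algebra F Ω) (θ : F),
      θ ^ 4 - 4 * θ ^ 2 + 2 = 0 ∧ Module.finrank ℚ F = 4 ∧ IsGalois F Ω := by
  have hd : (X ^ 4 - 4 * X ^ 2 + 2 : ℚ[X]).natDegree = 4 := by compute_degree!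
  have hm : (X ^ 4 - 4 * X ^ 2 + 2 : ℚ[X]).Monic := by monicity!
  obtain ⟨θ, hθ⟩ := IsAlgClosed.exists_aeval_eq_zero Ω (X ^ 4 - 4 * X ^ 2 + 2 : ℚ[X])
    (degree_ne_of_natDegree_ne (by rw [hd]; norm_num))
  have hIntegral : IsIntegral ℚ θ := ⟨_, hm, by rwa [← aeval_def]⟩
  have hmin := minpoly.eq_of_irreducible_of_monic quartic_irreducible hθ hm
  have hfin : FiniteDimensional ℚ ℚ⟮θ⟯ := adjoin.finiteDimensional hIntegral
  have hrank : Module.finrank ℚ ℚ⟮θ⟯ = 4 := by rw [adjoin.finrank hIntegral, ← hmin, hd]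
  have : Algebra.IsAlgebraic ℚ⟮θ⟯ Ω := Algebra.IsAlgebraic.tower_top (K := ℚ) _
  have : IsAlgClosure ℚ⟮θ⟯ Ω := ⟨inferInstance, inferInstance⟩
  refine ⟨ℚ⟮θ⟯, inferInstance, @NumberField.mk _ _ inferInstance ?_, inferInstance, AdjoinSimple.gen ℚ θ, ?_, ?_,
    IsAlgClosure.isGalois _ _⟩
  · exact hfin
  · apply Subtype.ext
    have e : θ ^ 4 - 4 * θ ^ 2 + 2 = 0 := by simpa [map_ofNat] using hθ
    exact e
  · exact hrank

end QuarticField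

section QuadraticField

variable {K : Type*} [Field K] [NumberField K] (hdeg : Module.finrank ℚ K = 2)

include hdeg

open Polynomial in
theorem isQuadratic_of_finrank (z : K) : IsQuadratic z := by
  have hn : (minpoly ℚ z).natDegree < 3 := by
    have := minpoly.natDegree_le (A := ℚ) z
    omega
  have hz := minpoly.aeval ℚ z
  rw [aeval_eq_sum_range' hn] at hz
  refine ⟨(minpoly ℚ z).coeff 2, (minpoly ℚ z).coeff 1, (minpoly ℚ z).coeff 0, ?_, ?_⟩
  · by_contra! hc
    refine minpoly.ne_zero (Algebra.IsIntegral.isIntegral (R := ℚ) z) (Polynomial.ext fun n => ?_)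
    rw [coeff_zero]
    by_cases h : n < 3
    · interval_cases n
      exacts [hc.2.2, hc.2.1, hc.1]
    · exact coeff_eq_zero_of_natDegree_lt (by omega)
  · simp only [Finset.sum_range_succ, Finset.sum_range_zero, Algebra.smul_def,
      eq_ratCast, pow_zero, pow_one] at hz
    linear_combination hz

variable {Ω : Type*} [Field Ω] [CharZero Ω]

theorem exists_two_embeddings [IsAlgClosed Ω] :
    ∃ ι ι' : K →ₐ[ℚ] Ω, ι ≠ ι' ∧ ∀ φ : K →ₐ[ℚ] Ω, φ = ι ∨ φ = ι' := by
  have h : Nat.card (K →ₐ[ℚ] Ω) = 2 := by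
    rw [Nat.card_eq_fintype_card, AlgHom.card, hdeg]
  obtain ⟨ι, ι', hne, hu⟩ := Nat.card_eq_two_iff.1 h
  refine ⟨ι, ι', hne, fun φ => ?_⟩
  have : φ ∈ ({ι, ι'} : Set (K →ₐ[ℚ] Ω)) := hu ▸ Set.mem_univ φ
  simpa using this

theorem rational_of_embeddings_eq {ι ι' : K →ₐ[ℚ] Ω} (hne : ι ≠ ι') {x : K} (hx : ι x = ι' x) :
    ∃ q : ℚ, x = q := by
  have := Subalgebra.isSimpleOrder_of_finrank_prime ℚ K (by rw [hdeg]; exact Nat.prime_two)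
  rcases eq_bot_or_eq_top (AlgHom.equalizer ι ι') with h | h
  · have hm : x ∈ AlgHom.equalizer ι ι' := hx
    rw [h, Algebra.mem_bot] at hm
    obtain ⟨q, hq⟩ := hm
    exact ⟨q, by rw [← hq, eq_ratCast]⟩
  · exact absurd (AlgHom.ext fun z => (h ▸ Algebra.mem_top : z ∈ AlgHom.equalizer ι ι')) hne

omit hdeg in
theorem fixes_or_swaps_embeddings {ι ι' : K →ₐ[ℚ] Ω} (hne : ι ≠ ι')
    (hall : ∀ φ : K →ₐ[ℚ] Ω, φ = ι ∨ φ = ι') (σ : Ω →+* Ω) :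
    (∀ z, σ (ι z) = ι z ∧ σ (ι' z) = ι' z) ∨ (∀ z, σ (ι z) = ι' z ∧ σ (ι' z) = ι z) := by
  have key : ∀ φ : K →ₐ[ℚ] Ω, (∀ z, σ (φ z) = ι z) ∨ (∀ z, σ (φ z) = ι' z) := fun φ => by
    rcases hall ((σ.comp φ.toRingHom).toRatAlgHom) with h | h
    · exact .inl fun z => DFunLike.congr_fun h z
    · exact .inr fun z => DFunLike.congr_fun h z
  rcases key ι with h | h <;> rcases key ι' with h' | h'
  · exact absurd (AlgHom.ext fun z => σ.injective ((h z).trans (h' z).symm)) hne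
  · exact .inl fun z => ⟨h z, h' z⟩
  · exact .inr fun z => ⟨h z, h' z⟩
  · exact absurd (AlgHom.ext fun z => σ.injective ((h z).trans (h' z).symm)) hne

omit hdeg in
theorem IsQuadratic.map {z : K} (h : IsQuadratic z) (ι : K →ₐ[ℚ] Ω) : IsQuadratic (ι z) := by
  obtain ⟨a, b, c, h0, h⟩ := h
  refine ⟨a, b, c, h0, ?_⟩
  simpa only [map_add, map_mul, map_pow, map_ratCast, map_zero] using congrArg ι h

theorem rational_of_quintic {x y s : K} (hy : y ^ 2 = -x * (x ^ 2 + 1) * (x ^ 2 - 2 * x - 1))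
    (hs : s ^ 2 * ((x ^ 2 - 1) ^ 2 * x)
      = -((x ^ 2 - 1) ^ 3 + 4 * x * (x ^ 2 - 1) ^ 2 - 16 * x ^ 3))
    (hy0 : y ≠ 0) (hx1 : x ≠ 1) (hx2 : x ≠ -1) : ∃ q : ℚ, x = q := by
  classical
  obtain ⟨Ω, _, _, _, _⟩ := exists_algebraicClosure
  obtain ⟨v, hv, h3⟩ := exists_threeAdic_absoluteValue (Ω := Ω)
  obtain ⟨F, _, _, _, θ, hθ, hF, _⟩ := exists_quarticField Ω
  obtain ⟨ι, ι', hne, hall⟩ := exists_two_embeddings (Ω := Ω) hdeg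
  obtain ⟨ε', hε'⟩ : ∃ ε' : F, ε' = θ ^ 2 - 1 := ⟨_, rfl⟩
  obtain ⟨a', ha'⟩ : ∃ a' : F, a' = 3 + 4 * θ - θ ^ 2 - θ ^ 3 := ⟨_, rfl⟩
  obtain ⟨t, ht⟩ : ∃ t, algebraMap F Ω θ = t := ⟨_, rfl⟩
  obtain ⟨ε, hε⟩ : ∃ ε, algebraMap F Ω ε' = ε := ⟨_, rfl⟩
  obtain ⟨a, ha⟩ : ∃ a, algebraMap F Ω a' = a := ⟨_, rfl⟩
  have htq : t ^ 4 - 4 * t ^ 2 + 2 = 0 := by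
    have := congrArg (algebraMap F Ω) hθ
    simpa only [map_add, map_sub, map_mul, map_pow, map_ofNat, map_zero, ht] using this
  have hp := tanParams_of_quartic hv h3 htq (ε := ε) (a := a)
    (by rw [← hε, hε', map_sub, map_pow, map_one, ht])
    (by rw [← ha, ha']; simp only [map_add, map_sub, map_mul, map_pow, map_ofNat, ht])
  obtain ⟨k, hk⟩ : ∃ k, k = ε * a ^ 2 / (1 + a ^ 2) := ⟨_, rfl⟩
  rw [← hk] at hp
  have hunr : ∀ u : F, v (algebraMap F Ω u) < 1 → v (algebraMap F Ω u) ≤ v 3 := fun u => by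
    obtain ⟨b, c, d, e, rfl⟩ := quartic_coordinates hθ hF u
    simp only [map_add, map_mul, map_pow, map_ratCast, ht]
    exact quartic_unramified hv h3 htq
  have hfix : ∀ z : Ω, (∀ σ : Ω →ₐ[F] Ω, σ z = z) → z ∈ (algebraMap F Ω).range := fun z hz =>
    (InfiniteGalois.mem_range_algebraMap_iff_fixed z).2 fun σ => hz σ.toAlgHom
  have hε0 := hp.eps_ne_zero
  have ha0 := hp.a_ne_zero
  have hε0' : ε' ≠ 0 := by rintro rfl; exact hε0 (by rw [← hε, map_zero])
  have ha0' : a' ≠ 0 := by rintro rfl; exact ha0 (by rw [← ha, map_zero])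
  have hrel' : ε' * (1 - a' ^ 2) = 2 * a' := by rw [hε', ha']; exact quarticTan_rel hθ
  have := isElliptic_of_rel hε0 ha0 hp.tan_rel
  have := isElliptic_of_rel hε0' ha0' hrel'
  have := finite_sixteen hθ hF hε' ha' hε0' ha0' hrel'
  have special : ∀ φ : K →ₐ[ℚ] Ω, HasSpecialReduction v ε a k (φ x) (φ y) := fun φ => by
    have ey : φ y ^ 2 = -φ x * (φ x ^ 2 + 1) * (φ x ^ 2 - 2 * φ x - 1) := by
      simpa only [map_add, map_sub, map_neg, map_mul, map_pow, map_ofNat, map_one]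
        using congrArg φ hy
    have es : φ s ^ 2 * ((φ x ^ 2 - 1) ^ 2 * φ x)
        = -((φ x ^ 2 - 1) ^ 3 + 4 * φ x * (φ x ^ 2 - 1) ^ 2 - 16 * φ x ^ 3) := by
      simpa only [map_add, map_sub, map_neg, map_mul, map_pow, map_ofNat, map_one]
        using congrArg φ hs
    refine hp.hasSpecialReduction hv ey ?_ ?_ ?_ (reduction_cases hv h3
      ((isQuadratic_of_finrank hdeg x).map φ) ((isQuadratic_of_finrank hdeg y).map φ)
      ((isQuadratic_of_finrank hdeg s).map φ) ey es)
    · exact (map_ne_zero φ).2 hy0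
    · rw [← map_one φ]; exact φ.injective.ne hx1
    · rw [← map_one φ, ← map_neg]; exact φ.injective.ne hx2
  obtain ⟨d₁, w₁, η₁, s₁, g₁, h₁⟩ := special ι
  obtain ⟨d₂, w₂, η₂, s₂, g₂, h₂⟩ := special ι'
  have hσa : ∀ σ : Ω →ₐ[F] Ω, σ a = a := fun σ => by rw [← ha, σ.commutes]
  have hσε : ∀ σ : Ω →ₐ[F] Ω, σ ε = ε := fun σ => by rw [← hε, σ.commutes]
  have hw := h₁.eq_of_galois hv hp.toSexticParams h3 hunr hfix hε ha h₂ (s₁.separated hv hp s₂)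
    (fun σ => by
      have e₁ := g₁ σ.toRingHom (hσa σ) (hσε σ)
      have e₂ := g₂ σ.toRingHom (hσa σ) (hσε σ)
      exact ⟨e₁.1, e₁.2, e₂.1, e₂.2⟩)
    (fun σ => by
      simp only [FixesOrSwaps, map_div₀, map_mul, map_pow, map_add, map_sub, map_one, map_ofNat,
        hσa, hσε]
      rcases fixes_or_swaps_embeddings hne hall σ.toRingHom with h | h
      · have f1 : ∀ z, σ (ι z) = ι z := fun z => (h z).1
        have f2 : ∀ z, σ (ι' z) = ι' z := fun z => (h z).2
        left; simp only [f1, f2, and_self]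
      · have f1 : ∀ z, σ (ι z) = ι' z := fun z => (h z).1
        have f2 : ∀ z, σ (ι' z) = ι z := fun z => (h z).2
        right; simp only [f1, f2, and_self])
  rw [div_eq_div_iff d₁ d₂] at hw
  refine rational_of_embeddings_eq hdeg hne (sub_eq_zero.1 ?_)
  refine (mul_eq_zero.1 ?_).resolve_left (ne_zero_of_v_eq_one hp.v_one_add)
  linear_combination hw

end QuadraticField

section Cycles

variable {K : Type*} [Field K] [CharZero K]

theorem three_cycle {α₀ α₁ α₂ c : K} (h₀ : α₀ ^ 2 + c = α₁) (h₁ : α₁ ^ 2 + c = α₂)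
    (h₂ : α₂ ^ 2 + c = α₀) (hne : α₁ ≠ α₀) :
    ∃ t s : K, t ≠ 0 ∧ t + 1 ≠ 0 ∧ t ^ 3 + t ^ 2 - 2 * t - 1 = s * (t * (t + 1)) ∧
      s ^ 2 = -4 * c - 7 := by
  obtain ⟨t, ht⟩ : ∃ t, t = α₀ + α₁ := ⟨_, rfl⟩
  obtain ⟨t₂, ht₂⟩ : ∃ t₂, t₂ = α₁ + α₂ := ⟨_, rfl⟩
  obtain ⟨t₃, ht₃⟩ : ∃ t₃, t₃ = α₂ + α₀ := ⟨_, rfl⟩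
  have hd : α₁ - α₀ ≠ 0 := sub_ne_zero.2 hne
  have e₁ : (α₁ - α₀) * t = α₂ - α₁ := by rw [ht]; linear_combination h₁ - h₀
  have e₂ : (α₂ - α₁) * t₂ = α₀ - α₂ := by rw [ht₂]; linear_combination h₂ - h₁
  have e₃ : (α₀ - α₂) * t₃ = α₁ - α₀ := by rw [ht₃]; linear_combination h₀ - h₂
  have r₂ : t * t₂ = -(t + 1) := mul_left_cancel₀ hd (by
    linear_combination e₂ + (t₂ + 1) * e₁)
  have r₃ : (t + 1) * t₃ = -1 := mul_left_cancel₀ hd (by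
    linear_combination -e₃ + t₃ * e₁)
  have n₁ : t + 1 ≠ 0 := by intro h; rw [h, zero_mul] at r₃; norm_num at r₃
  have n₀ : t ≠ 0 := by
    rintro rfl; rw [zero_mul] at r₂; norm_num at r₂
  have f₂ : t₂ = -(t + 1) / t := by rw [eq_div_iff n₀]; linear_combination r₂
  have f₃ : t₃ = -1 / (t + 1) := by rw [eq_div_iff n₁]; linear_combination r₃
  have g₀ : α₀ = (t - t₂ + t₃) / 2 := by rw [ht, ht₂, ht₃]; ring
  have g₁ : α₁ = (t + t₂ - t₃) / 2 := by rw [ht, ht₂, ht₃]; ring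
  have hc : c = (t + t₂ - t₃) / 2 - ((t - t₂ + t₃) / 2) ^ 2 := by
    rw [← g₀, ← g₁]; linear_combination h₀
  refine ⟨t, (t ^ 3 + t ^ 2 - 2 * t - 1) / (t * (t + 1)), n₀, n₁, ?_, ?_⟩
  · rw [div_mul_cancel₀]; exact mul_ne_zero n₀ n₁
  · rw [hc, f₂, f₃]; field_simp; ring

theorem four_cycle {β₀ β₁ β₂ β₃ c : K} (h₀ : β₀ ^ 2 + c = β₁) (h₁ : β₁ ^ 2 + c = β₂)
    (h₂ : β₂ ^ 2 + c = β₃) (h₃ : β₃ ^ 2 + c = β₀) (hne : β₂ ≠ β₀) :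
    ∃ x y : K, y ^ 2 = -x * (x ^ 2 + 1) * (x ^ 2 - 2 * x - 1) ∧ y ≠ 0 ∧ x ≠ 1 ∧ x ≠ -1 ∧
      (-4 * c - 7) * ((x ^ 2 - 1) ^ 2 * x)
        = -((x ^ 2 - 1) ^ 3 + 4 * x * (x ^ 2 - 1) ^ 2 - 16 * x ^ 3) := by
  obtain ⟨A, hA⟩ : ∃ A, A = β₀ + β₂ := ⟨_, rfl⟩
  obtain ⟨B, hB⟩ : ∃ B, B = β₁ + β₃ := ⟨_, rfl⟩
  obtain ⟨u, hu⟩ : ∃ u, u = β₀ - β₂ := ⟨_, rfl⟩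
  have u0 : u ≠ 0 := by rw [hu]; exact sub_ne_zero.2 hne.symm
  have hv : β₁ - β₃ = u * A := by rw [hu, hA]; linear_combination h₂ - h₀
  have hAB : A * B = -1 := mul_left_cancel₀ u0 (by
    rw [← mul_assoc, ← hv, hB, hu]; linear_combination h₁ - h₃)
  have A0 : A ≠ 0 := by rintro rfl; norm_num at hAB
  have hc : c = (B - (A ^ 2 + u ^ 2) / 2) / 2 := by
    rw [hA, hB, hu]; linear_combination (h₀ + h₂) / 2
  have hc' : c = (A - (B ^ 2 + (u * A) ^ 2) / 2) / 2 := by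
    rw [← hv, hA, hB]; linear_combination (h₁ + h₃) / 2
  have hB' : B = -1 / A := by rw [eq_div_iff A0]; linear_combination hAB
  have hq : u ^ 2 * (A ^ 2 * ((1 - A) * (1 + A))) = (1 + A ^ 2) * (1 - 2 * A - A ^ 2) := by
    have e := hc.symm.trans hc'
    rw [hB'] at e
    field_simp at e
    linear_combination -e
  have n₁ : 1 - A ≠ 0 := fun h => by
    rw [h, show A = 1 by linear_combination -h] at hq; norm_num at hq
  have n₂ : 1 + A ≠ 0 := fun h => by
    rw [h, show A = -1 by linear_combination h] at hq; norm_num at hq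
  have hU : u ^ 2 = (1 + A ^ 2) * (1 - 2 * A - A ^ 2) / (A ^ 2 * ((1 - A) * (1 + A))) := by
    rw [eq_div_iff (mul_ne_zero (pow_ne_zero 2 A0) (mul_ne_zero n₁ n₂))]; exact hq
  refine ⟨(1 + A) / (1 - A), 2 * u * A * (1 + A) / (1 - A) ^ 2, ?_, ?_, ?_, ?_, ?_⟩
  · rw [show (2 * u * A * (1 + A) / (1 - A) ^ 2) ^ 2
      = 4 * u ^ 2 * A ^ 2 * (1 + A) ^ 2 / (1 - A) ^ 4 by rw [div_pow, ← pow_mul]; congr 1; ring, hU]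
    field_simp
    ring
  · exact div_ne_zero (mul_ne_zero (mul_ne_zero (mul_ne_zero two_ne_zero u0) A0) n₂)
      (pow_ne_zero 2 n₁)
  · rw [Ne, div_eq_one_iff_eq n₁]
    intro h
    apply A0
    linear_combination h / 2
  · rw [Ne, div_eq_iff n₁]
    intro h
    exact two_ne_zero (α := K) (by linear_combination h)
  · rw [hc, hB', hU]
    field_simp
    ring

end Cycles

section Descent

theorem not_sq_eq_five (q : ℚ) : q ^ 2 ≠ 5 := by
  intro h
  have h5 : IsSquare (5 : ℚ) := ⟨q, by rw [← h]; ring⟩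
  rw [show (5 : ℚ) = ((5 : ℕ) : ℚ) by norm_num, Rat.isSquare_natCast_iff] at h5
  obtain ⟨n, hn⟩ := h5
  have : n ≤ 2 := by nlinarith
  interval_cases n <;> omega

theorem no_rational_sextic_point {x s : ℚ} (hx0 : x ≠ 0) (hx1 : x ≠ 1) (hx2 : x ≠ -1)
    (hs : s ^ 2 * ((x ^ 2 - 1) ^ 2 * x)
      = -((x ^ 2 - 1) ^ 3 + 4 * x * (x ^ 2 - 1) ^ 2 - 16 * x ^ 3)) : False := by
  have := finite_eleven
  obtain ⟨z, hz⟩ : ∃ z, z * x = x ^ 2 - 1 := ⟨(x ^ 2 - 1) / x, div_mul_cancel₀ _ hx0⟩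
  have e : (z * s) ^ 2 = (-z) ^ 3 - 4 * (-z) ^ 2 + 16 := by
    rw [← hz] at hs
    refine mul_right_cancel₀ (pow_ne_zero 3 hx0) ?_
    linear_combination hs
  rcases eleven_points e with h | h
  · have : (x - 1) * (x + 1) = 0 := by linear_combination -hz - x * h
    rcases mul_eq_zero.1 this with h | h
    · exact hx1 (by linear_combination h)
    · exact hx2 (by linear_combination h)
  · exact not_sq_eq_five (x + 2) (by linear_combination -hz - x * h)

theorem quadratic_relation {e₁ e₂ : ℚ}
    (h : e₁ ^ 2 * (e₂ - 1) + e₁ * (e₂ ^ 2 - e₂ - 1) - 2 * e₂ = 0) :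
    e₂ = 0 ∨ e₁ = -2 ∧ e₂ = 1 := by
  obtain ⟨p, hp⟩ : ∃ p, p = e₂ ^ 2 - e₂ + 3 + (2 * (e₂ - 1) * e₁ + (e₂ ^ 2 - e₂ - 1)) := ⟨_, rfl⟩
  have hq : p ^ 2 - 2 * (e₂ ^ 2 - e₂ + 3) * p + 8 = 0 := by
    rw [hp]; linear_combination 4 * (e₂ - 1) * h
  have hY : (2 * p * (2 * e₂ - 1)) ^ 2 = (2 * p) ^ 3 - 11 * (2 * p) ^ 2 + 32 * (2 * p) := by
    linear_combination -8 * p * hq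
  have hm : e₂ * (e₂ - 1) = 0 := by
    rcases fourteen_points hY with h | h | h
    · rw [show p = 0 by linear_combination h / 2] at hq; norm_num at hq
    · rw [show p = 2 by linear_combination h / 2] at hq; linear_combination -hq / 4
    · rw [show p = 4 by linear_combination h / 2] at hq; linear_combination -hq / 8
  rcases mul_eq_zero.1 hm with h' | h'
  · exact .inl h'
  · have h1 : e₂ = 1 := by linear_combination h'
    rw [h1] at h
    exact .inr ⟨by linear_combination -h, h1⟩

variable {K : Type*} [Field K] [NumberField K] (hdeg : Module.finrank ℚ K = 2)

theorem coordinates_eq_zero {s : K} (hs : ∀ q : ℚ, s ≠ q) {a b : ℚ} (h : (a : K) + b * s = 0) :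
    a = 0 ∧ b = 0 := by
  have hb : b = 0 := by
    by_contra hb
    have hb' : (b : K) ≠ 0 := by exact_mod_cast hb
    apply hs (-a / b)
    push_cast
    rw [eq_div_iff hb']
    linear_combination h
  rw [hb, Rat.cast_zero, zero_mul, add_zero] at h
  exact ⟨by exact_mod_cast h, hb⟩

include hdeg in
theorem exists_eq_add_mul {s : K} (hs : ∀ q : ℚ, s ≠ q) (t : K) : ∃ p q : ℚ, t = p + q * s := by
  have hli : LinearIndependent ℚ ![(1 : K), s] := by
    rw [LinearIndependent.pair_iff]
    intro a b h
    simp only [Algebra.smul_def, eq_ratCast, mul_one] at h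
    exact coordinates_eq_zero hs h
  have hspan := hli.span_eq_top_of_card_eq_finrank (by rw [hdeg]; rfl)
  have ht : t ∈ Submodule.span ℚ (Set.range ![(1 : K), s]) := hspan ▸ Submodule.mem_top
  rw [Matrix.range_cons, Matrix.range_cons, Matrix.range_empty, Set.union_empty,
    Set.singleton_union, Submodule.mem_span_pair] at ht
  obtain ⟨p, q, h⟩ := ht
  exact ⟨p, q, by rw [← h, Algebra.smul_def, Algebra.smul_def, eq_ratCast, eq_ratCast, mul_one]⟩

include hdeg in
theorem rational_of_threeCycle {t s : K} {r : ℚ} (hr : s ^ 2 = r) (ht0 : t ≠ 0) (ht1 : t + 1 ≠ 0)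
    (h : t ^ 3 + t ^ 2 - 2 * t - 1 = s * (t * (t + 1))) : ∃ q : ℚ, s = q := by
  by_contra! hs
  obtain ⟨p, q, rfl⟩ := exists_eq_add_mul hdeg hs t
  obtain ⟨E₁, E₂⟩ := coordinates_eq_zero hs
    (a := p ^ 3 + 3 * p * (q ^ 2 * r) + p ^ 2 + q ^ 2 * r - 2 * p - 1 - r * q * (2 * p + 1))
    (b := q * (3 * p ^ 2 + q ^ 2 * r + 2 * p - 2) - (p ^ 2 + q ^ 2 * r + p)) (by
      push_cast
      rw [← hr]
      linear_combination h)
  have hq : q ≠ 0 := by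
    rintro rfl
    rcases mul_eq_zero.1 (show p * (p + 1) = 0 by linear_combination -E₂) with hp | hp
    · exact ht0 (by rw [hp]; norm_num)
    · exact ht1 (by rw [show p = -1 by linear_combination hp]; norm_num)
  have E : (2 * p) ^ 2 * (p ^ 2 - q ^ 2 * r - 1)
      + (2 * p) * ((p ^ 2 - q ^ 2 * r) ^ 2 - (p ^ 2 - q ^ 2 * r) - 1)
      - 2 * (p ^ 2 - q ^ 2 * r) = 0 := by
    refine (mul_eq_zero.1 ?_).resolve_left hq
    linear_combination 2 * q * (p ^ 2 + q ^ 2 * r + p) * E₁ - 2 * (q ^ 2 * r) * (2 * p + 1) * E₂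
  have hroot : ((p : K) + q * s) ^ 2 - 2 * p * (p + q * s) + (p ^ 2 - q ^ 2 * r) = 0 := by
    rw [← hr]; ring
  rcases quadratic_relation E with h2 | ⟨h1, h2⟩
  · have h2' : (p : K) ^ 2 - q ^ 2 * r = 0 := by exact_mod_cast h2
    have hconj : ((p : K) - q * s) * (p + q * s) = 0 := by rw [← h2', ← hr]; ring
    have hz := (mul_eq_zero.1 hconj).resolve_right ht0
    obtain ⟨-, hq0⟩ := coordinates_eq_zero hs (a := p) (b := -q) (by push_cast; linear_combination hz)
    exact hq (neg_eq_zero.1 hq0)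
  · have h2' : (p : K) ^ 2 - q ^ 2 * r = 1 := by exact_mod_cast h2
    have h1' : 2 * (p : K) = -2 := by exact_mod_cast h1
    rw [h2', h1'] at hroot
    exact ht1 (pow_eq_zero_iff two_ne_zero |>.1 (by linear_combination hroot))

end Descent

end CubicCurve

open CubicCurve in
theorem no_periods_3_and_4 {K : Type*} [Field K] [NumberField K]
    (hdeg : Module.finrank ℚ K = 2) (c : K) :
    ¬∃ α β : K, HasExactPeriod c 3 α ∧ HasExactPeriod c 4 β := by
  rintro ⟨α, β, ⟨hα, hα'⟩, ⟨hβ, hβ'⟩⟩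
  obtain ⟨t, s, ht0, ht1, ht, hs⟩ := three_cycle (c := c) (α₀ := α) rfl rfl hα
    (hα' 1 le_rfl (by norm_num))
  obtain ⟨x, y, hy, hy0, hx1, hx2, hx⟩ := four_cycle (c := c) (β₀ := β) rfl rfl rfl hβ
    (hβ' 2 (by norm_num) (by norm_num))
  rw [← hs] at hx
  have hx0 : x ≠ 0 := by
    rintro rfl
    exact hy0 (by simpa using hy)
  obtain ⟨q, rfl⟩ := rational_of_quintic hdeg hy hx hy0 hx1 hx2
  have q0 : q ≠ 0 := by exact_mod_cast hx0
  have q1 : q ≠ 1 := by exact_mod_cast hx1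
  have q2 : q ≠ -1 := by exact_mod_cast hx2
  have hd : (q ^ 2 - 1) ^ 2 * q ≠ 0 := by
    rw [show (q ^ 2 - 1) ^ 2 * q = ((q - 1) * (q - -1)) ^ 2 * q by ring]
    exact mul_ne_zero (pow_ne_zero 2 (mul_ne_zero (sub_ne_zero.2 q1) (sub_ne_zero.2 q2))) q0
  have hd' : (((q : K) ^ 2 - 1) ^ 2 * q) ≠ 0 := by exact_mod_cast hd
  obtain ⟨r, rfl⟩ := rational_of_threeCycle hdeg (t := t) (s := s)
    (r := -((q ^ 2 - 1) ^ 3 + 4 * q * (q ^ 2 - 1) ^ 2 - 16 * q ^ 3) / ((q ^ 2 - 1) ^ 2 * q))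
    (by push_cast; rw [eq_div_iff hd', hx]) ht0 ht1 ht
  exact no_rational_sextic_point q0 q1 q2 (s := r) (by exact_mod_cast hx)
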